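/- Let p be an odd prime, n a positive integer, and let f ∈ F_{p^n}[X] be monic of degree d with d ≡ 1 (mod p). If f is exceptional planar, then f(X) = X^{p^k+1} + h(X) for some positive integer k and some polynomial h ∈ F_{p^n}[X] whose degree e satisfies e < p^k + 1 and, moreover, p divides e or p divides e − 1. -/

import Mathlib

open Polynomial

/-- A function on a field of odd characteristic is planar if for every nonzero `ε`
the map `x ↦ f (x + ε) - f x` is a bijection. -/
def IsPlanarOdd {F : Type} [Field F] (f : F → F) : Prop :=
  ∀ ε : F, ε ≠ 0 → Function.Bijective (fun x : F => f (x + ε) - f x)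

/-- A polynomial over a finite field `K` (of odd order) is exceptional planar if for
infinitely many positive integers `r` it induces a planar function on the extension
of `K` of degree `r`. -/
def IsExceptionalPlanarOdd {K : Type} [Field K] [Fintype K] (f : K[X]) : Prop :=
  Set.Infinite {r : ℕ | 0 < r ∧ ∀ (L : Type) [Field L] [Fintype L] [Algebra K L],
      Fintype.card L = Fintype.card K ^ r →
      IsPlanarOdd (fun x : L => Polynomial.aeval x f)}



section F1
variable {k : Type} [Field k]

/-- weight bound: monomials `x^i y^l` have weight `i + c l` -/
def Wt (c n : ℕ) (G : k[X][X]) : Prop :=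
  ∀ l, G.coeff l = 0 ∨ (G.coeff l).natDegree + c * l ≤ n

theorem Wt.mono {c n m : ℕ} {G : k[X][X]} (h : Wt c n G) (hnm : n ≤ m) : Wt c m G := by
  intro l
  rcases h l with h | h
  · exact Or.inl h
  · exact Or.inr (by omega)

theorem Wt.zero (c n : ℕ) : Wt c n (0 : k[X][X]) := fun l => Or.inl (by simp)

theorem Wt.add {c n : ℕ} {G H : k[X][X]} (hG : Wt c n G) (hH : Wt c n H) : Wt c n (G + H) := by
  intro l
  rcases hG l with h | h <;> rcases hH l with h' | h'
  · left; simp [h, h']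
  · right; simp [h, h']
  · right; simp [h, h']
  · right
    rw [coeff_add]
    have := natDegree_add_le (G.coeff l) (H.coeff l)
    rcases max_le_iff.mpr ⟨h, h'⟩ with _
    have : max (G.coeff l).natDegree (H.coeff l).natDegree + c * l ≤ n := by
      rcases le_total (G.coeff l).natDegree (H.coeff l).natDegree with h1 | h1
      · rw [max_eq_right h1]; exact h'
      · rw [max_eq_left h1]; exact h
    omega

theorem Wt.neg {c n : ℕ} {G : k[X][X]} (hG : Wt c n G) : Wt c n (-G) := by
  intro l
  rcases hG l with h | h
  · left; simp [h]
  · right; simpa using h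

theorem Wt.sub {c n : ℕ} {G H : k[X][X]} (hG : Wt c n G) (hH : Wt c n H) : Wt c n (G - H) := by
  rw [sub_eq_add_neg]; exact hG.add hH.neg

theorem Wt.sum {ι : Type*} {c n : ℕ} (s : Finset ι) (G : ι → k[X][X])
    (h : ∀ i ∈ s, Wt c n (G i)) : Wt c n (∑ i ∈ s, G i) := by
  classical
  induction s using Finset.induction_on with
  | empty => simpa using Wt.zero c n
  | insert a s ha ih =>
    rw [Finset.sum_insert ha]
    exact (h a (by simp)).add (ih fun i hi => h i (by simp [hi]))

theorem Wt.mul {c n m : ℕ} {G H : k[X][X]} (hG : Wt c n G) (hH : Wt c m H) :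
    Wt c (n + m) (G * H) := by
  intro l
  by_cases h0 : (G * H).coeff l = 0
  · exact Or.inl h0
  right
  rw [coeff_mul] at *
  have hle : c * l ≤ n + m := by
    obtain ⟨x, hx, hne⟩ := Finset.exists_ne_zero_of_sum_ne_zero h0
    have h1 := (hG x.1).resolve_left (left_ne_zero_of_mul hne)
    have h2 := (hH x.2).resolve_left (right_ne_zero_of_mul hne)
    rw [Finset.HasAntidiagonal.mem_antidiagonal] at hx
    rw [← hx]; nlinarith
  have : (∑ x ∈ Finset.HasAntidiagonal.antidiagonal l, G.coeff x.1 * H.coeff x.2).natDegree ≤ n + m - c * l := by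
    apply natDegree_sum_le_of_forall_le
    intro x hx
    rw [Finset.HasAntidiagonal.mem_antidiagonal] at hx
    rcases hG x.1 with h | h
    · simp [h]
    rcases hH x.2 with h' | h'
    · simp [h']
    have := natDegree_mul_le (p := G.coeff x.1) (q := H.coeff x.2)
    have e : c * l = c * x.1 + c * x.2 := by rw [← hx]; ring
    omega
  omega

theorem Wt.C_C (c n : ℕ) (a : k) : Wt c n (C (C a)) := by
  intro l
  rcases Nat.eq_zero_or_pos l with rfl | h
  · right; simp
  · left; rw [coeff_C, if_neg h.ne']

theorem Wt.CX (c : ℕ) : Wt c 1 (C X : k[X][X]) := by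
  intro l
  rcases Nat.eq_zero_or_pos l with rfl | h
  · right; simp
  · left; rw [coeff_C, if_neg h.ne']

theorem Wt.Y (c : ℕ) : Wt c c (X : k[X][X]) := by
  intro l
  rw [coeff_X]
  split_ifs with h
  · right; simp [← h]
  · left; rfl

theorem Wt.one (c n : ℕ) : Wt c n (1 : k[X][X]) := by
  simpa using Wt.C_C c n (1 : k)

theorem Wt.pow {c n : ℕ} {G : k[X][X]} (hG : Wt c n G) (m : ℕ) : Wt c (m * n) (G ^ m) := by
  induction m with
  | zero => simpa using Wt.one c 0
  | succ m ih => rw [pow_succ, Nat.succ_mul]; exact ih.mul hG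

theorem Wt.of_bound {c D κ : ℕ} {G : k[X][X]} (h : ∀ l, (G.coeff l).natDegree ≤ D)
    (hκ : G.natDegree ≤ κ) : Wt c (D + c * κ) G := by
  intro l
  by_cases hl : l ≤ κ
  · right; have := h l; have := Nat.mul_le_mul_left c hl; omega
  · left; exact coeff_eq_zero_of_natDegree_lt (by omega)

theorem Wt.natDegree_le {c n : ℕ} {G : k[X][X]} (h : Wt c n G) (l : ℕ) :
    (G.coeff l).natDegree ≤ n := by
  rcases h l with h | h
  · simp [h]
  · omega

theorem Wt.monic {c κ : ℕ} {h : k[X][X]} (hm : h.Monic) (hκ : h.natDegree = κ)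
    (hc : ∀ l, (h.coeff l).natDegree ≤ c) : Wt c (c * κ) h := by
  intro l
  rcases lt_trichotomy l κ with hl | hl | hl
  · right
    have := hc l
    have : c * (l + 1) ≤ c * κ := Nat.mul_le_mul_left c hl
    rw [mul_add] at this; omega
  · right; subst hl; rw [← hκ, hm.coeff_natDegree]; simp
  · left; exact coeff_eq_zero_of_natDegree_lt (by omega)

theorem Wt.modByMonic {c κ : ℕ} {h : k[X][X]} (hm : h.Monic) (hκ : h.natDegree = κ)
    (hc : ∀ l, (h.coeff l).natDegree ≤ c) {n : ℕ} : ∀ {G : k[X][X]}, Wt c n G →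
    Wt c n (G %ₘ h) := by
  have main : ∀ N, ∀ G : k[X][X], G.natDegree < N → Wt c n G → Wt c n (G %ₘ h) := by
    intro N
    induction N with
    | zero => intro G hG; omega
    | succ N ih =>
      intro G hG hw
      by_cases hd : G.degree < h.degree
      · rwa [(modByMonic_eq_self_iff hm).mpr hd]
      have hG0 : G ≠ 0 := by
        rintro rfl
        apply hd
        rw [degree_zero]
        exact bot_lt_iff_ne_bot.mpr (by simpa using hm.ne_zero)
      have hle : κ ≤ G.natDegree := by
        rw [← hκ]; exact natDegree_le_natDegree (not_lt.mp hd)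
      obtain ⟨t, ht⟩ : ∃ t : k[X][X], t = C G.leadingCoeff * X ^ (G.natDegree - κ) := ⟨_, rfl⟩
      have hlc : G.leadingCoeff ≠ 0 := leadingCoeff_ne_zero.mpr hG0
      have e1 : G %ₘ h = (G - h * t) %ₘ h := by
        rw [sub_modByMonic]
        rw [(modByMonic_eq_zero_iff_dvd hm).mpr (Dvd.intro _ rfl), sub_zero]
      have htw : Wt c (n - c * κ) t := by
        intro l
        rw [ht, coeff_C_mul, coeff_X_pow]
        split_ifs with hl
        · right
          have := (hw G.natDegree).resolve_left hlc
          rw [mul_one]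
          have e : c * G.natDegree = c * l + c * κ := by
            rw [← mul_add]; congr 1; omega
          rw [leadingCoeff] ; omega
        · left; simp
      have hnk : c * κ ≤ n := by
        have := (hw G.natDegree).resolve_left hlc
        have := Nat.mul_le_mul_left c hle
        omega
      have hw' : Wt c n (G - h * t) := by
        refine hw.sub ?_
        have := (Wt.monic hm hκ hc).mul htw
        rwa [Nat.add_sub_cancel' hnk] at this
      rw [e1]
      by_cases hz : G - h * t = 0
      · rw [hz]; simpa using Wt.zero c n
      apply ih _ _ hw'
      have hdt : degree (G - h * t) < degree G := by
        rw [ht, ← hκ]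
        exact div_wf_lemma ⟨not_lt.mp hd, hG0⟩ hm
      have := natDegree_lt_natDegree hz hdt
      omega
  exact fun {G} hw => main _ G (Nat.lt_succ_self _) hw

/-- polynomials with prescribed coefficients in a box -/
noncomputable def box (κ n : ℕ) (b : Fin κ → Fin n → k) : k[X][X] :=
  ∑ l : Fin κ, ∑ i : Fin n, C (C (b l i)) * (C X ^ (i : ℕ) * X ^ (l : ℕ))

theorem box_coeff (κ n : ℕ) (b : Fin κ → Fin n → k) (l : Fin κ) (i : Fin n) :
    ((box κ n b).coeff l).coeff i = b l i := by
  have : ∀ (l' : Fin κ) (i' : Fin n), ((C (C (b l' i')) * (C X ^ (i' : ℕ) * X ^ (l' : ℕ)) : k[X][X]).coeff l).coeff i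
      = if l' = l then (if i' = i then b l' i' else 0) else 0 := by
    intro l' i'
    rw [← C_pow, ← mul_assoc, ← C_mul, coeff_C_mul, coeff_X_pow]
    by_cases h : l' = l
    · subst h
      simp only [if_true, mul_one, coeff_C_mul, coeff_X_pow]
      by_cases h2 : i' = i
      · simp [h2]
      · have : (i:ℕ) ≠ i' := fun h => h2 (Fin.ext h.symm)
        simp [h2, this]
    · have : (l:ℕ) ≠ l' := fun hh => h (Fin.ext hh.symm)
      simp [h, this]
  simp only [box, finsetSum_coeff, this]
  simp

theorem box_wt (c κ n : ℕ) (b : Fin κ → Fin n → k) : Wt c (n + c * κ) (box κ n b) := by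
  refine Wt.sum _ _ fun l _ => Wt.sum _ _ fun i _ => ?_
  have h1 := (Wt.C_C c 0 (b l i)).mul (((Wt.CX (k := k) c).pow (i:ℕ)).mul ((Wt.Y c).pow (l:ℕ)))
  refine h1.mono ?_
  have := i.2
  have h3 : (l:ℕ) * c ≤ c * κ := by rw [mul_comm]; exact Nat.mul_le_mul_left c l.2.le
  omega

theorem box_degree (κ n : ℕ) (b : Fin κ → Fin n → k) : (box κ n b).degree < κ := by
  rw [degree_lt_iff_coeff_zero]
  intro m hm
  simp only [box, finsetSum_coeff]
  refine Finset.sum_eq_zero fun l _ => Finset.sum_eq_zero fun i _ => ?_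
  rw [← C_pow, ← mul_assoc, ← C_mul, coeff_C_mul, coeff_X_pow, if_neg, mul_zero]
  have := l.2
  omega

theorem box_ne_zero {κ n : ℕ} {b : Fin κ → Fin n → k} (hb : b ≠ 0) : box κ n b ≠ 0 := by
  intro h
  apply hb
  ext l i
  rw [← box_coeff κ n b l i, h]; simp

theorem box_add (κ n : ℕ) (b b' : Fin κ → Fin n → k) :
    box κ n (b + b') = box κ n b + box κ n b' := by
  simp only [box, ← Finset.sum_add_distrib]
  refine Finset.sum_congr rfl fun l _ => Finset.sum_congr rfl fun i _ => ?_
  simp [add_mul]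

theorem box_smul (κ n : ℕ) (t : k) (b : Fin κ → Fin n → k) :
    box κ n (t • b) = C (C t) * box κ n b := by
  simp only [box, Finset.mul_sum]
  refine Finset.sum_congr rfl fun l _ => Finset.sum_congr rfl fun i _ => ?_
  simp [mul_assoc]

theorem CC_smul (t : k) (G : k[X][X]) : t • G = C (C t) * G := by
  ext l i
  simp [coeff_C_mul]

theorem add_mbm (h p q : k[X][X]) : (p + q) %ₘ h = p %ₘ h + q %ₘ h := add_modByMonic p q

/-- general linear-algebra existence -/
theorem exists_kernel {ι ι' : Type} [Fintype ι] [Fintype ι']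
    (φ : (ι → k) →ₗ[k] (ι' → k)) (hc : Fintype.card ι' < Fintype.card ι) :
    ∃ g : ι → k, g ≠ 0 ∧ φ g = 0 := by
  have : LinearMap.ker φ ≠ ⊥ := LinearMap.ker_ne_bot_of_finrank_lt (by simpa using hc)
  obtain ⟨g, hg, h0⟩ := Submodule.exists_mem_ne_zero_of_ne_bot this
  exact ⟨g, h0, hg⟩

/-- Lemma N -/
theorem lemmaN {c κ A n : ℕ} {h a : k[X][X]} (hm : h.Monic) (hκ : h.natDegree = κ) (hκ1 : 1 ≤ κ)
    (hc : ∀ l, (h.coeff l).natDegree ≤ c) (ha : Wt c A a)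
    (hn : κ * (A + c * κ + 1) < n)
    (hprime : ∀ b, h ∣ a * b → h ∣ b) :
    ∃ (b : k[X][X]) (r : k[X]), r ≠ 0 ∧ h ∣ a * b - C r ∧ Wt c (n + c * κ) b ∧
      r.natDegree ≤ A + (n + c * κ) := by
  set W := A + (n + c * κ) with hW
  let φ : (Fin κ × Fin n → k) →ₗ[k] (Fin (κ - 1) × Fin (W + 1) → k) :=
    { toFun := fun g li => (((a * box κ n (fun l i => g (l, i))) %ₘ h).coeff (li.1 + 1)).coeff li.2
      map_add' := by
        intro g g'
        ext li
        have : (fun (l : Fin κ) (i : Fin n) => (g + g') (l, i)) = (fun l i => g (l,i)) + fun l i => g' (l,i) := rfl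
        rw [this, box_add, mul_add, add_mbm]
        simp
      map_smul' := by
        intro t g
        ext li
        have : (fun (l : Fin κ) (i : Fin n) => (t • g) (l, i)) = t • (fun l i => g (l,i)) := rfl
        rw [this, box_smul, mul_left_comm, ← smul_eq_C_mul, smul_modByMonic, coeff_smul, smul_eq_mul, coeff_C_mul]
        rfl }
  obtain ⟨g, hg0, hg⟩ := exists_kernel φ (by
    simp only [Fintype.card_prod, Fintype.card_fin]
    obtain ⟨κ', rfl⟩ : ∃ κ', κ = κ' + 1 := ⟨κ - 1, by omega⟩
    simp only [Nat.add_sub_cancel]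
    have : (κ' + 1) * (A + c * (κ' + 1) + 1) < n := hn
    have h1 : κ' * (A + c * (κ' + 1) + 1) ≤ (κ' + 1) * (A + c * (κ' + 1) + 1) :=
      Nat.mul_le_mul_right _ (by omega)
    have : W + 1 = n + (A + c * (κ' + 1) + 1) := by rw [hW]; ring
    rw [this, mul_add, add_mul]
    omega)
  set b := box κ n (fun l i => g (l, i)) with hb
  have hb0 : b ≠ 0 := by
    apply box_ne_zero
    intro h
    apply hg0
    ext ⟨l, i⟩
    exact congrFun (congrFun h l) i
  have hbw : Wt c (n + c * κ) b := box_wt _ _ _ _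
  have hrw : Wt c W ((a * b) %ₘ h) := Wt.modByMonic hm hκ hc (ha.mul hbw)
  set R := (a * b) %ₘ h with hR
  have hh1 : h ≠ 1 := by rintro rfl; simp at hκ; omega
  have hRd : R.natDegree < κ := by rw [← hκ]; exact natDegree_modByMonic_lt _ hm hh1
  have hRC : R = C (R.coeff 0) := by
    ext l i
    rcases Nat.eq_zero_or_pos l with rfl | hl
    · simp
    rw [coeff_C, if_neg hl.ne', coeff_zero]
    by_cases hlκ : l < κ
    · by_cases hi : i < W + 1
      · have := congrFun hg (⟨l - 1, by omega⟩, ⟨i, hi⟩)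
        simp only [φ, LinearMap.coe_mk, AddHom.coe_mk, Pi.zero_apply] at this
        rw [Nat.sub_add_cancel hl] at this
        exact this
      · apply coeff_eq_zero_of_natDegree_lt
        have := hrw.natDegree_le l
        omega
    · have : R.coeff l = 0 := coeff_eq_zero_of_natDegree_lt (by omega)
      rw [this]; simp
  have hdvd : h ∣ a * b - R := by
    rw [hR]
    rw [← modByMonic_eq_zero_iff_dvd hm, sub_modByMonic, (modByMonic_eq_self_iff hm).mpr
      (degree_modByMonic_lt _ hm), sub_self]
  refine ⟨b, R.coeff 0, ?_, by rwa [← hRC], hbw, hrw.natDegree_le 0⟩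
  intro h0
  rw [h0, C_0] at hRC
  rw [hRC, sub_zero] at hdvd
  have := hprime b hdvd
  refine hb0 (eq_zero_of_dvd_of_degree_lt this ?_)
  rw [degree_eq_natDegree hm.ne_zero, hκ]
  exact box_degree _ _ _
end F1


section F2
variable {k : Type} [Field k] {M : Type} [Field M] [Algebra k M]

/-- the filtration by order of a place -/
structure OrdFilt (k M : Type) [Field k] [Field M] [Algebra k M] where
  F : ℤ → Submodule k M
  anti : ∀ {m n : ℤ}, m ≤ n → F n ≤ F m
  one_mem : (1 : M) ∈ F 0
  one_not_mem : (1 : M) ∉ F 1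
  mul_mem : ∀ {a b : M} {m n : ℤ}, a ∈ F m → b ∈ F n → a * b ∈ F (m + n)
  mul_not_mem : ∀ {a b : M} {m n : ℤ}, a ∉ F (m + 1) → b ∉ F (n + 1) → a * b ∉ F (m + n + 1)
  exists_ord : ∀ {a : M}, a ≠ 0 → ∃ n, a ∈ F n ∧ a ∉ F (n + 1)
  residue : ∀ {a b : M} {n : ℤ}, a ∈ F n → b ∈ F n → b ∉ F (n + 1) →
    ∃ t : k, a - t • b ∈ F (n + 1)

theorem OrdFilt.pow_mem (O : OrdFilt k M) {a : M} {n : ℤ} (h : a ∈ O.F n) (m : ℕ) :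
    a ^ m ∈ O.F (m * n) := by
  induction m with
  | zero => simpa using O.one_mem
  | succ m ih =>
    rw [pow_succ]
    have := O.mul_mem ih h
    convert this using 2
    push_cast; ring

theorem OrdFilt.pow_not_mem (O : OrdFilt k M) {a : M} {n : ℤ} (h : a ∉ O.F (n + 1)) (m : ℕ) :
    a ^ m ∉ O.F (m * n + 1) := by
  induction m with
  | zero => simpa using O.one_not_mem
  | succ m ih =>
    rw [pow_succ]
    have := O.mul_not_mem ih h
    convert this using 3
    push_cast; ring

theorem lemmaNV (O : OrdFilt k M) (p : ℕ) [Fact p.Prime] [CharP k p] (V : Submodule k M) (T : ℕ)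
    (hV : V ≤ O.F (-T)) (hV' : ∀ a ∈ V, a ∈ O.F (T + 1) → a = 0) (μ : ℕ) (hμ : 2 * T < p ^ μ)
    {ι : Type} : ∀ (n : ℕ) (s : Finset ι), s.card = n → ∀ (w : ι → M),
    (∀ c : ι → k, ∑ i ∈ s, c i • w i = 0 → ∀ i ∈ s, c i = 0) →
    ∀ a : ι → M, (∀ i ∈ s, a i ∈ V) → ∑ i ∈ s, a i * w i ^ (p ^ μ) = 0 → ∀ i ∈ s, a i = 0 := by
  classical
  have : CharP M p := charP_of_injective_algebraMap (algebraMap k M).injective p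
  have : ExpChar M p := ExpChar.prime Fact.out
  intro n
  induction n with
  | zero =>
    intro s hs w _ a _ _ i hi
    rw [Finset.card_eq_zero] at hs
    subst hs; simp at hi
  | succ n ih =>
    intro s hs w hw a ha hsum
    have hw0 : ∀ i ∈ s, w i ≠ 0 := by
      intro i hi h0
      have := hw (fun j => if j = i then 1 else 0) (by
        refine Finset.sum_eq_zero fun j hj => ?_
        by_cases h : j = i
        · simp [h, h0]
        · simp [h]) i hi
      simp at this
    have hne : s.Nonempty := by rw [← Finset.card_pos]; omega
    have hord : ∀ i, ∃ n, i ∈ s → w i ∈ O.F n ∧ w i ∉ O.F (n + 1) := by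
      intro i
      by_cases hi : i ∈ s
      · obtain ⟨n, hn⟩ := O.exists_ord (hw0 i hi)
        exact ⟨n, fun _ => hn⟩
      · exact ⟨0, fun h => absurd h hi⟩
    choose o ho using hord
    obtain ⟨i0, hi0, hmin⟩ := Finset.exists_min_image s o hne
    have hres : ∀ i, ∃ t : k, i ∈ s → w i - t • w i0 ∈ O.F (o i0 + 1) := by
      intro i
      by_cases hi : i ∈ s
      · obtain ⟨t, ht⟩ := O.residue (O.anti (hmin i hi) (ho i hi).1) (ho i0 hi0).1 (ho i0 hi0).2
        exact ⟨t, fun _ => ht⟩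
      · exact ⟨0, fun h => absurd h hi⟩
    choose t ht using hres
    set w' : ι → M := fun i => w i - t i • w i0 with hw'
    set s' := s.erase i0 with hs'
    have hsplit : ∀ g : ι → M, ∑ i ∈ s, g i = g i0 + ∑ i ∈ s', g i := fun g =>
      (Finset.add_sum_erase s g hi0).symm
    have hsub : ∀ i ∈ s', i ∈ s := fun i hi => Finset.mem_of_mem_erase hi
    set b : M := a i0 + ∑ i ∈ s', (t i ^ (p ^ μ)) • a i with hb
    have hbV : b ∈ V := V.add_mem (ha i0 hi0) (V.sum_mem fun i hi => V.smul_mem _ (ha i (hsub i hi)))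
    have key : b * w i0 ^ (p ^ μ) + ∑ i ∈ s', a i * w' i ^ (p ^ μ) = 0 := by
      rw [← hsum, hsplit, hb, add_mul, add_assoc, Finset.sum_mul, ← Finset.sum_add_distrib]
      congr 1
      refine Finset.sum_congr rfl fun i _ => ?_
      have : w i ^ (p ^ μ) = w' i ^ (p ^ μ) + (t i • w i0) ^ (p ^ μ) := by
        rw [← add_pow_expChar_pow]; simp [hw']
      rw [this, _root_.smul_pow, mul_add]
      simp only [Algebra.smul_def]
      ring
    have hb0 : b = 0 := by
      apply hV' b hbV
      by_contra hbn
      have h1 := O.mul_not_mem hbn (O.pow_not_mem (ho i0 hi0).2 (p ^ μ))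
      apply h1
      rw [add_eq_zero_iff_eq_neg] at key
      rw [key]
      apply Submodule.neg_mem
      apply Submodule.sum_mem
      intro i hi
      have h2 := O.mul_mem (hV (ha i (hsub i hi))) (O.pow_mem (ht i (hsub i hi)) (p ^ μ))
      refine O.anti ?_ h2
      have : (2 * T : ℤ) < (p ^ μ : ℕ) := by exact_mod_cast hμ
      linarith
    rw [hb0, zero_mul, zero_add] at key
    have hzero : ∀ i ∈ s', a i = 0 := by
      apply ih s' (by rw [hs', Finset.card_erase_of_mem hi0, hs]; rfl) w' _ a
        (fun i hi => ha i (hsub i hi)) key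
      intro c hc i hi
      have := hw (fun j => if j = i0 then - ∑ j ∈ s', c j * t j else c j) (by
        rw [hsplit, if_pos rfl]
        have : ∑ j ∈ s', (if j = i0 then - ∑ j ∈ s', c j * t j else c j) • w j = ∑ j ∈ s', c j • w j := by
          refine Finset.sum_congr rfl fun j hj => ?_
          rw [if_neg (Finset.ne_of_mem_erase hj)]
        rw [this]
        simp only [hw', smul_sub, Finset.sum_sub_distrib, smul_smul] at hc
        rw [neg_smul, Finset.sum_smul]
        rw [← hc]; ring) i (hsub i hi)
      simp only [if_neg (Finset.ne_of_mem_erase hi)] at this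
      exact this
    intro i hi
    by_cases h : i = i0
    · subst h
      rw [hb, Finset.sum_eq_zero (fun j hj => by rw [hzero j hj, smul_zero]), add_zero] at hb0
      exact hb0
    · exact hzero i (Finset.mem_erase.mpr ⟨h, hi⟩)

/-- quotient coefficients -/
noncomputable def etaQ (κ : ℕ) (h : k[X][X]) (l : ℕ) : k[X][X] :=
  ∑ j ∈ Finset.range (κ + 1), if l < j then C (h.coeff j) * X ^ (j - 1 - l) else 0

theorem eta_wt {c κ : ℕ} {h : k[X][X]} (hc : ∀ l, (h.coeff l).natDegree ≤ c) (l : ℕ) :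
    Wt c (c * κ) (etaQ κ h l) := by
  refine Wt.sum _ _ fun j hj => ?_
  rw [Finset.mem_range] at hj
  split_ifs with hl
  · have h1 : Wt c c (C (h.coeff j)) := by
      intro i
      rcases Nat.eq_zero_or_pos i with rfl | hi
      · right; simpa using hc j
      · left; rw [coeff_C, if_neg hi.ne']
    refine (h1.mul ((Wt.Y c).pow (j - 1 - l))).mono ?_
    have : c * (1 + (j - 1 - l)) ≤ c * κ := Nat.mul_le_mul_left c (by omega)
    rw [mul_add, mul_one, mul_comm c (j - 1 - l)] at this
    exact this
  · exact Wt.zero _ _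

theorem evalEval_eq_sum {κ : ℕ} (G : k[X][X]) (hG : G.natDegree < κ) (x y : k) :
    G.evalEval x y = ∑ j ∈ Finset.range κ, (G.coeff j).eval x * y ^ j := by
  rw [evalEval, eval_eq_sum_range' hG, eval_finsetSum]
  simp

theorem eta_eval {κ : ℕ} {h : k[X][X]} (hκ : h.natDegree = κ) (x y z : k) :
    (z - y) * ∑ l ∈ Finset.range κ, (etaQ κ h l).evalEval x y * z ^ l
      = h.evalEval x z - h.evalEval x y := by
  have h1 : ∀ l, (etaQ κ h l).evalEval x y = ∑ j ∈ Finset.range (κ + 1),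
      if l < j then (h.coeff j).eval x * y ^ (j - 1 - l) else 0 := by
    intro l
    rw [etaQ, evalEval_finsetSum]
    refine Finset.sum_congr rfl fun j _ => ?_
    split_ifs
    · simp [evalEval_C]
    · simp
  simp only [h1]
  rw [evalEval_eq_sum h (κ := κ + 1) (by omega), evalEval_eq_sum h (κ := κ + 1) (by omega),
    ← Finset.sum_sub_distrib]
  simp only [Finset.sum_mul]
  rw [Finset.sum_comm, Finset.mul_sum]
  refine Finset.sum_congr rfl fun j hj => ?_
  rw [Finset.mem_range] at hj
  rw [← mul_sub, ← geom_sum₂_mul z y j, mul_comm (z - y), ← mul_assoc, Finset.mul_sum]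
  congr 1
  rw [← Finset.sum_subset (Finset.range_subset_range.mpr (show j ≤ κ by omega))]
  · refine Finset.sum_congr rfl fun l hl => ?_
    rw [Finset.mem_range] at hl
    rw [if_pos hl]; ring
  · intro l _ hl
    rw [Finset.mem_range] at hl
    rw [if_neg hl, zero_mul]

theorem ev_mem (O : OrdFilt k M) {x y : M} {c : ℕ} (hx : x ∈ O.F (-1)) (hy : y ∈ O.F (-c))
    {n : ℕ} {G : k[X][X]} (hG : Wt c n G) : aevalAeval x y G ∈ O.F (-n) := by
  have : aevalAeval x y G = ∑ l ∈ Finset.range (G.natDegree + 1),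
      ∑ i ∈ Finset.range ((G.coeff l).natDegree + 1), ((G.coeff l).coeff i) • (x ^ i * y ^ l) := by
    conv_lhs => rw [G.as_sum_range_C_mul_X_pow]
    rw [map_sum]
    refine Finset.sum_congr rfl fun l _ => ?_
    rw [map_mul, map_pow, aevalAeval_C, aeval_eq_sum_range, Finset.sum_mul]
    refine Finset.sum_congr rfl fun i _ => ?_
    rw [smul_mul_assoc]; congr 2; congr 1; simp
  rw [this]
  refine Submodule.sum_mem _ fun l hl => Submodule.sum_mem _ fun i hi => ?_
  rcases hG l with h | h
  · simp [h]
  · apply Submodule.smul_mem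
    refine O.anti ?_ (O.mul_mem (O.pow_mem hx i) (O.pow_mem hy l))
    rw [Finset.mem_range] at hi
    have : (i + c * l : ℕ) ≤ n := by omega
    zify at this
    linarith

theorem Wt.derivative {c n : ℕ} {G : k[X][X]} (h : Wt c n G) : Wt c n (derivative G) := by
  intro l
  rw [coeff_derivative]
  rcases h (l + 1) with h | h
  · left; simp [h]
  · right
    have : (G.coeff (l + 1) * ((l : k[X]) + 1)).natDegree ≤ (G.coeff (l+1)).natDegree := by
      refine natDegree_mul_le.trans ?_
      have : ((l : k[X]) + 1).natDegree = 0 := by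
        have := natDegree_natCast (R := k) (l + 1)
        push_cast at this; exact this
      omega
    have e : c * (l + 1) = c * l + c := by ring
    omega

end F2


section F3
variable {k : Type} [Field k] {M : Type} [Field M] [Algebra k M]

theorem fixed_card (p : ℕ) [Fact p.Prime] [CharP k p] [IsAlgClosed k] (N : ℕ) (hN : 0 < N) :
    ∃ S : Finset k, S.card = p ^ N ∧ ∀ x ∈ S, x ^ (p ^ N) = x := by
  classical
  have hp : p.Prime := Fact.out
  have h1 : 1 < p ^ N := Nat.one_lt_pow hN.ne' hp.one_lt
  have hsep : (X ^ p ^ N - X : k[X]).Separable :=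
    galois_poly_separable p _ (dvd_pow_self p hN.ne')
  have hnd := FiniteField.X_pow_card_sub_X_natDegree_eq k h1
  refine ⟨(X ^ p ^ N - X : k[X]).roots.toFinset, ?_, ?_⟩
  · rw [Multiset.toFinset_card_of_nodup (nodup_roots hsep),
      splits_iff_card_roots.mp (IsAlgClosed.splits _), hnd]
  · intro x hx
    rw [Multiset.mem_toFinset, mem_roots'] at hx
    have := hx.2
    simp only [IsRoot.def, eval_sub, eval_pow, eval_X] at this
    exact sub_eq_zero.mp this

/-- vanishing at the roots of a separable fibre -/
theorem fibre_zero [IsAlgClosed k] {κ : ℕ} {h R : k[X][X]} (hm : h.Monic) (hκ : h.natDegree = κ)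
    (hR : R.natDegree < κ) (x0 : k)
    (hsep : ∀ y0, h.evalEval x0 y0 = 0 → (derivative h).evalEval x0 y0 ≠ 0)
    (hv : ∀ y0, h.evalEval x0 y0 = 0 → R.evalEval x0 y0 = 0) (l : ℕ) :
    (R.coeff l).eval x0 = 0 := by
  classical
  set H := h.map (evalRingHom x0) with hH
  set S := R.map (evalRingHom x0) with hS
  have hev : ∀ (G : k[X][X]) (y : k), (G.map (evalRingHom x0)).eval y = G.evalEval x0 y := fun G y =>
    map_evalRingHom_eval x0 y G
  have hHm : H.Monic := hm.map _
  have hHd : H.natDegree = κ := by rw [hH, hm.natDegree_map, hκ]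
  have hHsep : H.Separable := by
    rw [separable_def]
    apply (isCoprime_iff_aeval_ne_zero_of_isAlgClosed k k _ _).mpr
    intro y
    rw [← not_and_or]
    rintro ⟨h1, h2⟩
    rw [coe_aeval_eq_eval] at h1 h2
    rw [hH, hev] at h1
    rw [hH, derivative_map, hev] at h2
    exact hsep y h1 h2
  have hcard : H.roots.toFinset.card = κ := by
    rw [Multiset.toFinset_card_of_nodup (nodup_roots hHsep),
      splits_iff_card_roots.mp (IsAlgClosed.splits _), hHd]
  have hS0 : S = 0 := by
    apply eq_zero_of_natDegree_lt_card_of_eval_eq_zero' S H.roots.toFinset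
    · intro y hy
      rw [Multiset.mem_toFinset, mem_roots', IsRoot.def, hH, hev] at hy
      rw [hS, hev]
      exact hv y hy.2
    · rw [hcard]
      exact (natDegree_map_le).trans_lt hR
  have : S.coeff l = (R.coeff l).eval x0 := by rw [hS, coeff_map]; rfl
  rw [← this, hS0, coeff_zero]

theorem exists_order_bound (O : OrdFilt k M) {x y : M} {c κ : ℕ} {h : k[X][X]}
    (hx : x ∈ O.F (-1)) (hy : y ∈ O.F (-c))
    (hr : ∀ r : k[X], r ≠ 0 → aeval x r ∉ O.F 1)
    (hm : h.Monic) (hκ : h.natDegree = κ) (hκ1 : 1 ≤ κ)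
    (hc : ∀ l, (h.coeff l).natDegree ≤ c)
    (hmin : ∀ G : k[X][X], aevalAeval x y G = 0 ↔ h ∣ G) {A : ℕ} {G : k[X][X]} (hG : Wt c A G)
    (hO : aevalAeval x y G ∈ O.F ((κ * (A + c * κ + 1) + 1 + c * κ : ℕ) + 1)) :
    aevalAeval x y G = 0 := by
  by_contra h0
  obtain ⟨b, r, hr0, hdvd, hbw, -⟩ := lemmaN (n := κ * (A + c * κ + 1) + 1) hm hκ hκ1 hc hG (by omega)
    (fun b hb => by
      rw [← hmin] at hb ⊢
      rw [map_mul] at hb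
      exact (mul_eq_zero.mp hb).resolve_left h0)
  rw [← hmin, map_sub, map_mul, aevalAeval_C, sub_eq_zero] at hdvd
  apply hr r hr0
  rw [← hdvd]
  refine O.anti ?_ (O.mul_mem hO (ev_mem O hx hy hbw))
  linarith

/-- the linear system of Stepanov's method -/
noncomputable def stepC (κ A B P : ℕ) (g : (Fin κ × Fin A) × (Fin κ × Fin B) → k) (l' : Fin κ) :
    k[X][X] :=
  ∑ j : Fin κ × Fin A, ∑ i' : Fin B,
    C (C (g (j, (l', i')))) * ((C X ^ (j.2 : ℕ) * X ^ (j.1 : ℕ)) ^ P * C X ^ (i' : ℕ))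

theorem mono_wt (c κ : ℕ) {A : ℕ} (i : Fin A) (l : Fin κ) :
    Wt c (A + c * κ) (C X ^ (i : ℕ) * X ^ (l : ℕ) : k[X][X]) := by
  refine (((Wt.CX (k := k) c).pow (i:ℕ)).mul ((Wt.Y c).pow (l:ℕ))).mono ?_
  have := i.2
  have h3 : (l:ℕ) * c ≤ c * κ := by rw [mul_comm]; exact Nat.mul_le_mul_left c l.2.le
  omega

theorem stepC_wt (c κ A B P : ℕ) (g : (Fin κ × Fin A) × (Fin κ × Fin B) → k) (l' : Fin κ) :
    Wt c (P * (A + c * κ) + B) (stepC κ A B P g l') := by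
  refine Wt.sum _ _ fun j _ => Wt.sum _ _ fun i' _ => ?_
  refine ((Wt.C_C c 0 _).mul (((mono_wt c κ j.2 j.1).pow P).mul
    ((Wt.CX c).pow (i' : ℕ)))).mono ?_
  have := i'.2
  omega

theorem stepC_exists {c κ A B P : ℕ} {h : k[X][X]} (hm : h.Monic) (hκ : h.natDegree = κ)
    (hκ1 : 1 ≤ κ) (hc : ∀ l, (h.coeff l).natDegree ≤ c)
    (hcount : (κ - 1) * (κ * (P * (A + c * κ) + B + c * κ + 1)) < (κ * A) * (κ * B)) :
    ∃ g : (Fin κ × Fin A) × (Fin κ × Fin B) → k, g ≠ 0 ∧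
      ∀ l' : Fin κ, h ∣ stepC κ A B P g l' - stepC κ A B P g ⟨κ - 1, by omega⟩ * etaQ κ h l' := by
  set W := P * (A + c * κ) + B + c * κ with hW
  set top : Fin κ := ⟨κ - 1, by omega⟩ with htop
  have hadd : ∀ g g' l', stepC κ A B P (g + g') l' = stepC κ A B P g l' + stepC (k := k) κ A B P g' l' := by
    intro g g' l'
    simp only [stepC, ← Finset.sum_add_distrib]
    refine Finset.sum_congr rfl fun _ _ => Finset.sum_congr rfl fun _ _ => ?_
    rw [← add_mul]; simp
  have hsmul : ∀ (t : k) g l', stepC κ A B P (t • g) l' = C (C t) * stepC κ A B P g l' := by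
    intro t g l'
    simp only [stepC, Finset.mul_sum]
    refine Finset.sum_congr rfl fun _ _ => Finset.sum_congr rfl fun _ _ => ?_
    rw [Pi.smul_apply, smul_eq_mul, C_mul, C_mul, mul_assoc]
  let emb : Fin (κ - 1) → Fin κ := fun l => ⟨l, by omega⟩
  let E : ((Fin κ × Fin A) × (Fin κ × Fin B) → k) → Fin κ → k[X][X] := fun g l' =>
    (stepC κ A B P g l' - stepC κ A B P g top * etaQ κ h l') %ₘ h
  let φ : ((Fin κ × Fin A) × (Fin κ × Fin B) → k) →ₗ[k]
      (Fin (κ - 1) × (Fin κ × Fin (W + 1)) → k) :=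
    { toFun := fun g q => ((E g (emb q.1)).coeff q.2.1).coeff q.2.2
      map_add' := by
        intro g g'
        ext q
        have : E (g + g') (emb q.1) = E g (emb q.1) + E g' (emb q.1) := by
          simp only [E]
          rw [← add_mbm]
          congr 1
          rw [hadd, hadd]; ring
        simp only [this, coeff_add, Pi.add_apply]
      map_smul' := by
        intro t g
        ext q
        have : E (t • g) (emb q.1) = C t • E g (emb q.1) := by
          simp only [E]
          rw [← smul_modByMonic]
          congr 1
          rw [hsmul, hsmul, smul_eq_C_mul]; ring
        simp only [this, coeff_smul, smul_eq_mul, coeff_C_mul]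
        rfl }
  obtain ⟨g, hg0, hg⟩ := exists_kernel φ (by
    simp only [Fintype.card_prod, Fintype.card_fin]
    exact hcount)
  refine ⟨g, hg0, fun l' => ?_⟩
  by_cases hl : l' = top
  · rw [hl]
    have : etaQ κ h top = 1 := by
      rw [etaQ, Finset.sum_eq_single κ]
      · have e : h.coeff κ = 1 := by rw [← hκ]; exact hm.coeff_natDegree
        rw [htop, if_pos (by simp; omega), e]; simp
      · intro j hj hjκ
        rw [Finset.mem_range] at hj
        rw [htop, if_neg (by simp; omega)]
      · simp
    rw [this, mul_one, sub_self]
    exact dvd_zero h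
  have hl2 : (l' : ℕ) < κ - 1 := by
    have := l'.2
    have : (l' : ℕ) ≠ κ - 1 := fun hh => hl (Fin.ext hh)
    omega
  rw [← modByMonic_eq_zero_iff_dvd hm]
  change E g l' = 0
  have hw : Wt c W (E g l') := by
    apply Wt.modByMonic hm hκ hc
    refine ((stepC_wt c κ A B P g l').mono (by omega)).sub ?_
    exact (stepC_wt c κ A B P g top).mul (eta_wt hc _)
  have hh1 : h ≠ 1 := by rintro rfl; simp at hκ; omega
  have hd : (E g l').natDegree < κ := by rw [← hκ]; exact natDegree_modByMonic_lt _ hm hh1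
  ext l i
  rw [coeff_zero, coeff_zero]
  by_cases h1 : l < κ
  · by_cases h2 : i < W + 1
    · have := congrFun hg (⟨l', hl2⟩, (⟨l, h1⟩, ⟨i, h2⟩))
      exact this
    · exact coeff_eq_zero_of_natDegree_lt (by have := hw.natDegree_le l; omega)
  · have : (E g l').coeff l = 0 := coeff_eq_zero_of_natDegree_lt (by omega)
    rw [this, coeff_zero]

theorem count_ineq {c κ u P : ℕ} (hκ : 1 ≤ κ) (hu : u = κ * (c * κ + 1)) (hP : 2 * u + 1 ≤ P) :
    (κ - 1) * (κ * (P * (2 * u + c * κ) + (P - 1 - c * κ) + c * κ + 1))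
      < (κ * (2 * u)) * (κ * (P - 1 - c * κ)) := by
  have hck : c * κ + 1 ≤ u := by rw [hu]; exact Nat.le_mul_of_pos_left _ hκ
  obtain ⟨B, rfl⟩ : ∃ B, P = B + 1 + c * κ := ⟨P - 1 - c * κ, by omega⟩
  have e : B + 1 + c * κ - 1 - c * κ = B := by omega
  rw [e]
  obtain ⟨κ', rfl⟩ : ∃ κ', κ = κ' + 1 := ⟨κ - 1, by omega⟩
  simp only [Nat.add_sub_cancel]
  set z := c * (κ' + 1) with hz
  have h1 : κ' * ((B + 1 + z) * (2 * u + z) + B + z + 1) < (2 * u) * ((κ' + 1) * B) := by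
    have e1 : (B + 1 + z) * (2 * u + z) + B + z + 1 = (B + 1 + z) * (2 * u + (z + 1)) := by ring
    rw [e1]
    have : u = κ' * (z + 1) + (z + 1) := by rw [hu]; ring
    zify at *
    nlinarith
  calc _ = (κ' + 1) * (κ' * ((B + 1 + z) * (2 * u + z) + B + z + 1)) := by ring
    _ < (κ' + 1) * ((2 * u) * ((κ' + 1) * B)) := Nat.mul_lt_mul_of_pos_left h1 (by omega)
    _ = _ := by ring

end F3


section F4
variable {k : Type} [Field k] {M : Type} [Field M] [Algebra k M]

/-- the auxiliary function of Stepanov's method -/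
noncomputable def stepPsi (κ A B Q' : ℕ) (g : (Fin κ × Fin A) × (Fin κ × Fin B) → k) : k[X][X] :=
  ∑ m : Fin κ × Fin B, (box κ A fun l i => g ((l, i), m)) * (C X ^ (m.2 : ℕ) * X ^ (m.1 : ℕ)) ^ Q'

theorem stepPsi_wt (c κ A B Q' : ℕ) (g : (Fin κ × Fin A) × (Fin κ × Fin B) → k) :
    Wt c (A + c * κ + Q' * (B + c * κ)) (stepPsi κ A B Q' g) := by
  refine Wt.sum _ _ fun m _ => ?_
  exact (box_wt c κ A _).mul ((mono_wt c κ m.2 m.1).pow Q')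

theorem box_evalEval (κ n : ℕ) (b : Fin κ → Fin n → k) (x y : k) :
    (box κ n b).evalEval x y = ∑ j : Fin κ × Fin n, b j.1 j.2 * (x ^ (j.2 : ℕ) * y ^ (j.1 : ℕ)) := by
  rw [Fintype.sum_prod_type]
  simp [box, evalEval_finsetSum, evalEval_mul, evalEval_pow, evalEval_C, evalEval_X]

theorem stepPsi_eval (p : ℕ) [Fact p.Prime] [CharP k p] (κ A B μ ν : ℕ)
    (g δ : (Fin κ × Fin A) × (Fin κ × Fin B) → k) (hδ : ∀ i, δ i ^ (p ^ μ) = g i) (x0 y0 : k)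
    (hx0 : x0 ^ (p ^ (μ + ν)) = x0) :
    (stepPsi κ A B (p ^ ν) δ).evalEval x0 y0 ^ (p ^ μ)
      = ∑ l' : Fin κ, (stepC κ A B (p ^ μ) g l').evalEval x0 y0 * (y0 ^ (p ^ (μ + ν))) ^ (l' : ℕ) := by
  have : ExpChar k p := ExpChar.prime Fact.out
  rw [stepPsi, evalEval_finsetSum, sum_pow_char_pow, Fintype.sum_prod_type]
  refine Finset.sum_congr rfl fun l' _ => ?_
  rw [stepC, evalEval_finsetSum, Finset.sum_mul]
  simp only [evalEval_finsetSum, Finset.sum_mul]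
  rw [Finset.sum_comm]
  refine Finset.sum_congr rfl fun i' _ => ?_
  rw [evalEval_mul, box_evalEval, mul_pow, sum_pow_char_pow, Finset.sum_mul]
  refine Finset.sum_congr rfl fun j _ => ?_
  simp only [evalEval_mul, evalEval_pow, evalEval_C, evalEval_X, eval_C, eval_X, mul_pow, hδ]
  have e1 : ((x0 ^ (i' : ℕ)) ^ p ^ ν) ^ p ^ μ = x0 ^ (i' : ℕ) := by
    rw [← pow_mul, ← pow_mul, ← pow_add, add_comm ν μ, mul_comm, pow_mul, hx0]
  have e2 : ((y0 ^ (l' : ℕ)) ^ p ^ ν) ^ p ^ μ = (y0 ^ p ^ (μ + ν)) ^ (l' : ℕ) := by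
    rw [← pow_mul, ← pow_mul, ← pow_add, add_comm ν μ, mul_comm, pow_mul]
  rw [e1, e2]; ring

theorem fixed_root (p : ℕ) [Fact p.Prime] [CharP k p] {N : ℕ} {h : k[X][X]}
    (hfix : ∀ l i, ((h.coeff l).coeff i) ^ (p ^ N) = (h.coeff l).coeff i) {x0 y0 : k}
    (hx0 : x0 ^ (p ^ N) = x0) : h.evalEval x0 (y0 ^ (p ^ N)) = h.evalEval x0 y0 ^ (p ^ N) := by
  have : ExpChar k p := ExpChar.prime Fact.out
  rw [evalEval_eq_sum h (Nat.lt_succ_self _), evalEval_eq_sum h (Nat.lt_succ_self _),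
    sum_pow_char_pow]
  refine Finset.sum_congr rfl fun l _ => ?_
  rw [mul_pow, eval_eq_sum_range, sum_pow_char_pow]
  congr 1
  · refine Finset.sum_congr rfl fun i _ => ?_
    rw [mul_pow, hfix, pow_right_comm, hx0]
  · rw [← pow_mul, ← pow_mul, mul_comm]

theorem stepanov (p : ℕ) [Fact p.Prime] [CharP k p] [IsAlgClosed k] (O : OrdFilt k M) (x : M)
    (hx : x ∈ O.F (-1)) (hr : ∀ r : k[X], r ≠ 0 → aeval x r ∉ O.F 1) (κ c A0 : ℕ) (hκ1 : 1 ≤ κ) :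
    ∃ N0 : ℕ, ∀ N ≥ N0, ∀ (h a : k[X][X]) (y : M), h.Monic → h.natDegree = κ →
      (∀ l, (h.coeff l).natDegree ≤ c) →
      (∀ l i, ((h.coeff l).coeff i) ^ (p ^ N) = (h.coeff l).coeff i) →
      y ∈ O.F (-c) → (∀ G : k[X][X], aevalAeval x y G = 0 ↔ h ∣ G) →
      Wt c A0 a → aevalAeval x y a ≠ 0 → aevalAeval x y (derivative h) ≠ 0 →
      ∃ x0 y0 : k, x0 ^ (p ^ N) = x0 ∧ y0 ^ (p ^ N) = y0 ∧ h.evalEval x0 y0 = 0 ∧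
        a.evalEval x0 y0 ≠ 0 := by
  classical
  have hp : p.Prime := Fact.out
  have hexp : ExpChar k p := ExpChar.prime Fact.out
  obtain ⟨u, hu⟩ : ∃ u, u = κ * (c * κ + 1) := ⟨_, rfl⟩
  obtain ⟨A, hA⟩ : ∃ A, A = 2 * u := ⟨_, rfl⟩
  obtain ⟨μ, hμ⟩ : ∃ μ, 2 * u + 1 ≤ p ^ μ := ⟨2 * u + 1, (Nat.lt_pow_self hp.one_lt).le⟩
  obtain ⟨B, hB⟩ : ∃ B, B = p ^ μ - 1 - c * κ := ⟨_, rfl⟩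
  have hck : c * κ + 1 ≤ u := by rw [hu]; exact Nat.le_mul_of_pos_left _ hκ1
  have hBc : B + c * κ = p ^ μ - 1 := by omega
  obtain ⟨T, hT⟩ : ∃ T, T = κ * ((A + c * κ) + c * κ + 1) + 1 + c * κ := ⟨_, rfl⟩
  obtain ⟨n2, hn2⟩ : ∃ n2, n2 = κ * ((A0 + c * κ) + c * κ + 1) + 1 := ⟨_, rfl⟩
  obtain ⟨T0, hT0⟩ : ∃ T0, T0 = A0 + c * κ + (n2 + c * κ) := ⟨_, rfl⟩
  refine ⟨μ + (2 * T + 1 + A + c * κ + T0 + 1), ?_⟩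
  intro N hN h a y hm hκ hc hfix hy hmin ha ha0 hh'
  obtain ⟨ν, rfl⟩ : ∃ ν, N = μ + ν := ⟨N - μ, by omega⟩
  have hν : 2 * T + 1 + A + c * κ + T0 + 1 ≤ p ^ ν := by
    have : ν < p ^ ν := Nat.lt_pow_self hp.one_lt
    omega
  by_contra hno
  push Not at hno
  -- bad points
  obtain ⟨b, r, hr0, hdvd, -, hrdeg⟩ := lemmaN (n := n2) (a := a * derivative h) hm hκ hκ1 hc
    (ha.mul (Wt.monic hm hκ hc).derivative) (by omega) (fun b hb => by
      rw [← hmin] at hb ⊢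
      rw [map_mul, map_mul] at hb
      exact (mul_eq_zero.mp hb).resolve_left (mul_ne_zero ha0 hh'))
  rw [← hT0] at hrdeg
  have hgood : ∀ x0 y0, r.eval x0 ≠ 0 → h.evalEval x0 y0 = 0 →
      a.evalEval x0 y0 ≠ 0 ∧ (derivative h).evalEval x0 y0 ≠ 0 := by
    intro x0 y0 hrx hh0
    obtain ⟨d, hd⟩ := hdvd
    have := congrArg (evalEval x0 y0) hd
    rw [evalEval_sub, evalEval_mul, evalEval_mul, evalEval_mul, hh0, zero_mul, evalEval_C,
      sub_eq_zero] at this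
    constructor
    · intro h0; rw [h0] at this; simp at this; exact hrx this.symm
    · intro h0; rw [h0] at this; simp at this; exact hrx this.symm
  -- auxiliary function
  obtain ⟨g, hg0, hg⟩ := stepC_exists (k := k) (c := c) (A := A) (B := B) (P := p ^ μ) hm hκ hκ1 hc (by
    rw [hA, hB]; exact count_ineq hκ1 hu hμ)
  have hroot : ∀ i, ∃ z : k, z ^ (p ^ μ) = g i := fun i =>
    IsAlgClosed.exists_pow_nat_eq (g i) (pow_pos hp.pos μ)
  choose δ hδ using hroot
  set ψ := stepPsi κ A B (p ^ ν) δ with hψ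
  have hpow : p ^ (μ + ν) = p ^ ν * (p ^ μ - 1) + p ^ ν := by
    have : 1 ≤ p ^ μ := Nat.one_le_pow _ _ hp.pos
    rw [pow_add, ← Nat.mul_succ, Nat.succ_eq_add_one, Nat.sub_add_cancel this, mul_comm]
  have hψw : Wt c (A + c * κ + p ^ ν * (p ^ μ - 1)) ψ := by
    rw [← hBc]; exact stepPsi_wt c κ A B (p ^ ν) δ
  have hh1 : h ≠ 1 := by rintro rfl; simp at hκ; omega
  have hψv : ∀ x0 y0, r.eval x0 ≠ 0 → x0 ^ (p ^ (μ + ν)) = x0 → h.evalEval x0 y0 = 0 →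
      ψ.evalEval x0 y0 = 0 := by
    intro x0 y0 hrx hx0 hh0
    have h1 : y0 ^ (p ^ (μ + ν)) ≠ y0 := fun hy0 =>
      (hgood x0 y0 hrx hh0).1 (hno x0 y0 hx0 hy0 hh0)
    have h2 : h.evalEval x0 (y0 ^ (p ^ (μ + ν))) = 0 := by
      rw [fixed_root p hfix hx0, hh0, zero_pow (pow_ne_zero _ hp.ne_zero)]
    have h3 := eta_eval hκ x0 y0 (y0 ^ (p ^ (μ + ν)))
    rw [h2, hh0, sub_self, mul_eq_zero, sub_eq_zero] at h3
    have h4 := h3.resolve_left h1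
    have h5 := stepPsi_eval p κ A B μ ν g δ hδ x0 y0 hx0
    have h6 : ∀ l' : Fin κ, (stepC κ A B (p ^ μ) g l').evalEval x0 y0 =
        (stepC κ A B (p ^ μ) g ⟨κ - 1, by omega⟩).evalEval x0 y0 * (etaQ κ h l').evalEval x0 y0 := by
      intro l'
      obtain ⟨d, hd⟩ := hg l'
      have := congrArg (evalEval x0 y0) hd
      rw [evalEval_sub, evalEval_mul, evalEval_mul, hh0, zero_mul, sub_eq_zero] at this
      exact this
    have h7 : ψ.evalEval x0 y0 ^ (p ^ μ) = 0 := by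
      rw [h5]
      have : ∀ l' : Fin κ, (stepC κ A B (p ^ μ) g l').evalEval x0 y0 * (y0 ^ (p ^ (μ + ν))) ^ (l' : ℕ)
          = (stepC κ A B (p ^ μ) g ⟨κ - 1, by omega⟩).evalEval x0 y0 *
            ((etaQ κ h l').evalEval x0 y0 * (y0 ^ (p ^ (μ + ν))) ^ (l' : ℕ)) := by
        intro l'; rw [h6 l', mul_assoc]
      rw [Finset.sum_congr rfl fun l' _ => this l', ← Finset.mul_sum,
        Fin.sum_univ_eq_sum_range (fun l => (etaQ κ h l).evalEval x0 y0 * (y0 ^ (p ^ (μ + ν))) ^ l) κ,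
        h4, mul_zero]
    exact eq_zero_of_pow_eq_zero h7
  have hRw : Wt c (A + c * κ + p ^ ν * (p ^ μ - 1)) (ψ %ₘ h) := Wt.modByMonic hm hκ hc hψw
  have hRd : (ψ %ₘ h).natDegree < κ := by rw [← hκ]; exact natDegree_modByMonic_lt _ hm hh1
  obtain ⟨S, hScard, hS⟩ := fixed_card (k := k) p (μ + ν) (by omega)
  have hψ0 : ψ %ₘ h = 0 := by
    ext1 l
    rw [coeff_zero]
    apply eq_zero_of_natDegree_lt_card_of_eval_eq_zero' _ (S \ r.roots.toFinset)
    · intro x0 hx0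
      rw [Finset.mem_sdiff, Multiset.mem_toFinset, mem_roots hr0, IsRoot.def] at hx0
      refine fibre_zero hm hκ hRd x0 (fun y0 hh0 => (hgood x0 y0 hx0.2 hh0).2) (fun y0 hh0 => ?_) l
      have h1 := hψv x0 y0 hx0.2 (hS x0 hx0.1) hh0
      rw [← modByMonic_add_div ψ h, evalEval_add, evalEval_mul, hh0, zero_mul, add_zero] at h1
      exact h1
    · have h1 := Finset.le_card_sdiff r.roots.toFinset S
      have h2 : r.roots.toFinset.card ≤ T0 :=
        (Multiset.toFinset_card_le _).trans ((card_roots' r).trans hrdeg)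
      have h3 := hRw.natDegree_le l
      rw [hScard] at h1
      omega
  rw [modByMonic_eq_zero_iff_dvd hm, ← hmin] at hψ0
  -- contradiction via orders
  let V : Submodule k M :=
    { carrier := {v | ∃ G : k[X][X], Wt c (A + c * κ) G ∧ aevalAeval x y G = v}
      add_mem' := by
        rintro _ _ ⟨G, hG, rfl⟩ ⟨G', hG', rfl⟩
        exact ⟨G + G', hG.add hG', map_add _ _ _⟩
      zero_mem' := ⟨0, Wt.zero _ _, map_zero _⟩
      smul_mem' := by
        rintro t _ ⟨G, hG, rfl⟩
        refine ⟨C (C t) * G, by simpa using (Wt.C_C c 0 t).mul hG, ?_⟩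
        rw [← CC_smul, map_smul] }
  have hbox : ∀ n (b : Fin κ → Fin n → k), aevalAeval x y (box κ n b) = 0 → b = 0 := by
    intro n b hb
    by_contra hb0
    rw [hmin] at hb
    refine box_ne_zero hb0 (eq_zero_of_dvd_of_degree_lt hb ?_)
    rw [degree_eq_natDegree hm.ne_zero, hκ]
    exact box_degree _ _ _
  have hNV := lemmaNV O p V T (by
      rintro _ ⟨G, hG, rfl⟩
      refine O.anti ?_ (ev_mem O hx hy hG)
      have : A + c * κ ≤ T := by
        have : A + c * κ ≤ κ * ((A + c * κ) + c * κ + 1) :=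
          le_trans (by omega) (Nat.le_mul_of_pos_left _ hκ1)
        omega
      have : ((A + c * κ : ℕ) : ℤ) ≤ T := by exact_mod_cast this
      linarith) (by
      rintro _ ⟨G, hG, rfl⟩ hO
      apply exists_order_bound O hx hy hr hm hκ hκ1 hc hmin hG
      rw [← hT]; exact hO) ν (by omega) _ (Finset.univ : Finset (Fin κ × Fin B)) rfl
      (fun m => x ^ (m.2 : ℕ) * y ^ (m.1 : ℕ)) (by
        intro cc hcc i _
        have : aevalAeval x y (box κ B fun l i => cc (l, i)) = 0 := by
          rw [← hcc, box, Fintype.sum_prod_type, map_sum]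
          refine Finset.sum_congr rfl fun l _ => ?_
          rw [map_sum]
          refine Finset.sum_congr rfl fun i _ => ?_
          rw [← CC_smul, map_smul]
          simp
        have := hbox B _ this
        exact congrFun (congrFun this i.1) i.2)
      (fun m => aevalAeval x y (box κ A fun l i => δ ((l, i), m))) (by
        intro m _
        exact ⟨_, box_wt _ _ _ _, rfl⟩) (by
        rw [← hψ0, hψ, stepPsi, map_sum]
        refine Finset.sum_congr rfl fun m _ => ?_
        rw [map_mul, map_pow]
        simp)
  apply hg0
  ext ⟨⟨l, i⟩, m⟩
  have h1 := hbox A _ (hNV m (Finset.mem_univ m))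
  have h2 := congrFun (congrFun h1 l) i
  simp only [Pi.zero_apply] at h2
  rw [← hδ, h2, Pi.zero_apply, zero_pow (pow_ne_zero _ hp.ne_zero)]

end F4


section F5
variable {k : Type} [Field k] {M : Type} [Field M] [Algebra k M]

theorem exists_minpoly (x y : M) (hx : Function.Injective (aeval x : k[X] → M)) (H : k[X][X])
    (hH : H.Monic) (hy : aevalAeval x y H = 0) :
    ∃ h : k[X][X], h.Monic ∧ Irreducible h ∧ h ∣ H ∧ ∀ G : k[X][X], aevalAeval x y G = 0 ↔ h ∣ G := by
  let _ : Algebra k[X] M := (aeval x : k[X] →ₐ[k] M).toRingHom.toAlgebra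
  have hmap : ∀ r : k[X], algebraMap k[X] M r = aeval x r := fun r => rfl
  have hev : ∀ G : k[X][X], aevalAeval x y G = aeval y G := by
    intro G
    induction G using Polynomial.induction_on' with
    | add p q hp hq => rw [map_add, map_add, hp, hq]
    | monomial n a =>
      rw [← C_mul_X_pow_eq_monomial, map_mul, map_mul, map_pow, map_pow, aevalAeval_C, aeval_C, hmap,
        aeval_X]
      simp
  have : FaithfulSMul k[X] M := (faithfulSMul_iff_algebraMap_injective k[X] M).mpr hx
  have hyint : IsIntegral k[X] y := ⟨H, hH, by rw [← hy, hev]; rfl⟩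
  refine ⟨minpoly k[X] y, minpoly.monic hyint, minpoly.irreducible hyint, ?_, ?_⟩
  · rw [hev] at hy
    exact minpoly.isIntegrallyClosed_dvd hyint hy
  · intro G
    rw [hev]
    exact minpoly.isIntegrallyClosed_dvd_iff hyint G

theorem swap_coeff (G : k[X][X]) (i l : ℕ) : ((Bivariate.swap G).coeff i).coeff l = (G.coeff l).coeff i := by
  induction G using Polynomial.induction_on' with
  | add p q hp hq => simp only [map_add, coeff_add, hp, hq]
  | monomial n a =>
    induction a using Polynomial.induction_on' with
    | add p q hp hq => simp only [map_add, coeff_add, hp, hq]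
    | monomial m b =>
      rw [Bivariate.swap_monomial_monomial]
      simp only [coeff_monomial]
      by_cases h1 : m = i <;> by_cases h2 : n = l <;> simp [h1, h2, coeff_monomial]

theorem swap_natDegree_le {G : k[X][X]} {n : ℕ} (h : ∀ l, (G.coeff l).natDegree ≤ n) :
    (Bivariate.swap G).natDegree ≤ n := by
  rw [natDegree_le_iff_coeff_eq_zero]
  intro i hi
  ext l
  rw [swap_coeff, coeff_zero]
  exact coeff_eq_zero_of_natDegree_lt ((h l).trans_lt hi)

theorem coeff_natDegree_le_swap (G : k[X][X]) (l : ℕ) :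
    (G.coeff l).natDegree ≤ (Bivariate.swap G).natDegree := by
  rw [natDegree_le_iff_coeff_eq_zero]
  intro i hi
  rw [← swap_coeff, coeff_eq_zero_of_natDegree_lt hi, coeff_zero]

theorem coeff_natDegree_le_of_dvd {h H : k[X][X]} (hd : h ∣ H) (hH : H ≠ 0) {n : ℕ}
    (hn : ∀ l, (H.coeff l).natDegree ≤ n) (l : ℕ) : (h.coeff l).natDegree ≤ n := by
  refine (coeff_natDegree_le_swap h l).trans (le_trans ?_ (swap_natDegree_le hn))
  have : Bivariate.swap h ∣ Bivariate.swap H := by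
    obtain ⟨g, rfl⟩ := hd
    exact ⟨Bivariate.swap g, map_mul Bivariate.swap h g⟩
  exact natDegree_le_of_dvd this (fun h0 => hH (by
    rw [← Bivariate.swap_swap_apply H, h0, map_zero]))

/-- coefficient Frobenius -/
noncomputable def coefMap (φ : k →+* k) : k[X][X] →+* k[X][X] := mapRingHom (mapRingHom φ)

theorem coefMap_coeff (φ : k →+* k) (G : k[X][X]) (l i : ℕ) :
    ((coefMap φ G).coeff l).coeff i = φ ((G.coeff l).coeff i) := by
  simp [coefMap]

theorem ev_coefMap (φ : k →+* k) (σ : M →+* M) (hσ : ∀ t : k, σ (algebraMap k M t) = algebraMap k M (φ t))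
    {x y : M} (hx : σ x = x) (hy : σ y = y) (G : k[X][X]) :
    σ (aevalAeval x y G) = aevalAeval x y (coefMap φ G) := by
  induction G using Polynomial.induction_on' with
  | add p q hp hq => simp only [map_add, hp, hq]
  | monomial n a =>
    rw [← C_mul_X_pow_eq_monomial]
    simp only [map_mul, map_pow, coefMap, coe_mapRingHom, map_C, Polynomial.map_X]
    have h1 : aevalAeval (R := k) x y X = y := by simp
    have h2 : ∀ a : k[X], σ (aeval x a) = aeval x (a.map φ) := by
      intro a
      induction a using Polynomial.induction_on' with
      | add p q hp hq => simp only [map_add, Polynomial.map_add, hp, hq]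
      | monomial n a => 
        rw [← C_mul_X_pow_eq_monomial]
        simp [hσ, hx]
    rw [aevalAeval_C, h1, hy, h2, aevalAeval_C]

theorem minpoly_fixed (φ : k →+* k) (σ : M →+* M)
    (hσ : ∀ t : k, σ (algebraMap k M t) = algebraMap k M (φ t))
    {x y : M} (hx : σ x = x) (hy : σ y = y) {h : k[X][X]} (hm : h.Monic)
    (hmin : ∀ G : k[X][X], aevalAeval x y G = 0 ↔ h ∣ G) (l i : ℕ) :
    φ ((h.coeff l).coeff i) = (h.coeff l).coeff i := by
  have h1 : h ∣ coefMap φ h := by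
    rw [← hmin, ← ev_coefMap φ σ hσ hx hy, (hmin h).mpr dvd_rfl, map_zero]
  have hm' : (coefMap φ h).Monic := hm.map _
  have h2 : coefMap φ h = h := by
    refine (eq_of_monic_of_dvd_of_natDegree_le hm hm' h1 ?_)
    rw [coefMap, coe_mapRingHom, hm.natDegree_map]
  rw [← coefMap_coeff, h2]

/-- Stepanov in uniform form -/
theorem stepanov_uniform (p : ℕ) [Fact p.Prime] [CharP k p] [IsAlgClosed k] (O : OrdFilt k M) (x : M)
    (hx : x ∈ O.F (-1)) (hr : ∀ r : k[X], r ≠ 0 → aeval x r ∉ O.F 1) (D : ℕ) :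
    ∃ N0 : ℕ, ∀ N ≥ N0, ∀ (h a : k[X][X]) (y : M), h.Monic → h.natDegree ≤ D →
      (∀ l, (h.coeff l).natDegree ≤ D) →
      (∀ l i, ((h.coeff l).coeff i) ^ (p ^ N) = (h.coeff l).coeff i) →
      y ∈ O.F (-D) → (∀ G : k[X][X], aevalAeval x y G = 0 ↔ h ∣ G) →
      a.natDegree ≤ D → (∀ l, (a.coeff l).natDegree ≤ D) →
      aevalAeval x y a ≠ 0 → aevalAeval x y (derivative h) ≠ 0 →
      ∃ x0 y0 : k, x0 ^ (p ^ N) = x0 ∧ y0 ^ (p ^ N) = y0 ∧ h.evalEval x0 y0 = 0 ∧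
        a.evalEval x0 y0 ≠ 0 := by
  have h1 : ∀ κ : ℕ, ∃ N0 : ℕ, 1 ≤ κ → ∀ N ≥ N0, ∀ (h a : k[X][X]) (y : M), h.Monic → h.natDegree = κ →
      (∀ l, (h.coeff l).natDegree ≤ D) →
      (∀ l i, ((h.coeff l).coeff i) ^ (p ^ N) = (h.coeff l).coeff i) →
      y ∈ O.F (-D) → (∀ G : k[X][X], aevalAeval x y G = 0 ↔ h ∣ G) →
      Wt D (D + D * D) a → aevalAeval x y a ≠ 0 → aevalAeval x y (derivative h) ≠ 0 →
      ∃ x0 y0 : k, x0 ^ (p ^ N) = x0 ∧ y0 ^ (p ^ N) = y0 ∧ h.evalEval x0 y0 = 0 ∧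
        a.evalEval x0 y0 ≠ 0 := by
    intro κ
    by_cases hκ : 1 ≤ κ
    · obtain ⟨N0, hN0⟩ := stepanov p O x hx hr κ D (D + D * D) hκ
      exact ⟨N0, fun _ => hN0⟩
    · exact ⟨0, fun h => absurd h hκ⟩
  choose N0 hN0 using h1
  refine ⟨(Finset.range (D + 1)).sup N0, fun N hN h a y hm hd hc hfix hy hmin had hac ha hh => ?_⟩
  have h1 : 1 ≤ h.natDegree := by
    by_contra h0
    have := hm.natDegree_eq_zero.mp (by omega)
    subst this
    have := (hmin 1).mpr dvd_rfl
    simp at this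
  refine hN0 h.natDegree h1 N ?_ h a y hm rfl hc hfix hy hmin (Wt.of_bound hac had) ha hh
  exact le_trans (Finset.le_sup (f := N0) (Finset.mem_range.mpr (by omega))) hN

end F5


section Hens
open IsLocalRing Function

theorem hensel_nonmonic (R : Type*) [CommRing R] (I : Ideal R)
    [IsAdicComplete I R] (f : R[X]) (a₀ : R) (h₁ : f.eval a₀ ∈ I)
    (h₂ : IsUnit (Ideal.Quotient.mk I (f.derivative.eval a₀))) :
    ∃ a : R, f.IsRoot a ∧ a - a₀ ∈ I := by
  classical
  let f' := derivative f
  -- we define a sequence `c n` by starting at `a₀` and then continually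
  -- applying the function sending `b` to `b - f(b)/f'(b)` (Newton's method).
  -- Note that `f'.eval b` is a unit, because `b` has the same residue as `a₀` modulo `I`.
  let c : ℕ → R := fun n => Nat.recOn n a₀ fun _ b => b - f.eval b * Ring.inverse (f'.eval b)
  have hc : ∀ n, c (n + 1) = c n - f.eval (c n) * Ring.inverse (f'.eval (c n)) := by
    intro n
    simp only [c]
  -- we now spend some time determining properties of the sequence `c : ℕ → R`
  -- `hc_mod`: for every `n`, we have `c n ≡ a₀ [SMOD I]`
  -- `hf'c`  : for every `n`, `f'.eval (c n)` is a unit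
  -- `hfcI`  : for every `n`, `f.eval (c n)` is contained in `I ^ (n+1)`
  have hc_mod : ∀ n, c n ≡ a₀ [SMOD I] := by
    intro n
    induction n with
    | zero => rfl
    | succ n ih => ?_
    rw [hc, sub_eq_add_neg, ← add_zero a₀]
    refine ih.add ?_
    rw [SModEq.zero, Ideal.neg_mem_iff]
    refine I.mul_mem_right _ ?_
    rw [← SModEq.zero] at h₁ ⊢
    exact (ih.eval f).trans h₁
  have hf'c : ∀ n, IsUnit (f'.eval (c n)) := by
    intro n
    have := isLocalHom_of_le_jacobson_bot I (IsAdicComplete.le_jacobson_bot I)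
    apply IsUnit.of_map (Ideal.Quotient.mk I)
    convert! h₂ using 1
    exact SModEq.def.mp ((hc_mod n).eval _)
  have hfcI : ∀ n, f.eval (c n) ∈ I ^ (n + 1) := by
    intro n
    induction n with
    | zero => simpa only [Nat.rec_zero, zero_add, pow_one] using! h₁
    | succ n ih => ?_
    rw [← taylor_eval_sub (c n), hc, sub_eq_add_neg, sub_eq_add_neg,
      add_neg_cancel_comm]
    rw [eval_eq_sum, sum_over_range' _ _ _ (lt_add_of_pos_right _ zero_lt_two), ←
      Finset.sum_range_add_sum_Ico _ (Nat.le_add_left _ _)]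
    swap
    · intro i
      rw [zero_mul]
    refine Ideal.add_mem _ ?_ ?_
    · rw [← one_add_one_eq_two, Finset.sum_range_succ, Finset.range_one, Finset.sum_singleton,
        taylor_coeff_zero, taylor_coeff_one, pow_zero, pow_one, mul_one, mul_neg,
        mul_left_comm, Ring.mul_inverse_cancel _ (hf'c n), mul_one, add_neg_cancel]
      exact Ideal.zero_mem _
    · refine Submodule.sum_mem _ ?_
      simp only [Finset.mem_Ico]
      rintro i ⟨h2i, _⟩
      have aux : n + 2 ≤ i * (n + 1) := by trans 2 * (n + 1) <;> nlinarith only [h2i]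
      refine Ideal.mul_mem_left _ _ (Ideal.pow_le_pow_right aux ?_)
      rw [pow_mul']
      exact Ideal.pow_mem_pow ((Ideal.neg_mem_iff _).2 <| Ideal.mul_mem_right _ _ ih) _
  -- we are now in the position to show that `c : ℕ → R` is a Cauchy sequence
  have aux : ∀ m n, m ≤ n → c m ≡ c n [SMOD (I ^ m • ⊤ : Ideal R)] := by
    intro m n hmn
    rw [← Ideal.one_eq_top, Ideal.smul_eq_mul, mul_one]
    obtain ⟨k, rfl⟩ := Nat.exists_eq_add_of_le hmn
    clear hmn
    induction k with
    | zero => rw [add_zero]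
    | succ k ih => ?_
    rw [← add_assoc, hc, ← add_zero (c m), sub_eq_add_neg]
    refine ih.add ?_
    symm
    rw [SModEq.zero, Ideal.neg_mem_iff]
    refine Ideal.mul_mem_right _ _ (Ideal.pow_le_pow_right ?_ (hfcI _))
    rw [add_assoc]
    exact le_self_add
  -- hence the sequence converges to some limit point `a`, which is the `a` we are looking for
  obtain ⟨a, ha⟩ := IsPrecomplete.prec' c (aux _ _)
  refine ⟨a, ?_, ?_⟩
  · show f.IsRoot a
    suffices ∀ n, f.eval a ≡ 0 [SMOD (I ^ n • ⊤ : Ideal R)] by exact IsHausdorff.haus' _ this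
    intro n
    specialize ha n
    rw [← Ideal.one_eq_top, Ideal.smul_eq_mul, mul_one] at ha ⊢
    refine (ha.symm.eval f).trans ?_
    rw [SModEq.zero]
    exact Ideal.pow_le_pow_right le_self_add (hfcI _)
  · show a - a₀ ∈ I
    specialize ha (0 + 1)
    rw [hc, pow_one, ← Ideal.one_eq_top, Ideal.smul_eq_mul, mul_one, sub_eq_add_neg] at ha
    rw [← SModEq.sub_mem, ← add_zero a₀]
    refine ha.symm.trans (SModEq.rfl.add ?_)
    rw [SModEq.zero, Ideal.neg_mem_iff]
    exact Ideal.mul_mem_right _ _ h₁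
end Hens

section F6
variable {k : Type} [Field k]

/-- Hensel's lemma for power series, with control of the derivative and of rationality -/
theorem hensel_ps (G : (PowerSeries k)[X]) (w : k)
    (h0 : (G.map PowerSeries.constantCoeff).eval w = 0)
    (h1 : (G.map PowerSeries.constantCoeff).derivative.eval w ≠ 0) :
    ∃ v : PowerSeries k, PowerSeries.constantCoeff v = w ∧ G.eval v = 0 ∧ G.derivative.eval v ≠ 0 ∧
      ∀ φ : k →+* k, φ w = w → G.map (PowerSeries.map φ) = G → PowerSeries.map φ v = v := by
  have hcc : ∀ (H : (PowerSeries k)[X]) (v : PowerSeries k), PowerSeries.constantCoeff (H.eval v) =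
      (H.map PowerSeries.constantCoeff).eval (PowerSeries.constantCoeff v) := by
    intro H v
    rw [eval_map, ← eval₂_at_apply]
  have hI : ∀ z : PowerSeries k, z ∈ Ideal.span {(PowerSeries.X : PowerSeries k)} ↔
      PowerSeries.constantCoeff z = 0 := by
    intro z
    rw [Ideal.mem_span_singleton, PowerSeries.X_dvd_iff]
  have hu : ∀ v : PowerSeries k, PowerSeries.constantCoeff v = w → IsUnit (G.derivative.eval v) := by
    intro v hv
    rw [PowerSeries.isUnit_iff_constantCoeff, hcc, hv, ← derivative_map]
    exact IsUnit.mk0 _ h1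
  obtain ⟨v, hv, hvw⟩ := hensel_nonmonic (PowerSeries k) (Ideal.span {PowerSeries.X}) G
    (PowerSeries.C w) (by rw [hI, hcc]; simpa using h0)
    ((hu _ (by simp)).map _)
  rw [hI, map_sub, sub_eq_zero] at hvw
  have hvw' : PowerSeries.constantCoeff v = w := by simpa using hvw
  refine ⟨v, hvw', hv, (hu v hvw').ne_zero, ?_⟩
  intro φ hφ hG
  set v' := PowerSeries.map φ v with hv'
  have hv'0 : G.eval v' = 0 := by
    rw [← hG, eval_map, hv', eval₂_at_apply]
    rw [show eval v G = 0 from hv, map_zero]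
  have hc' : PowerSeries.constantCoeff v' = w := by
    rw [hv']
    rw [← PowerSeries.coeff_zero_eq_constantCoeff_apply, PowerSeries.coeff_map,
      PowerSeries.coeff_zero_eq_constantCoeff_apply, hvw', hφ]
  obtain ⟨z, hz⟩ := G.binomExpansion v (v' - v)
  rw [add_sub_cancel, hv'0, show eval v G = 0 from hv, zero_add] at hz
  have : (v' - v) * (G.derivative.eval v + z * (v' - v)) = 0 := by rw [hz]; ring
  have hne : G.derivative.eval v + z * (v' - v) ≠ 0 := by
    apply IsUnit.ne_zero
    rw [PowerSeries.isUnit_iff_constantCoeff, map_add, map_mul, map_sub, hc', hvw', sub_self,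
      mul_zero, add_zero, ← PowerSeries.isUnit_iff_constantCoeff]
    exact hu v hvw'
  exact sub_eq_zero.mp ((mul_eq_zero.mp this).resolve_right hne)

/-- the place at infinity -/
structure Place (k M : Type) [Field k] [Field M] [Algebra k M] extends OrdFilt k M where
  x : M
  ι : PowerSeries k →ₐ[k] M
  ι_inj : Function.Injective ι
  x_mul : x * ι PowerSeries.X = 1
  x_mem : x ∈ F (-1)
  ι_mem : ∀ v, ι v ∈ F 0
  ι_not_mem : ∀ v, PowerSeries.constantCoeff v ≠ 0 → ι v ∉ F 1
  aeval_not_mem : ∀ r : k[X], r ≠ 0 → aeval x r ∉ F (1 - r.natDegree)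
  frob : ∀ φ : k →+* k, ∃ σ : M →+* M, ∀ v, σ (ι v) = ι (PowerSeries.map φ v)

/-- Laurent series with a single algebra structure -/
def LS (k : Type) [Field k] : Type := LaurentSeries k

noncomputable instance LS.instField (k : Type) [Field k] : Field (LS k) :=
  inferInstanceAs (Field (LaurentSeries k))

noncomputable instance LS.instAlgebra (k : Type) [Field k] : Algebra k (LS k) :=
  RingHom.toAlgebra (S := LS k) (HahnSeries.C : k →+* HahnSeries ℤ k)

/-- coefficients -/
def LS.cf {k : Type} [Field k] (f : LS k) (i : ℤ) : k := HahnSeries.coeff (Γ := ℤ) f i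

theorem LS.cf_add {k : Type} [Field k] (f g : LS k) (i : ℤ) : (f + g).cf i = f.cf i + g.cf i := rfl

theorem LS.cf_smul {k : Type} [Field k] (t : k) (g : LS k) (i : ℤ) : (t • g).cf i = t * g.cf i := by
  have h : t • g = (show LS k from HahnSeries.C t * (show HahnSeries ℤ k from g)) := Algebra.smul_def t g
  rw [h]
  change HahnSeries.coeff (HahnSeries.C t * (show HahnSeries ℤ k from g)) i = _
  rw [HahnSeries.C_mul_eq_smul, HahnSeries.coeff_smul]
  rfl

/-- order -/
noncomputable def LS.ord {k : Type} [Field k] (f : LS k) : ℤ := HahnSeries.order (Γ := ℤ) (show HahnSeries ℤ k from f)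

theorem exists_place (k : Type) [Field k] : ∃ (M : Type) (_ : Field M) (_ : Algebra k M),
    Nonempty (Place k M) := by
  let Fs : ℤ → Submodule k (LS k) := fun n =>
    { carrier := {f | ∀ i < n, f.cf i = 0}
      add_mem' := by
        intro a b ha hb i hi
        rw [LS.cf_add, ha i hi, hb i hi, add_zero]
      zero_mem' := by intro i _; rfl
      smul_mem' := by
        intro t a ha i hi
        rw [LS.cf_smul, ha i hi, mul_zero] }
  have hF : ∀ n f, f ∈ Fs n ↔ ∀ i < n, f.cf i = 0 := fun n f => Iff.rfl
  have hF2 : ∀ n f, f ≠ 0 → (f ∈ Fs n ↔ n ≤ f.ord) := by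
    intro n f hf
    rw [hF]
    exact (HahnSeries.le_order_iff_forall hf).symm
  have hmul : ∀ a b : LS k, a ≠ 0 → b ≠ 0 → (a * b).ord = a.ord + b.ord := by
    intro a b ha hb
    exact HahnSeries.order_mul (Γ := ℤ) (R := k) ha hb
  have hone : (1 : LS k).ord = 0 := HahnSeries.order_one
  let xx : LS k := (HahnSeries.single (-1 : ℤ) (1 : k) : LaurentSeries k)
  have hxpow : ∀ i : ℕ, xx ^ i = (HahnSeries.single (-i : ℤ) 1 : LaurentSeries k) := by
    intro i
    refine (HahnSeries.single_pow (Γ := ℤ) (R := k) (-1) i 1).trans ?_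
    simp
  have hcfs : ∀ (i j : ℤ), LS.cf (k := k) (HahnSeries.single i 1 : LaurentSeries k) j = if j = i then 1 else 0 := by
    intro i j
    change (HahnSeries.single i 1 : LaurentSeries k).coeff j = _
    rw [HahnSeries.coeff_single]
    congr
  have hcsum : ∀ (s : Finset ℕ) (g : ℕ → LS k) j, (∑ i ∈ s, g i).cf j = ∑ i ∈ s, (g i).cf j := by
    intro s g j
    classical
    induction s using Finset.induction_on with
    | empty => rfl
    | insert a s ha ih => rw [Finset.sum_insert ha, Finset.sum_insert ha, LS.cf_add, ih]
  refine ⟨LS k, inferInstance, inferInstance, ⟨?_⟩⟩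
  exact
  { F := Fs
    anti := by
      intro m n hmn f hf i hi
      exact hf i (lt_of_lt_of_le hi hmn)
    one_mem := by rw [hF2 _ _ one_ne_zero, hone]
    one_not_mem := by rw [hF2 _ _ one_ne_zero, hone]; norm_num
    mul_mem := by
      intro a b m n ha hb
      by_cases ha0 : a = 0
      · rw [ha0, zero_mul]; exact Submodule.zero_mem _
      by_cases hb0 : b = 0
      · rw [hb0, mul_zero]; exact Submodule.zero_mem _
      rw [hF2 _ _ ha0] at ha
      rw [hF2 _ _ hb0] at hb
      rw [hF2 _ _ (mul_ne_zero ha0 hb0), hmul _ _ ha0 hb0]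
      omega
    mul_not_mem := by
      intro a b m n ha hb
      have ha0 : a ≠ 0 := by rintro rfl; exact ha (Submodule.zero_mem _)
      have hb0 : b ≠ 0 := by rintro rfl; exact hb (Submodule.zero_mem _)
      rw [hF2 _ _ ha0] at ha
      rw [hF2 _ _ hb0] at hb
      rw [hF2 _ _ (mul_ne_zero ha0 hb0), hmul _ _ ha0 hb0]
      omega
    exists_ord := by
      intro a ha
      refine ⟨a.ord, ?_, ?_⟩ <;> rw [hF2 _ _ ha]
      omega
    residue := by
      intro a b n ha hb hb'
      have hbn : b.cf n ≠ 0 := by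
        intro h0
        apply hb'
        intro i hi
        rcases (Int.lt_add_one_iff.mp hi).lt_or_eq with h | h
        · exact hb i h
        · rw [h, h0]
      refine ⟨a.cf n / b.cf n, ?_⟩
      intro i hi
      rw [sub_eq_add_neg, ← neg_smul, LS.cf_add, LS.cf_smul]
      rcases (Int.lt_add_one_iff.mp hi).lt_or_eq with h | h
      · rw [ha i h, hb i h]; simp
      · rw [h, neg_mul, div_mul_cancel₀ _ hbn, add_neg_cancel]
    x := xx
    ι := { (show PowerSeries k →+* LS k from HahnSeries.ofPowerSeries ℤ k) with
      commutes' := by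
        intro t
        exact HahnSeries.ofPowerSeries_C t }
    ι_inj := HahnSeries.ofPowerSeries_injective
    x_mul := by
      change (HahnSeries.single (-1 : ℤ) (1 : k) : LaurentSeries k) * HahnSeries.ofPowerSeries ℤ k PowerSeries.X = 1
      rw [HahnSeries.ofPowerSeries_X, HahnSeries.single_mul_single]
      simp
    x_mem := by
      intro i hi
      rw [hcfs, if_neg hi.ne]
    ι_mem := by
      intro v i hi
      change (HahnSeries.ofPowerSeries ℤ k v).coeff i = 0
      rw [HahnSeries.ofPowerSeries_apply]
      apply HahnSeries.embDomain_of_notMem_range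
      rintro ⟨j, hj⟩
      simp at hj
      omega
    ι_not_mem := by
      intro v hv hm
      apply hv
      have := hm 0 (by norm_num)
      change (HahnSeries.ofPowerSeries ℤ k v).coeff ((0 : ℕ) : ℤ) = 0 at this
      rw [LaurentSeries.coeff_coe_powerSeries] at this
      simpa using this
    aeval_not_mem := by
      intro r hr hm
      have := hm (-(r.natDegree : ℤ)) (by omega)
      rw [aeval_eq_sum_range, hcsum] at this
      rw [Finset.sum_eq_single r.natDegree] at this
      · rw [LS.cf_smul, hxpow, hcfs] at this
        simp at this
        exact hr this
      · intro i hi hne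
        rw [LS.cf_smul, hxpow, hcfs, if_neg, mul_zero]
        omega
      · simp
    frob := by
      intro φ
      have hinj : Function.Injective (PowerSeries.map φ) := by
        intro a b hab
        ext n
        have := congrArg (PowerSeries.coeff n) hab
        simp only [PowerSeries.coeff_map] at this
        exact φ.injective this
      refine ⟨IsLocalization.map (LaurentSeries k) (S := LaurentSeries k) (M := nonZeroDivisors (PowerSeries k))
        (T := nonZeroDivisors (PowerSeries k)) (PowerSeries.map φ)
        (nonZeroDivisors_le_comap_nonZeroDivisors_of_injective _ hinj), ?_⟩
      intro v
      exact IsLocalization.map_eq (S := LaurentSeries k) (Q := LaurentSeries k) (M := nonZeroDivisors (PowerSeries k))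
        (T := nonZeroDivisors (PowerSeries k)) (nonZeroDivisors_le_comap_nonZeroDivisors_of_injective _ hinj) v }
end F6


section F7
variable {k : Type} [Field k] {M : Type} [Field M] [Algebra k M]

theorem Place.aeval_inj (P : Place k M) : Function.Injective (aeval P.x : k[X] → M) := by
  rw [injective_iff_map_eq_zero]
  intro r hr
  by_contra h
  exact P.aeval_not_mem r h (by rw [hr]; exact Submodule.zero_mem _)

theorem Place.x_ne (P : Place k M) : P.x ≠ 0 := left_ne_zero_of_mul_eq_one P.x_mul

theorem Place.sigma (P : Place k M) (φ : k →+* k) : ∃ σ : M →+* M, σ P.x = P.x ∧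
    (∀ t : k, σ (algebraMap k M t) = algebraMap k M (φ t)) ∧
    ∀ v, σ (P.ι v) = P.ι (PowerSeries.map φ v) := by
  obtain ⟨σ, hσ⟩ := P.frob φ
  refine ⟨σ, ?_, ?_, hσ⟩
  · have h1 : P.ι PowerSeries.X ≠ 0 := right_ne_zero_of_mul_eq_one P.x_mul
    have h2 := congrArg σ P.x_mul
    rw [map_mul, hσ, PowerSeries.map_X, map_one, ← P.x_mul] at h2
    exact mul_right_cancel₀ h1 h2
  · intro t
    have h1 : ∀ t : k, P.ι (PowerSeries.C t) = algebraMap k M t := fun t => P.ι.commutes t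
    rw [← h1, hσ, PowerSeries.map_C, h1]

theorem curve_point (p : ℕ) [Fact p.Prime] [CharP k p] [IsAlgClosed k] (P : Place k M) (D : ℕ) :
    ∃ N0 : ℕ, ∀ N ≥ N0, ∀ (H a : k[X][X]) (j : ℕ) (v : PowerSeries k), H.Monic → H.natDegree ≤ D →
      (∀ l, (H.coeff l).natDegree ≤ D) → j ≤ D →
      PowerSeries.map (iterateFrobenius k p N) v = v →
      aevalAeval P.x (P.x ^ j * P.ι v) H = 0 →
      aevalAeval P.x (P.x ^ j * P.ι v) (derivative H) ≠ 0 →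
      a.natDegree ≤ D → (∀ l, (a.coeff l).natDegree ≤ D) →
      aevalAeval P.x (P.x ^ j * P.ι v) a ≠ 0 →
      ∃ x0 y0 : k, x0 ^ (p ^ N) = x0 ∧ y0 ^ (p ^ N) = y0 ∧ H.evalEval x0 y0 = 0 ∧
        a.evalEval x0 y0 ≠ 0 := by
  obtain ⟨N0, h0⟩ := stepanov_uniform p P.toOrdFilt P.x P.x_mem (fun r hr h =>
    P.aeval_not_mem r hr (P.anti (by omega) h)) D
  refine ⟨N0, fun N hN H a j v hm hd hl hj hv hy hy' had hal hay => ?_⟩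
  set y := P.x ^ j * P.ι v with hydef
  obtain ⟨h, hhm, hirr, ⟨g, hg⟩, hmin⟩ := exists_minpoly P.x y P.aeval_inj H hm hy
  obtain ⟨σ, hσx, hσ, hσv⟩ := P.sigma (iterateFrobenius k p N)
  have hσy : σ y = y := by rw [hydef, map_mul, map_pow, hσx, hσv, hv]
  have hdvd : h ∣ H := ⟨g, hg⟩
  have hyF : y ∈ P.F (-D) := by
    have h1 := P.mul_mem (P.toOrdFilt.pow_mem P.x_mem j) (P.ι_mem v)
    exact P.anti (by omega) h1
  have hh' : aevalAeval P.x y (derivative h) ≠ 0 := by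
    intro h0
    apply hy'
    rw [hg, derivative_mul, map_add, map_mul, map_mul, h0, (hmin h).mpr dvd_rfl]
    simp
  obtain ⟨x0, y0, hx0, hy0, h1, h2⟩ := h0 N hN h a y hhm
    ((natDegree_le_of_dvd hdvd hm.ne_zero).trans hd)
    (coeff_natDegree_le_of_dvd hdvd hm.ne_zero hl)
    (fun l i => minpoly_fixed (iterateFrobenius k p N) σ hσ hσx hσy hhm hmin l i) hyF hmin had hal hay hh'
  refine ⟨x0, y0, hx0, hy0, ?_, h2⟩
  rw [hg, evalEval_mul, h1, zero_mul]

/-- second difference -/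
noncomputable def sd {A : Type} [CommRing A] [Algebra k A] (f : k[X]) (a b c : A) : A :=
  aeval (a + b + c) f - aeval (a + b) f - aeval (a + c) f + aeval a f

theorem sd_map {A B : Type} [CommRing A] [Algebra k A] [CommRing B] [Algebra k B] (g : A →ₐ[k] B)
    (f : k[X]) (a b c : A) : g (sd f a b c) = sd f (g a) (g b) (g c) := by
  simp only [sd, map_add, map_sub, ← aeval_algHom_apply]

theorem aeval_C_add_X (f α : k[X]) : aeval (C α + X : k[X][X]) f = taylor α (f.map C) := by
  rw [taylor_apply, comp, eval₂_map, add_comm, aeval_def]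
  rfl

theorem taylor_mapC_coeff (f α : k[X]) (l : ℕ) :
    (taylor α (f.map C)).coeff l = (hasseDeriv l f).comp α := by
  rw [taylor_coeff]
  have : hasseDeriv l (f.map C) = (hasseDeriv l f).map C := by
    ext n
    simp [hasseDeriv_coeff]
  rw [this, eval_map]
  rfl

theorem comp_sub_linear (g α β : k[X]) (hg : g.natDegree ≤ 1) :
    g.comp (α + β) - g.comp α = C (g.coeff 1) * β := by
  rw [eq_X_add_C_of_natDegree_le_one hg]
  simp
  ring

theorem aeval_sub_dvd' {A : Type} [CommRing A] [Algebra k A] (a b : A) (f : k[X]) :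
    a - b ∣ aeval a f - aeval b f := by
  have := sub_dvd_eval_sub a b (f.map (algebraMap k A))
  rwa [eval_map_algebraMap, eval_map_algebraMap] at this

theorem slice_H (f : k[X]) (d : ℕ) (hf : f.Monic) (hdeg : f.natDegree = d) (hd : (d : k) = 1)
    (hd2 : 2 ≤ d) (α β : k[X]) (hβ : β ≠ 0) (D0 : ℕ) (hα : α.natDegree ≤ D0) (hβD : β.natDegree ≤ D0) :
    ∃ H : k[X][X], sd f (C α) (C β) X = C β * H ∧ H.Monic ∧ H.natDegree = d - 1 ∧
      ∀ l, (H.coeff l).natDegree ≤ d * D0 := by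
  have hJ : sd f (C α : k[X][X]) (C β) X = taylor (α + β) (f.map C) - taylor α (f.map C)
      - C (f.comp (α + β) - f.comp α) := by
    have h1 : ∀ γ : k[X], aeval (C γ : k[X][X]) f = C (f.comp γ) := by
      intro γ
      have : aeval (C γ : k[X][X]) f = (CAlgHom (R := k) (A := k[X])) (aeval γ f) := by
        rw [← aeval_algHom_apply]; rfl
      rw [this]; rfl
    rw [sd, ← C_add, aeval_C_add_X, aeval_C_add_X, h1, h1, C_sub]
    ring
  have hdv : C β ∣ sd f (C α : k[X][X]) (C β) X := by
    have h2 : sd f (C α : k[X][X]) (C β) X =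
        (aeval (C α + C β + X) f - aeval (C α + X) f) - (aeval (C α + C β) f - aeval (C α) f) := by
      rw [sd]; ring
    rw [h2]
    refine dvd_sub ?_ ?_
    · refine dvd_trans (dvd_of_eq ?_) (aeval_sub_dvd' _ _ f)
      ring
    · refine dvd_trans (dvd_of_eq ?_) (aeval_sub_dvd' _ _ f)
      ring
  obtain ⟨H, hH⟩ := hdv
  have hc : ∀ l, β * H.coeff l = (hasseDeriv l f).comp (α + β) - (hasseDeriv l f).comp α
      - (C (f.comp (α + β) - f.comp α) : k[X][X]).coeff l := by
    intro l
    rw [← coeff_C_mul, ← hH, hJ, coeff_sub, coeff_sub, taylor_mapC_coeff, taylor_mapC_coeff]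
  have hnd : ∀ l, (hasseDeriv l f).natDegree ≤ d - l := by
    intro l; rw [← hdeg]; exact natDegree_hasseDeriv_le f l
  have hhi : ∀ l, d ≤ l → H.coeff l = 0 := by
    intro l hl
    have h1 := hc l
    rw [comp_sub_linear _ _ _ ((hnd l).trans (by omega)), coeff_C_of_ne_zero (by omega),
      coeff_eq_zero_of_natDegree_lt ((hnd l).trans_lt (by omega))] at h1
    simpa [hβ] using h1
  have hlead : H.coeff (d - 1) = 1 := by
    have h1 := hc (d - 1)
    rw [comp_sub_linear _ _ _ ((hnd _).trans (by omega)), coeff_C_of_ne_zero (by omega), hasseDeriv_coeff,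
      show 1 + (d - 1) = d by omega, ← hdeg, hf.coeff_natDegree, hdeg] at h1
    have h3 : d.choose (d - 1) = d := by
      obtain ⟨e, rfl⟩ : ∃ e, d = e + 1 := ⟨d - 1, by omega⟩
      simp
    rw [h3, hd] at h1
    apply mul_left_cancel₀ hβ
    rw [h1]; simp
  have hle : H.natDegree ≤ d - 1 := by
    rw [natDegree_le_iff_coeff_eq_zero]
    intro l hl
    exact hhi l (by omega)
  have hnat : H.natDegree = d - 1 := by
    refine le_antisymm hle (le_natDegree_of_ne_zero ?_)
    rw [hlead]; exact one_ne_zero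
  refine ⟨H, hH, ?_, hnat, ?_⟩
  · rw [Monic, leadingCoeff, hnat, hlead]
  · intro l
    by_cases h0 : H.coeff l = 0
    · rw [h0]; simp
    have h1 : (H.coeff l).natDegree ≤ (β * H.coeff l).natDegree := by
      rw [natDegree_mul hβ h0]; omega
    refine h1.trans ?_
    rw [hc]
    have hcomp : ∀ (g γ : k[X]), g.natDegree ≤ d → γ.natDegree ≤ D0 → (g.comp γ).natDegree ≤ d * D0 := by
      intro g γ hg hγ
      exact natDegree_comp_le.trans (Nat.mul_le_mul hg hγ)
    have hab : (α + β).natDegree ≤ D0 := (natDegree_add_le _ _).trans (max_le hα hβD)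
    refine (natDegree_sub_le _ _).trans (max_le ((natDegree_sub_le _ _).trans (max_le ?_ ?_)) ?_)
    · exact hcomp _ _ ((hnd l).trans (by omega)) hab
    · exact hcomp _ _ ((hnd l).trans (by omega)) hα
    · rw [coeff_C]
      split_ifs
      · exact (natDegree_sub_le _ _).trans (max_le (hcomp _ _ hdeg.le hab) (hcomp _ _ hdeg.le hα))
      · simp

theorem derivative_aeval_CX (f α : k[X]) :
    derivative (aeval (C α + X : k[X][X]) f) = aeval (C α + X : k[X][X]) (derivative f) := by
  rw [aeval_C_add_X, aeval_C_add_X, ← derivative_map, taylor_apply, taylor_apply, derivative_comp]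
  simp

theorem slice (p : ℕ) [Fact p.Prime] [CharP k p] [IsAlgClosed k] (P : Place k M) (f : k[X]) (d : ℕ)
    (hf : f.Monic) (hdeg : f.natDegree = d) (hd : (d : k) = 1) (hd2 : 2 ≤ d) (D0 : ℕ) :
    ∃ N0 : ℕ, ∀ N ≥ N0, ∀ (α β : k[X]) (j : ℕ) (v : PowerSeries k), β ≠ 0 →
      α.natDegree ≤ D0 → β.natDegree ≤ D0 → (∀ i, α.coeff i ^ (p ^ N) = α.coeff i) →
      (∀ i, β.coeff i ^ (p ^ N) = β.coeff i) → j ≤ D0 →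
      PowerSeries.map (iterateFrobenius k p N) v = v → v ≠ 0 →
      sd f (aeval P.x α) (aeval P.x β) (P.x ^ j * P.ι v) = 0 →
      aeval (aeval P.x α + aeval P.x β + P.x ^ j * P.ι v) (derivative f) -
        aeval (aeval P.x α + P.x ^ j * P.ι v) (derivative f) ≠ 0 →
      ∃ a b c : k, a ^ (p ^ N) = a ∧ b ^ (p ^ N) = b ∧ c ^ (p ^ N) = c ∧ b ≠ 0 ∧ c ≠ 0 ∧
        sd f a b c = 0 := by
  obtain ⟨N0, h0⟩ := curve_point p P (d * D0 + D0 + d)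
  refine ⟨N0, fun N hN α β j v hβ hα hβD hαf hβf hj hv hv0 hsd hsd' => ?_⟩
  obtain ⟨H, hH, hm, hnat, hl⟩ := slice_H f d hf hdeg hd hd2 α β hβ D0 hα hβD
  set y := P.x ^ j * P.ι v with hydef
  have hC : ∀ r : k[X], aevalAeval P.x y (C r) = aeval P.x r := by intro r; simp
  have hX : aevalAeval (R := k) P.x y X = y := by simp
  have hβx : aeval P.x β ≠ 0 := fun h => hβ (P.aeval_inj (by rw [h, map_zero]))
  have hy0 : y ≠ 0 := mul_ne_zero (pow_ne_zero _ P.x_ne) (fun h => hv0 (P.ι_inj (by rw [h, map_zero])))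
  have e1 : aevalAeval P.x y H = 0 := by
    have := congrArg (aevalAeval P.x y) hH
    rw [sd_map, map_mul, hC, hC, hX, hsd] at this
    exact (mul_eq_zero.mp this.symm).resolve_left hβx
  have e2 : aevalAeval P.x y (derivative H) ≠ 0 := by
    intro h
    apply hsd'
    have h1 := congrArg (fun G => aevalAeval P.x y (derivative G)) hH
    simp only [derivative_C_mul, map_mul, h, mul_zero] at h1
    rw [sd, derivative_add, derivative_sub, derivative_sub, ← C_add, derivative_aeval_CX,
      derivative_aeval_CX] at h1
    have h2 : ∀ γ : k[X], derivative (aeval (C γ : k[X][X]) f) = 0 := by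
      intro γ
      have : aeval (C γ : k[X][X]) f = C (aeval γ f) :=
        (aeval_algHom_apply (CAlgHom (R := k) (A := k[X])) γ f)
      rw [this, derivative_C]
    rw [h2, h2, sub_zero, add_zero, map_sub, ← aeval_algHom_apply, ← aeval_algHom_apply, map_add, map_add,
      hX, map_add, hC, hC] at h1
    rw [map_add, hC, hX] at h1
    exact h1
  have hCX : ∀ l, (C β * X : k[X][X]).coeff l = if l = 1 then β else 0 := by
    intro l
    rw [coeff_C_mul, coeff_X]
    by_cases h : l = 1 <;> simp [h, eq_comm]
  obtain ⟨x0, y0, hx0, hy0', h1, h2⟩ := h0 N hN H (C β * X) j v hm (by omega)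
    (fun l => (hl l).trans (by omega)) (by omega) hv e1 e2
    ((natDegree_C_mul_le _ _).trans (by rw [natDegree_X]; omega))
    (by
      intro l
      rw [hCX]
      split_ifs
      · omega
      · simp)
    (by rw [map_mul, hC, hX]; exact mul_ne_zero hβx hy0)
  have hfix : ∀ r : k[X], (∀ i, r.coeff i ^ (p ^ N) = r.coeff i) → (r.eval x0) ^ (p ^ N) = r.eval x0 := by
    intro r hr
    have : r.map (iterateFrobenius k p N) = r := by
      ext i; rw [coeff_map, iterateFrobenius_def, hr]
    have h3 := eval₂_at_apply (p := r) (iterateFrobenius k p N) x0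
    rw [← eval_map, this, iterateFrobenius_def, hx0, iterateFrobenius_def] at h3
    exact h3.symm
  have h2' : β.eval x0 * y0 ≠ 0 := by simpa [evalEval] using h2
  refine ⟨α.eval x0, β.eval x0, y0, hfix α hαf, hfix β hβf, hy0', left_ne_zero_of_mul h2',
    right_ne_zero_of_mul h2', ?_⟩
  have h3 := congrArg (aevalAeval x0 y0) hH
  rw [sd_map] at h3
  have h4 : aevalAeval x0 y0 H = H.evalEval x0 y0 := by
    rw [coe_aevalAeval_eq_evalEval]
  rw [map_mul, h4, h1, mul_zero] at h3
  simpa using h3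
end F7


section F8
variable {k : Type} [Field k] {M : Type} [Field M] [Algebra k M]

/-- homogenisation -/
noncomputable def fh (f : k[X]) (d : ℕ) : (PowerSeries k)[X] :=
  ∑ i ∈ Finset.range (d + 1), C (PowerSeries.C (f.coeff i) * PowerSeries.X ^ (d - i)) * X ^ i

theorem Place.x_pow_mul (P : Place k M) {d i : ℕ} (h : i ≤ d) :
    P.x ^ d * P.ι PowerSeries.X ^ (d - i) = P.x ^ i := by
  obtain ⟨e, rfl⟩ := Nat.exists_eq_add_of_le h
  rw [Nat.add_sub_cancel_left, pow_add, mul_assoc, ← mul_pow, P.x_mul, one_pow, mul_one]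

theorem Place.ι_C (P : Place k M) (t : k) : P.ι (PowerSeries.C t) = algebraMap k M t := P.ι.commutes t

theorem fh_eval (P : Place k M) (f : k[X]) (d : ℕ) (hd : f.natDegree = d) (T : PowerSeries k) :
    aeval (P.x * P.ι T) f = P.x ^ d * P.ι ((fh f d).eval T) := by
  rw [aeval_eq_sum_range, hd, fh, eval_finsetSum, map_sum, Finset.mul_sum]
  refine Finset.sum_congr rfl fun i hi => ?_
  have h1 := P.x_pow_mul (Nat.lt_succ_iff.mp (Finset.mem_range.mp hi))
  simp only [eval_mul, eval_C, eval_pow, eval_X, map_mul, map_pow, P.ι_C]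
  rw [Algebra.smul_def, mul_pow, ← h1]
  ring

theorem fh_deriv_eval (P : Place k M) (f : k[X]) (d : ℕ) (hd : f.natDegree = d) (hd1 : 1 ≤ d)
    (T : PowerSeries k) :
    aeval (P.x * P.ι T) (derivative f) = P.x ^ (d - 1) * P.ι ((derivative (fh f d)).eval T) := by
  conv_lhs => rw [f.as_sum_range_C_mul_X_pow, hd]
  rw [fh, derivative_sum, derivative_sum, eval_finsetSum, map_sum, map_sum, Finset.mul_sum]
  refine Finset.sum_congr rfl fun i hi => ?_
  rw [derivative_C_mul_X_pow, derivative_C_mul_X_pow]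
  rcases Nat.eq_zero_or_pos i with rfl | hi0
  · simp
  have h1 := P.x_pow_mul (d := d - 1) (i := i - 1) (by have := Finset.mem_range.mp hi; omega)
  rw [show d - 1 - (i - 1) = d - i by omega] at h1
  simp only [eval_mul, eval_C, eval_pow, eval_X, map_mul, map_pow, P.ι_C, aeval_C,
    aeval_X, map_natCast, eval_natCast]
  rw [mul_pow, ← h1]
  ring

theorem fh_cc (f : k[X]) (d : ℕ) (hf : f.coeff d = 1) :
    (fh f d).map PowerSeries.constantCoeff = X ^ d := by
  rw [fh, Polynomial.map_sum, Finset.sum_eq_single d]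
  · simp [hf]
  · intro i hi hne
    have : d - i ≠ 0 := by have := Finset.mem_range.mp hi; omega
    simp [this]
  · simp

theorem fh_map (f : k[X]) (d : ℕ) (φ : k →+* k) (hf : ∀ i, φ (f.coeff i) = f.coeff i) :
    (fh f d).map (PowerSeries.map φ) = fh f d := by
  rw [fh, Polynomial.map_sum]
  refine Finset.sum_congr rfl fun i _ => ?_
  simp [hf]

theorem lemmaL (p : ℕ) [Fact p.Prime] [CharP k p] [IsAlgClosed k] (P : Place k M) (f : k[X]) (d : ℕ)
    (hf : f.Monic) (hdeg : f.natDegree = d) (hd : (d : k) = 1) (hd2 : 2 ≤ d) :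
    ∃ N0 : ℕ, ∀ N ≥ N0, (∀ i, f.coeff i ^ (p ^ N) = f.coeff i) → ∀ b0 U0 W0 : k,
      b0 ^ (p ^ N) = b0 → U0 ^ (p ^ N) = U0 → W0 ^ (p ^ N) = W0 → U0 ≠ 0 → W0 ≠ 0 →
      (b0 + U0 + W0) ^ d - (b0 + U0) ^ d - (b0 + W0) ^ d + b0 ^ d = 0 →
      (b0 + U0 + W0) ^ (d - 1) ≠ (b0 + W0) ^ (d - 1) →
      ∃ a b c : k, a ^ (p ^ N) = a ∧ b ^ (p ^ N) = b ∧ c ^ (p ^ N) = c ∧ b ≠ 0 ∧ c ≠ 0 ∧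
        sd f a b c = 0 := by
  obtain ⟨N0, h0⟩ := slice p P f d hf hdeg hd hd2 1
  refine ⟨N0, fun N hN hfix b0 U0 W0 hb hU hW hU0 hW0 hz hz' => ?_⟩
  let A : PowerSeries k := PowerSeries.C (b0 + U0)
  let B : PowerSeries k := PowerSeries.C b0
  let g := fh f d
  let G : (PowerSeries k)[X] := g.comp (C A + X) - C (g.eval A) - g.comp (C B + X) + C (g.eval B)
  have hcd : f.coeff d = 1 := by rw [← hdeg]; exact hf.coeff_natDegree
  have hcc : ∀ T : PowerSeries k, PowerSeries.constantCoeff (g.eval T) = (PowerSeries.constantCoeff T) ^ d := by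
    intro T
    have := eval₂_at_apply (p := g) (PowerSeries.constantCoeff (R := k)) T
    rw [← this, ← eval_map, fh_cc f d hcd]
    simp
  have hGcc : G.map PowerSeries.constantCoeff = (C (b0 + U0) + X) ^ d - C ((b0 + U0) ^ d)
      - (C b0 + X) ^ d + C (b0 ^ d) := by
    simp only [G, Polynomial.map_add, Polynomial.map_sub, Polynomial.map_comp, Polynomial.map_C,
      Polynomial.map_X, hcc]
    rw [fh_cc f d hcd]
    simp [A, B]
  obtain ⟨v, hv0, hv1, hv2, hv3⟩ := hensel_ps G W0
    (by
      rw [hGcc]; simp only [eval_add, eval_sub, eval_pow, eval_C, eval_X]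
      rw [← hz])
    (by
      rw [hGcc]
      simp only [derivative_add, derivative_sub, derivative_C, derivative_pow, derivative_X, eval_add,
        eval_sub, eval_mul, eval_pow, eval_C, eval_X, hd, zero_add, map_natCast, eval_natCast, eval_one, eval_zero]
      intro h
      apply hz'
      rw [sub_zero, add_zero, mul_one, mul_one, one_mul, one_mul, sub_eq_zero] at h
      exact h)
  have hφ : ∀ t : k, t ^ (p ^ N) = t → iterateFrobenius k p N t = t := by
    intro t ht; rw [iterateFrobenius_def, ht]
  have hgm : g.map (PowerSeries.map (iterateFrobenius k p N)) = g :=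
    fh_map f d _ (fun i => hφ _ (hfix i))
  have hAm : PowerSeries.map (iterateFrobenius k p N) A = A := by
    simp only [A, PowerSeries.map_C, map_add, hφ b0 hb, hφ U0 hU]
  have hBm : PowerSeries.map (iterateFrobenius k p N) B = B := by
    simp only [B, PowerSeries.map_C, hφ b0 hb]
  have hem : ∀ T, PowerSeries.map (iterateFrobenius k p N) T = T →
      PowerSeries.map (iterateFrobenius k p N) (g.eval T) = g.eval T := by
    intro T hT
    have := eval₂_at_apply (p := g) (PowerSeries.map (iterateFrobenius k p N)) T
    rw [← this, ← eval_map, hgm, hT]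
  have hvm := hv3 _ (hφ W0 hW) (by
    simp only [G, Polynomial.map_add, Polynomial.map_sub, Polynomial.map_comp, Polynomial.map_C,
      Polynomial.map_X, hgm, hAm, hBm, hem A hAm, hem B hBm])
  have hval : ∀ t : k, aeval P.x (C t * X : k[X]) = P.x * P.ι (PowerSeries.C t) := by
    intro t; rw [P.ι_C, map_mul, aeval_C, aeval_X, mul_comm]
  have hcf : ∀ t : k, t ^ (p ^ N) = t → ∀ i, (C t * X : k[X]).coeff i ^ (p ^ N) = (C t * X : k[X]).coeff i := by
    intro t ht i
    rw [coeff_C_mul, coeff_X]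
    split_ifs
    · simpa using ht
    · simp [(Fact.out : p.Prime).ne_zero]
  have hnd : ∀ t : k, (C t * X : k[X]).natDegree ≤ 1 := fun t => (natDegree_C_mul_le _ _).trans natDegree_X_le
  refine h0 N hN (C b0 * X) (C U0 * X) 1 v ?_ (hnd _) (hnd _) (hcf _ hb) (hcf _ hU) le_rfl hvm ?_ ?_ ?_
  · exact mul_ne_zero (by simpa using hU0) X_ne_zero
  · rintro rfl
    exact hW0 (by rw [← hv0, map_zero])
  · rw [hval, hval, pow_one, sd]
    simp only [← mul_add, ← map_add]
    simp only [fh_eval P f d hdeg]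
    rw [← mul_sub, ← map_sub, ← mul_sub, ← map_sub, ← mul_add, ← map_add]
    convert mul_zero _
    rw [← map_zero P.ι]
    congr 1
    rw [← hv1]
    simp only [G, eval_add, eval_sub, eval_comp, eval_C, eval_X]
    change eval (A + v) g - eval A g - eval (B + v) g + eval B g = _
    rfl
  · rw [hval, hval, pow_one]
    simp only [← mul_add, ← map_add]
    simp only [fh_deriv_eval P f d hdeg (by omega)]
    rw [← mul_sub, ← map_sub]
    refine mul_ne_zero (pow_ne_zero _ P.x_ne) ?_
    rw [Ne, ← map_zero P.ι]
    intro h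
    apply hv2
    have h := P.ι_inj h
    rw [← h]
    simp only [G, derivative_add, derivative_sub, derivative_C, derivative_comp, derivative_X, eval_add,
      eval_sub, eval_comp, eval_C, eval_X, eval_mul, eval_one, eval_zero]
    change _ = eval (A + v) (derivative g) - eval (B + v) (derivative g)
    ring

/-- odd degree -/
theorem caseA (p : ℕ) [Fact p.Prime] [CharP k p] [IsAlgClosed k] (P : Place k M) (f : k[X]) (d : ℕ)
    (hf : f.Monic) (hdeg : f.natDegree = d) (hd : (d : k) = 1) (hd2 : 2 ≤ d) (hodd : Odd d) :
    ∃ N0 : ℕ, ∀ N ≥ N0, (∀ i, f.coeff i ^ (p ^ N) = f.coeff i) → 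
      ∃ a b c : k, a ^ (p ^ N) = a ∧ b ^ (p ^ N) = b ∧ c ^ (p ^ N) = c ∧ b ≠ 0 ∧ c ≠ 0 ∧
        sd f a b c = 0 := by
  obtain ⟨N0, h0⟩ := lemmaL p P f d hf hdeg hd hd2
  refine ⟨N0, fun N hN hfix => ?_⟩
  have hpN : p ^ N ≠ 0 := pow_ne_zero _ (Fact.out : p.Prime).ne_zero
  refine h0 N hN hfix 0 1 (-1) (zero_pow hpN) (by simp) ?_ one_ne_zero (by simp) ?_ ?_
  · have := map_neg (iterateFrobenius k p N) 1
    rw [map_one, iterateFrobenius_def] at this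
    exact this
  · rw [show (0 : k) + 1 + -1 = 0 by ring, zero_add, zero_add, hodd.neg_one_pow, one_pow, zero_pow (by omega)]
    ring
  · rw [show (0 : k) + 1 + -1 = 0 by ring, zero_add, zero_pow (by omega)]
    exact (pow_ne_zero _ (neg_ne_zero.mpr one_ne_zero)).symm
end F8


section F9
variable {k : Type} [Field k] {M : Type} [Field M] [Algebra k M]

theorem fermat_irred [IsAlgClosed k] (n : ℕ) (hn : 1 ≤ n) (hnk : (n : k) ≠ 0) (c0 : k) (hc : c0 ≠ 0) :
    Irreducible (X ^ n + C (X ^ n + C c0) : k[X][X]) := by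
  obtain ⟨ξ, hξ⟩ := IsAlgClosed.exists_pow_nat_eq (-c0) (show 0 < n by omega)
  have hξ0 : ξ ≠ 0 := by
    rintro rfl
    rw [zero_pow (by omega)] at hξ
    exact hc (neg_eq_zero.mp hξ.symm)
  have hm : (X ^ n + C (X ^ n + C c0) : k[X][X]).Monic := monic_X_pow_add_C _ (by omega)
  have hdeg : (X ^ n + C (X ^ n + C c0) : k[X][X]).natDegree = n := natDegree_X_pow_add_C
  have hroot : (X - C ξ) ∣ (X ^ n + C c0 : k[X]) := by
    rw [dvd_iff_isRoot]; simp [hξ]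
  have hE : (X ^ n + C (X ^ n + C c0) : k[X][X]).IsEisensteinAt (Ideal.span {X - C ξ}) := by
    refine ⟨?_, ?_, ?_⟩
    · rw [hm.leadingCoeff]
      intro h
      have := (Ideal.eq_top_iff_one _).mpr h
      rw [Ideal.span_singleton_eq_top] at this
      exact not_isUnit_X_sub_C ξ this
    · intro l hl
      rw [hdeg] at hl
      rw [coeff_add, coeff_X_pow, if_neg (by omega), zero_add, coeff_C]
      split_ifs
      · rwa [Ideal.mem_span_singleton]
      · exact zero_mem _
    · rw [coeff_add, coeff_X_pow, if_neg (by omega), zero_add, coeff_C, if_pos rfl, Ideal.span_singleton_pow,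
        Ideal.mem_span_singleton]
      rintro ⟨r, hr⟩
      have := congrArg (fun g => (derivative g).eval ξ) hr
      simp [hnk, hξ0, pow_two, derivative_X_pow] at this
  exact hE.irreducible ((Ideal.span_singleton_prime (X_sub_C_ne_zero ξ)).mpr (prime_X_sub_C ξ))
    hm.isPrimitive (by omega)

theorem fermat_points (p : ℕ) [Fact p.Prime] [CharP k p] [IsAlgClosed k] (P : Place k M) (n : ℕ) (hn : 1 ≤ n)
    (hnk : (n : k) ≠ 0) : ∃ N0 : ℕ, ∀ N ≥ N0, ∀ c0 : k, c0 ≠ 0 → c0 ^ (p ^ N) = c0 →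
      ∃ u w : k, u ^ (p ^ N) = u ∧ w ^ (p ^ N) = w ∧ u ≠ 0 ∧ w ≠ 0 ∧ w ^ n + u ^ n + c0 = 0 := by
  obtain ⟨N0, h0⟩ := stepanov_uniform p P.toOrdFilt P.x P.x_mem
    (fun r hr h => P.aeval_not_mem r hr (P.anti (by omega) h)) (n + 1)
  refine ⟨N0, fun N hN c0 hc hcf => ?_⟩
  have hpN : p ^ N ≠ 0 := pow_ne_zero _ (Fact.out : p.Prime).ne_zero
  let H : k[X][X] := X ^ n + C (X ^ n + C c0)
  have hm : H.Monic := monic_X_pow_add_C _ (by omega)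
  have hdeg : H.natDegree = n := natDegree_X_pow_add_C
  have hirr : Irreducible H := fermat_irred n hn hnk c0 hc
  obtain ⟨ω, hω⟩ := IsAlgClosed.exists_pow_nat_eq (-1 : k) (show 0 < n by omega)
  have hω0 : ω ≠ 0 := by
    rintro rfl
    rw [zero_pow (by omega)] at hω
    exact one_ne_zero (neg_eq_zero.mp hω.symm)
  let G : (PowerSeries k)[X] := X ^ n + C (1 + PowerSeries.C c0 * PowerSeries.X ^ n)
  have hG : G.map PowerSeries.constantCoeff = X ^ n + C 1 := by
    simp [G, show n ≠ 0 by omega]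
  obtain ⟨v, hv0, hv1, hv2, -⟩ := hensel_ps G ω (by rw [hG]; simp [hω]) (by rw [hG]; simp [hnk, hω0, derivative_X_pow])
  have hY : ∀ y : M, aevalAeval P.x y (X : k[X][X]) = y := fun y => by simp
  have hs : P.x ^ n * P.ι PowerSeries.X ^ n = 1 := by rw [← mul_pow, P.x_mul, one_pow]
  have hv1' : v ^ n + (1 + PowerSeries.C c0 * PowerSeries.X ^ n) = 0 := by simpa [G] using hv1
  have hev : aevalAeval P.x (P.x * P.ι v) H = 0 := by
    have h2 : aevalAeval P.x (P.x * P.ι v) H = P.x ^ n * P.ι (v ^ n + (1 + PowerSeries.C c0 * PowerSeries.X ^ n)) := by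
      simp only [H, map_add, map_mul, map_pow, P.ι_C, map_one, aevalAeval_C, hY, aeval_X, aeval_C]
      linear_combination (-(algebraMap k M c0)) * hs
    rw [h2, hv1', map_zero, mul_zero]
  obtain ⟨h, hhm, hhi, hhd, hh⟩ := exists_minpoly P.x (P.x * P.ι v) P.aeval_inj H hm hev
  have hhH : h = H := eq_of_monic_of_associated hhm hm
    ((hhi.dvd_irreducible_iff_associated hirr).mp hhd)
  subst hhH
  have hvne : P.ι v ≠ 0 := by
    intro hz
    have : v = 0 := P.ι_inj (by rw [hz, map_zero])
    rw [this, map_zero] at hv0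
    exact hω0 hv0.symm
  obtain ⟨x0, y0, hx0, hy0, e1, e2⟩ := h0 N hN H (C X * X) (P.x * P.ι v) hm (by omega)
    (fun l => by
      rw [coeff_add, coeff_X_pow, coeff_C]
      refine (natDegree_add_le _ _).trans (max_le ?_ ?_)
      · split_ifs <;> simp
      · split_ifs
        · rw [natDegree_X_pow_add_C]; omega
        · simp)
    (fun l i => by
      rw [coeff_add, coeff_X_pow, coeff_C]
      rw [← iterateFrobenius_def, coeff_add, map_add]
      have hc' : iterateFrobenius k p N c0 = c0 := by rw [iterateFrobenius_def, hcf]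
      congr 1
      · split_ifs
        · rw [coeff_one]; split_ifs <;> simp
        · simp
      · split_ifs
        · rw [coeff_add, map_add, coeff_X_pow, coeff_C]
          congr 1
          · split_ifs <;> simp
          · split_ifs <;> simp [hc']
        · simp)
    (by
      have h1 := P.mul_mem P.x_mem (P.ι_mem v)
      exact P.anti (by push_cast; omega) h1)
    hh
    ((natDegree_C_mul_le _ _).trans (by rw [natDegree_X]; omega))
    (fun l => by
      rw [coeff_C_mul, coeff_X]
      split_ifs <;> simp)
    (by
      simp only [map_mul, aevalAeval_C, hY, aeval_X]
      exact mul_ne_zero P.x_ne (mul_ne_zero P.x_ne hvne))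
    (by
      have : derivative H = C (C (n : k)) * X ^ (n - 1) := by
        rw [derivative_add, derivative_C, derivative_X_pow, add_zero]; simp
      rw [this]
      simp only [map_mul, map_pow, aevalAeval_C, hY, aeval_C]
      refine mul_ne_zero ?_ (pow_ne_zero _ (mul_ne_zero P.x_ne hvne))
      exact fun h => hnk ((algebraMap k M).injective (by rw [h, map_zero])))
  refine ⟨x0, y0, hx0, hy0, ?_, ?_, ?_⟩
  · rintro rfl; simp [evalEval] at e2
  · rintro rfl; simp [evalEval] at e2
  · simp [H, evalEval] at e1
    rw [← e1]; ring
end F9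


section F10
variable {k : Type} [Field k] {M : Type} [Field M] [Algebra k M]

/-- divided second difference of a power -/
def KK {A : Type} [CommRing A] (i : ℕ) (σ u v : A) : A :=
  ∑ j ∈ Finset.range (i - 1), (i.choose (j + 2) : A) * σ ^ j * ((u + v) ^ (j + 2) - u ^ (j + 2) - v ^ (j + 2))

theorem KK_map {A B : Type} [CommRing A] [CommRing B] (φ : A →+* B) (i : ℕ) (σ u v : A) :
    φ (KK i σ u v) = KK i (φ σ) (φ u) (φ v) := by
  simp only [KK, map_sum, map_mul, map_natCast, map_pow, map_sub, map_add]

theorem one_add_pow {A : Type} [CommRing A] (i : ℕ) (σ w : A) :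
    (1 + σ * w) ^ (i + 1) = 1 + (i + 1) * σ * w +
      σ ^ 2 * ∑ j ∈ Finset.range i, ((i + 1).choose (j + 2) : A) * σ ^ j * w ^ (j + 2) := by
  rw [add_comm, add_pow, Finset.sum_range_succ', Finset.sum_range_succ', Finset.mul_sum]
  simp only [one_pow, mul_one, mul_pow]
  have : ∀ j ∈ Finset.range i, σ ^ (j + 1 + 1) * w ^ (j + 1 + 1) * ((i + 1).choose (j + 1 + 1) : A)
      = σ ^ 2 * (((i + 1).choose (j + 2) : A) * σ ^ j * w ^ (j + 2)) := fun j _ => by ring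
  rw [Finset.sum_congr rfl this]
  simp
  ring

theorem KK_id {A : Type} [CommRing A] (i : ℕ) (σ u v : A) :
    (1 + σ * (u + v)) ^ i - (1 + σ * u) ^ i - (1 + σ * v) ^ i + 1 = σ ^ 2 * KK i σ u v := by
  rcases i with _ | i
  · simp [KK]
  · rw [one_add_pow, one_add_pow, one_add_pow, KK, Nat.add_sub_cancel]
    simp only [mul_sub, Finset.sum_sub_distrib]
    ring

theorem KK_zero {A : Type} [CommRing A] (i : ℕ) (u v : A) (hi : 2 ≤ i) :
    KK i 0 u v = (i : A) * (i - 1) * u * v := by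
  obtain ⟨i, rfl⟩ := Nat.exists_eq_add_of_le' hi
  rw [KK, show i + 2 - 1 = i + 1 by omega, Finset.sum_range_succ', Finset.sum_eq_zero]
  · have h2 : ((i + 2).choose 2 : A) * 2 = (i + 2) * (i + 1) := by
      have := Nat.triangle_succ (i + 1)
      have h3 : (i + 2).choose 2 * 2 = (i + 2) * (i + 1) := by
        rw [Nat.choose_two_right]
        rw [Nat.div_mul_cancel]
        · rfl
        · exact (Nat.even_mul_pred_self (i + 2)).two_dvd
      exact_mod_cast congrArg (Nat.cast : ℕ → A) h3
    push_cast
    linear_combination (u * v) * h2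
  · intro j _
    rw [zero_pow (by omega)]; ring

noncomputable def GG {A : Type} [CommRing A] [Algebra k A] (h : k[X]) (e n c q : ℕ) (s U T : A) : A :=
  U * T ^ q + U ^ q * T + ∑ i ∈ Finset.range (e + 1),
    algebraMap k A (h.coeff i) * s ^ (n * (e - i)) * KK i (s ^ (n - c)) U T

theorem GG_map {A B : Type} [CommRing A] [Algebra k A] [CommRing B] [Algebra k B] (h : k[X]) (e n c q : ℕ)
    (φ : A →+* B) (hφ : ∀ i, φ (algebraMap k A (h.coeff i)) = algebraMap k B (h.coeff i)) (s U T : A) :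
    φ (GG h e n c q s U T) = GG h e n c q (φ s) (φ U) (φ T) := by
  simp only [GG, map_add, map_mul, map_pow, map_sum, KK_map, hφ]

theorem GG_id {A : Type} [CommRing A] [Algebra k A] (p a : ℕ) [Fact p.Prime] [CharP A p] (h : k[X]) (e n c q : ℕ)
    (hq : q = p ^ a) (hqn : q = n + 1) (he : e = c + 2) (hcn : c ≤ n) (hh : h.natDegree = e) (x s U T : A)
    (hxs : x * s = 1) :
    sd (X ^ (q + 1) + h) (x ^ n) (x ^ c * U) (x ^ c * T) = x ^ (c * (q + 1)) * GG h e n c q s U T := by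
  have h1 : sd (X ^ (q + 1) : k[X]) (x ^ n) (x ^ c * U) (x ^ c * T) =
      x ^ (c * (q + 1)) * (U * T ^ q + U ^ q * T) := by
    have hadd : ∀ y z : A, (y + z) ^ q = y ^ q + z ^ q := fun y z => by rw [hq, add_pow_char_pow]
    simp only [sd, map_pow, aeval_X]
    simp only [pow_succ _ q, hadd, mul_pow, ← pow_mul]
    rw [show c * (q + 1) = c * q + c by ring, pow_add]
    ring
  have h2 : sd h (x ^ n) (x ^ c * U) (x ^ c * T) = x ^ (c * (q + 1)) * ∑ i ∈ Finset.range (e + 1),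
    algebraMap k A (h.coeff i) * s ^ (n * (e - i)) * KK i (s ^ (n - c)) U T := by
    have hx : x ^ c = x ^ n * s ^ (n - c) := by
      obtain ⟨r, rfl⟩ := Nat.exists_eq_add_of_le hcn
      rw [Nat.add_sub_cancel_left, pow_add, mul_assoc, ← mul_pow, hxs, one_pow, mul_one]
    simp only [sd, aeval_eq_sum_range, hh]
    rw [← Finset.sum_sub_distrib, ← Finset.sum_sub_distrib, ← Finset.sum_add_distrib, Finset.mul_sum]
    refine Finset.sum_congr rfl fun i hi => ?_
    have hi' := Nat.lt_succ_iff.mp (Finset.mem_range.mp hi)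
    have e1 : x ^ (n * i) = x ^ (n * e) * s ^ (n * (e - i)) := by
      obtain ⟨r, rfl⟩ := Nat.exists_eq_add_of_le hi'
      rw [Nat.add_sub_cancel_left, mul_add, pow_add, mul_assoc, ← mul_pow, hxs, one_pow, mul_one]
    have e2 : x ^ (n * e) * (s ^ (n - c)) ^ 2 = x ^ (c * (q + 1)) := by
      rw [show c * (q + 1) = n * c + c * 2 by rw [hqn]; ring, he, mul_add, pow_add, pow_add, pow_mul x n 2,
        pow_mul x c 2, hx]
      ring
    have e3 := KK_id i (s ^ (n - c)) U T
    simp only [Algebra.smul_def]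
    rw [show x ^ n + x ^ c * U + x ^ c * T = x ^ n * (1 + s ^ (n - c) * (U + T)) by rw [hx]; ring,
      show x ^ n + x ^ c * U = x ^ n * (1 + s ^ (n - c) * U) by rw [hx]; ring,
      show x ^ n + x ^ c * T = x ^ n * (1 + s ^ (n - c) * T) by rw [hx]; ring,
      mul_pow, mul_pow, mul_pow, ← pow_mul, e1, ← e2]
    linear_combination (algebraMap k A (h.coeff i) * x ^ (n * e) * s ^ (n * (e - i))) * e3
  have h3 : sd (X ^ (q + 1) + h) (x ^ n) (x ^ c * U) (x ^ c * T) =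
      sd (X ^ (q + 1) : k[X]) (x ^ n) (x ^ c * U) (x ^ c * T) + sd h (x ^ n) (x ^ c * U) (x ^ c * T) := by
    simp only [sd, map_add]; ring
  rw [h3, h1, h2, GG, ← mul_add]

theorem derivative_aeval_gen (f : k[X]) (z : M[X]) :
    derivative (aeval z f) = derivative z * aeval z (derivative f) := by
  have : ∀ g : k[X], aeval z g = (g.map (algebraMap k M)).comp z := by
    intro g
    rw [comp, eval₂_map, aeval_def]
    rfl
  rw [this, this, derivative_comp, derivative_map]

theorem caseC (p : ℕ) [Fact p.Prime] [CharP k p] [IsAlgClosed k] (P : Place k M) (h : k[X]) (a q e : ℕ)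
    (ha : 0 < a) (hq : q = p ^ a) (he : h.natDegree = e) (heq : e < q + 1) (he0 : (e : k) ≠ 0) (he1 : (e : k) ≠ 1) :
    ∃ N0 : ℕ, ∀ N ≥ N0, (∀ i, h.coeff i ^ (p ^ N) = h.coeff i) →
      ∃ a b c : k, a ^ (p ^ N) = a ∧ b ^ (p ^ N) = b ∧ c ^ (p ^ N) = c ∧ b ≠ 0 ∧ c ≠ 0 ∧
        sd (X ^ (q + 1) + h) a b c = 0 := by
  have he2 : 2 ≤ e := by
    rcases e with _ | _ | e
    · simp at he0
    · simp at he1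
    · omega
  obtain ⟨c, rfl⟩ := Nat.exists_eq_add_of_le' he2
  have hqk : (q : k) = 0 := by
    rw [hq, Nat.cast_pow, CharP.cast_eq_zero, zero_pow (by omega)]
  obtain ⟨n, rfl⟩ : ∃ n, q = n + 1 := ⟨q - 1, by omega⟩
  have hn1 : 1 ≤ n := by omega
  have hnk : (n : k) ≠ 0 := by
    intro hz
    push_cast at hqk
    rw [hz] at hqk; simp at hqk
  have hdegq : h.degree < ((n + 1 + 1 : ℕ) : WithBot ℕ) :=
    degree_le_natDegree.trans_lt (by rw [he]; exact_mod_cast heq)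
  have hfm : (X ^ (n + 1 + 1) + h).Monic := monic_X_pow_add hdegq
  have hfd : (X ^ (n + 1 + 1) + h).natDegree = n + 1 + 1 := by
    rw [natDegree_add_eq_left_of_degree_lt] <;> simp [hdegq]
    exact_mod_cast hdegq
  obtain ⟨N1, h1⟩ := fermat_points p P n hn1 hnk
  obtain ⟨N2, h2⟩ := slice p P (X ^ (n + 1 + 1) + h) (n + 1 + 1) hfm hfd (by push_cast at hqk ⊢; rw [hqk, zero_add])
    (by omega) n
  refine ⟨max N1 N2, fun N hN hfix => ?_⟩
  have hφ : ∀ t : k, t ^ (p ^ N) = t → iterateFrobenius k p N t = t := by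
    intro t ht; rw [iterateFrobenius_def, ht]
  let c0 : k := ((c + 2 : ℕ) : k) * (((c + 2 : ℕ) : k) - 1) * h.coeff (c + 2)
  have hc0 : c0 ≠ 0 := by
    refine mul_ne_zero (mul_ne_zero he0 (sub_ne_zero.mpr he1)) ?_
    rw [← he]
    change h.leadingCoeff ≠ 0
    rw [leadingCoeff_ne_zero]
    rintro rfl
    simp at he
  have hc0f : c0 ^ (p ^ N) = c0 := by
    rw [← iterateFrobenius_def]
    simp only [c0, map_mul, map_sub, map_natCast, map_one, hφ _ (hfix _)]
  obtain ⟨u, w, hu, hw, hu0, hw0, huw⟩ := h1 N (le_trans (le_max_left _ _) hN) c0 hc0 hc0f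
  let AA := (PowerSeries k)[X]
  let G : (PowerSeries k)[X] := GG h (c + 2) n c (n + 1) (C PowerSeries.X) (C (PowerSeries.C u)) X
  have hG0 : G.map PowerSeries.constantCoeff = C u * X ^ (n + 1) + C (u ^ (n + 1)) * X + C (c0 * u) * X := by
    have := GG_map (A := (PowerSeries k)[X]) (B := k[X]) h (c + 2) n c (n + 1)
      (Polynomial.mapRingHom PowerSeries.constantCoeff) (fun i => by
        rw [Polynomial.algebraMap_apply, Polynomial.algebraMap_apply, coe_mapRingHom, Polynomial.map_C]
        congr 1
        ) (C PowerSeries.X) (C (PowerSeries.C u)) X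
    simp only [coe_mapRingHom, Polynomial.map_C, Polynomial.map_X, PowerSeries.constantCoeff_X,
      PowerSeries.constantCoeff_C, map_zero] at this
    rw [this, GG, Finset.sum_eq_single (c + 2)]
    · rw [Nat.sub_self, mul_zero, pow_zero, zero_pow (by omega), KK_zero _ _ _ (by omega)]
      simp only [c0, map_mul, map_sub, map_natCast, map_pow, map_one, Polynomial.algebraMap_apply, Algebra.algebraMap_self, RingHom.id_apply]
      ring
    · intro i hi hne
      have := Finset.mem_range.mp hi
      rw [zero_pow (by
        have : c + 2 - i ≠ 0 := by omega
        positivity)]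
      ring
    · simp
  obtain ⟨v, hv0, hv1, hv2, hv3⟩ := hensel_ps G w
    (by
      rw [hG0]
      simp only [eval_add, eval_mul, eval_C, eval_X, eval_pow]
      linear_combination (u * w) * huw)
    (by
      rw [hG0]
      have : derivative (C u * X ^ (n + 1) + C (u ^ (n + 1)) * X + C (c0 * u) * X) = C (u ^ (n + 1)) + C (c0 * u) := by
        simp only [derivative_add, derivative_C_mul, derivative_X_pow, derivative_X]
        rw [hqk]; simp
      rw [this, eval_add, eval_C, eval_C]
      intro hz
      have : u * w ^ n = 0 := by linear_combination u * huw - hz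
      exact mul_ne_zero hu0 (pow_ne_zero _ hw0) this)
  have hvm := hv3 _ (hφ w hw) (by
    have := GG_map (A := (PowerSeries k)[X]) (B := (PowerSeries k)[X]) h (c + 2) n c (n + 1)
      (Polynomial.mapRingHom (PowerSeries.map (iterateFrobenius k p N))) (fun i => by
        rw [Polynomial.algebraMap_apply, coe_mapRingHom, Polynomial.map_C]
        congr 1
        change PowerSeries.map _ (PowerSeries.C _) = PowerSeries.C _
        rw [PowerSeries.map_C, hφ _ (hfix i)]
        ) (C PowerSeries.X) (C (PowerSeries.C u)) X
    simp only [coe_mapRingHom, Polynomial.map_C, Polynomial.map_X, PowerSeries.map_X,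
      PowerSeries.map_C, hφ u hu] at this
    exact this)
  have : CharP M p := charP_of_injective_algebraMap (algebraMap k M).injective p
  have hpoly : sd (X ^ (n + 1 + 1) + h) ((C P.x : M[X]) ^ n) ((C P.x) ^ c * C (P.ι (PowerSeries.C u)))
      ((C P.x) ^ c * X) = (C P.x) ^ (c * (n + 1 + 1)) * G.map P.ι.toRingHom := by
    rw [GG_id p a h (c + 2) n c (n + 1) hq rfl rfl (by omega) he (C P.x) (C (P.ι PowerSeries.X)) _ _
      (by rw [← C_mul, P.x_mul, C_1])]
    congr 1
    have := GG_map (A := (PowerSeries k)[X]) (B := M[X]) h (c + 2) n c (n + 1)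
      (Polynomial.mapRingHom P.ι.toRingHom) (fun i => by
        rw [Polynomial.algebraMap_apply, Polynomial.algebraMap_apply, coe_mapRingHom, Polynomial.map_C]
        congr 1
        exact P.ι.commutes _) (C PowerSeries.X) (C (PowerSeries.C u)) X
    simp only [coe_mapRingHom, Polynomial.map_C, Polynomial.map_X] at this
    exact this.symm
  have hx0 := P.x_ne
  have hαx : aeval P.x (X ^ n : k[X]) = P.x ^ n := by simp
  have hβx : aeval P.x (C u * X ^ c : k[X]) = P.x ^ c * P.ι (PowerSeries.C u) := by
    rw [P.ι_C, map_mul, aeval_C, map_pow, aeval_X, mul_comm]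
  have hGv : ∀ g : (PowerSeries k)[X], (g.map P.ι.toRingHom).eval (P.ι v) = P.ι (g.eval v) := fun g => by
    rw [eval_map]; exact eval₂_at_apply (p := g) P.ι.toRingHom v
  refine h2 N (le_trans (le_max_right _ _) hN) (X ^ n) (C u * X ^ c) c v ?_ ?_ ?_ ?_ ?_ ?_ hvm ?_ ?_ ?_
  · exact mul_ne_zero (by simpa using hu0) (pow_ne_zero _ X_ne_zero)
  · simp
  · exact (natDegree_C_mul_X_pow_le _ _).trans (by omega)
  · intro i
    rw [← iterateFrobenius_def, coeff_X_pow]; split_ifs <;> simp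
  · intro i
    rw [← iterateFrobenius_def, coeff_C_mul, coeff_X_pow]; split_ifs <;> simp [hφ u hu]
  · omega
  · rintro rfl
    exact hw0 (by rw [← hv0, map_zero])
  · rw [hαx, hβx]
    have := congrArg (((aeval (P.ι v) : M[X] →ₐ[M] M).restrictScalars k)) hpoly
    rw [sd_map] at this
    simp only [AlgHom.coe_restrictScalars', map_mul, map_pow, aeval_X, aeval_C, Algebra.algebraMap_self, RingHom.id_apply] at this
    rw [this]
    rw [coe_aeval_eq_eval, hGv, hv1, map_zero, mul_zero]
  · rw [hαx, hβx]
    have := congrArg derivative hpoly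
    rw [← C_pow, ← C_pow, ← C_pow, sd, derivative_C_mul, derivative_add, derivative_sub, derivative_sub] at this
    simp only [derivative_aeval_gen, derivative_add, derivative_C, derivative_C_mul, derivative_X, ← C_mul,
      zero_add, zero_mul, sub_zero, add_zero, mul_one] at this
    rw [derivative_map] at this
    have := congrArg (((aeval (P.ι v) : M[X] →ₐ[M] M).restrictScalars k)) this
    simp only [map_sub, map_mul, ← aeval_algHom_apply, map_add] at this
    simp only [AlgHom.coe_restrictScalars', map_mul, map_pow, aeval_X, aeval_C, Algebra.algebraMap_self, RingHom.id_apply] at this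
    rw [coe_aeval_eq_eval, hGv, ← mul_sub] at this
    intro hz
    simp only [derivative_add, map_add] at hz
    rw [hz, mul_zero] at this
    refine mul_ne_zero (pow_ne_zero _ hx0) ?_ this.symm
    intro hz
    exact hv2 (P.ι_inj (by rw [hz, map_zero]))
end F10


section F11
variable {k : Type} [Field k]

/-- blow-up `X ↦ Z`, `Y ↦ V Z` -/
noncomputable def psi : k[X][X] →ₐ[k] k[X][X] := aevalAeval (X : k[X][X]) (C X * X)

theorem psi_mono (t : k) (i l : ℕ) :
    psi (C (C t * X ^ i) * X ^ l : k[X][X]) = C (C t * X ^ l) * X ^ (i + l) := by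
  have hY : aevalAeval (X : k[X][X]) (C X * X) (X : k[X][X]) = C X * X := by simp
  rw [psi, map_mul, map_pow, aevalAeval_C, map_mul, map_pow, aeval_X, aeval_C, hY,
    show algebraMap k k[X][X] t = C (C t) from rfl]
  simp only [C_mul, C_pow]
  ring

theorem bi_induction {P : k[X][X] → Prop} (hadd : ∀ G H, P G → P H → P (G + H))
    (hm : ∀ (t : k) (i l : ℕ), P (C (C t * X ^ i) * X ^ l)) (G : k[X][X]) : P G := by
  induction G using Polynomial.induction_on' with
  | add p q hp hq => exact hadd _ _ hp hq
  | monomial l a =>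
    rw [← C_mul_X_pow_eq_monomial]
    induction a using Polynomial.induction_on' with
    | add p q hp hq => rw [C_add, add_mul]; exact hadd _ _ hp hq
    | monomial i t => rw [← C_mul_X_pow_eq_monomial]; exact hm t i l

theorem psi_coeff (G : k[X][X]) (j l : ℕ) :
    ((psi G).coeff j).coeff l = if l ≤ j then (G.coeff l).coeff (j - l) else 0 := by
  induction G using bi_induction with
  | hadd G H hG hH =>
    rw [map_add, coeff_add, coeff_add, hG, hH, coeff_add, coeff_add]
    split_ifs <;> simp
  | hm t i l' =>
    rw [psi_mono]
    simp only [coeff_C_mul, coeff_X_pow]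
    by_cases h1 : l = l'
    · subst h1
      by_cases h2 : j = i + l
      · subst h2; simp
      · have : l ≤ j → j - l ≠ i := by omega
        simp only [h2, if_false, mul_zero, coeff_zero, if_true, mul_one]
        split_ifs with h3
        · simp [coeff_X_pow, this h3]
        · rfl
    · simp only [mul_ite, mul_one, mul_zero, h1, if_false]
      split_ifs <;> simp [coeff_X_pow, h1]

theorem psi_coeff_add (G : k[X][X]) (i l : ℕ) : ((psi G).coeff (i + l)).coeff l = (G.coeff l).coeff i := by
  rw [psi_coeff, if_pos (by omega), Nat.add_sub_cancel]

theorem psi_inj : Function.Injective (psi : k[X][X] → k[X][X]) := by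
  intro G H h
  ext l i
  rw [← psi_coeff_add G, h, psi_coeff_add]

theorem psi_coeff_natDegree (G : k[X][X]) (j : ℕ) : ((psi G).coeff j).natDegree ≤ j := by
  rw [natDegree_le_iff_coeff_eq_zero]
  intro l hl
  rw [psi_coeff, if_neg (by omega)]

theorem psi_coeff_natDegree' (G : k[X][X]) (j : ℕ) : ((psi G).coeff j).natDegree ≤ G.natDegree := by
  rw [natDegree_le_iff_coeff_eq_zero]
  intro l hl
  rw [psi_coeff, coeff_eq_zero_of_natDegree_lt hl]
  simp

theorem psi_ne_zero {G : k[X][X]} (h : G ≠ 0) : psi G ≠ 0 := fun h0 => h (psi_inj (by rw [h0, map_zero]))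

/-- total degree -/
noncomputable def td (G : k[X][X]) : ℕ := (psi G).natDegree
/-- top form -/
noncomputable def tf (G : k[X][X]) : k[X] := (psi G).leadingCoeff

theorem td_mul {G H : k[X][X]} (hG : G ≠ 0) (hH : H ≠ 0) : td (G * H) = td G + td H := by
  rw [td, map_mul, natDegree_mul (psi_ne_zero hG) (psi_ne_zero hH)]; rfl

theorem tf_mul (G H : k[X][X]) : tf (G * H) = tf G * tf H := by
  rw [tf, map_mul, leadingCoeff_mul]; rfl

theorem tf_dvd {G H : k[X][X]} (h : G ∣ H) : tf G ∣ tf H := by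
  obtain ⟨r, rfl⟩ := h
  rw [tf_mul]; exact dvd_mul_right _ _

theorem coeff_natDegree_of_td {G : k[X][X]} {m : ℕ} (h : td G ≤ m) (l i : ℕ) (hil : m < i + l) :
    (G.coeff l).coeff i = 0 := by
  rw [← psi_coeff_add, coeff_eq_zero_of_natDegree_lt (lt_of_le_of_lt h hil), coeff_zero]

theorem natDegree_le_td {G : k[X][X]} (hG : G.Monic) : G.natDegree ≤ td G := by
  refine le_natDegree_of_ne_zero (n := G.natDegree) ?_
  intro h
  have := psi_coeff_add G 0 G.natDegree
  rw [zero_add, h, coeff_zero, hG.coeff_natDegree, coeff_one_zero] at this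
  exact zero_ne_one this

/-- monic in `Y` with total degree equal to the `Y`-degree -/
def T1 (G : k[X][X]) : Prop := G.Monic ∧ td G = G.natDegree

theorem T1.of_mul {G H : k[X][X]} (hG : G.Monic) (hH : H.Monic) (h : T1 (G * H)) : T1 G := by
  refine ⟨hG, ?_⟩
  have h1 := h.2
  rw [td_mul hG.ne_zero hH.ne_zero, hG.natDegree_mul hH] at h1
  have := natDegree_le_td hG
  have := natDegree_le_td hH
  omega

theorem T1.tf_coeff {G : k[X][X]} (h : T1 G) : (tf G).coeff G.natDegree = 1 := by
  have := psi_coeff_add G 0 G.natDegree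
  rw [zero_add, h.1.coeff_natDegree, coeff_one_zero] at this
  rw [tf, leadingCoeff]
  rwa [show (psi G).natDegree = G.natDegree from h.2]

theorem T1.tf_natDegree {G : k[X][X]} (h : T1 G) : (tf G).natDegree = G.natDegree := by
  refine le_antisymm ?_ (le_natDegree_of_ne_zero (by rw [h.tf_coeff]; exact one_ne_zero))
  exact psi_coeff_natDegree' _ _

theorem T1.tf_monic {G : k[X][X]} (h : T1 G) : (tf G).Monic := by
  rw [Monic, leadingCoeff, h.tf_natDegree, h.tf_coeff]

/-- finite codimension at most `n` -/
def CD (J : Ideal k[X][X]) (n : ℕ) : Prop :=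
  ∃ W : Submodule k k[X][X], FiniteDimensional k W ∧ Module.finrank k W ≤ n ∧
    J.restrictScalars k ⊔ W = ⊤

theorem CD.mono {J J' : Ideal k[X][X]} {n n' : ℕ} (h : CD J n) (hJ : J ≤ J') (hn : n ≤ n') : CD J' n' := by
  obtain ⟨W, h1, h2, h3⟩ := h
  refine ⟨W, h1, h2.trans hn, ?_⟩
  rw [eq_top_iff, ← h3]
  exact sup_le_sup_right (fun x hx => hJ hx) _

theorem CD.mul {J : Ideal k[X][X]} {u v : k[X][X]} {n1 n2 : ℕ} (h1 : CD (J ⊔ Ideal.span {u}) n1)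
    (h2 : CD (J ⊔ Ideal.span {v}) n2) : CD (J ⊔ Ideal.span {u * v}) (n1 + n2) := by
  obtain ⟨W1, a1, b1, c1⟩ := h1
  obtain ⟨W2, a2, b2, c2⟩ := h2
  refine ⟨W1 ⊔ W2.map (LinearMap.mulLeft k u), inferInstance, ?_, ?_⟩
  · refine (Submodule.finrank_add_le_finrank_add_finrank _ _).trans (add_le_add b1 ?_)
    exact (Submodule.finrank_map_le _ _).trans b2
  · rw [eq_top_iff]
    rintro x -
    have hx : x ∈ (J ⊔ Ideal.span {u}).restrictScalars k ⊔ W1 := by rw [c1]; trivial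
    obtain ⟨y, hy, w, hw, rfl⟩ := Submodule.mem_sup.mp hx
    obtain ⟨j, hj, z, hz, rfl⟩ := Submodule.mem_sup.mp (show y ∈ J ⊔ Ideal.span {u} from hy)
    obtain ⟨r, rfl⟩ := Ideal.mem_span_singleton'.mp hz
    have hr : r ∈ (J ⊔ Ideal.span {v}).restrictScalars k ⊔ W2 := by rw [c2]; trivial
    obtain ⟨y', hy', w', hw', rfl⟩ := Submodule.mem_sup.mp hr
    obtain ⟨j', hj', z', hz', rfl⟩ := Submodule.mem_sup.mp (show y' ∈ J ⊔ Ideal.span {v} from hy')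
    obtain ⟨r', rfl⟩ := Ideal.mem_span_singleton'.mp hz'
    rw [show j + (j' + r' * v + w') * u + w = (j + j' * u + r' * (u * v)) + (w + u * w') by ring]
    refine Submodule.add_mem_sup ?_ ?_
    · change _ ∈ J ⊔ Ideal.span {u * v}
      exact add_mem (Ideal.mem_sup_left (add_mem hj (J.mul_mem_right _ hj')))
        (Ideal.mem_sup_right (Ideal.mem_span_singleton'.mpr ⟨_, rfl⟩))
    · exact Submodule.add_mem_sup hw ⟨w', hw', rfl⟩

theorem CD.zero_of_mem {J : Ideal k[X][X]} (h : (1 : k[X][X]) ∈ J) : CD J 0 := by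
  refine ⟨⊥, inferInstance, by simp, ?_⟩
  rw [(Ideal.eq_top_iff_one J).mpr h]
  simp

theorem CD.prod {ι : Type} (s : Finset ι) (u : ι → k[X][X]) (n : ι → ℕ) (J : Ideal k[X][X])
    (h : ∀ i ∈ s, CD (J ⊔ Ideal.span {u i}) (n i)) : CD (J ⊔ Ideal.span {∏ i ∈ s, u i}) (∑ i ∈ s, n i) := by
  classical
  induction s using Finset.induction_on with
  | empty => exact CD.zero_of_mem (Ideal.mem_sup_right (by simp))
  | insert i s hi ih =>
    rw [Finset.prod_insert hi, Finset.sum_insert hi]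
    exact CD.mul (h i (Finset.mem_insert_self _ _)) (ih fun j hj => h j (Finset.mem_insert_of_mem hj))

theorem CD.map {J : Ideal k[X][X]} {n : ℕ} (h : CD J n) (g : k[X][X] →ₐ[k] k[X][X])
    (hg : Function.Surjective g) : CD (J.map g) n := by
  obtain ⟨W, a1, b1, c1⟩ := h
  refine ⟨W.map g.toLinearMap, inferInstance, (Submodule.finrank_map_le _ _).trans b1, ?_⟩
  rw [eq_top_iff]
  rintro x -
  obtain ⟨x, rfl⟩ := hg x
  have hx : x ∈ J.restrictScalars k ⊔ W := by rw [c1]; trivial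
  obtain ⟨y, hy, w, hw, rfl⟩ := Submodule.mem_sup.mp hx
  rw [map_add]
  exact Submodule.add_mem_sup (Ideal.mem_map_of_mem g hy) ⟨w, hw, rfl⟩
end F11


section F12
variable {k : Type} [Field k]

noncomputable def bx (T : Finset (ℕ × ℕ)) : (T → k) →ₗ[k] k[X][X] :=
  Fintype.linearCombination k (fun x : T => C (X ^ x.1.1) * X ^ x.1.2)

theorem bx_coeff (T : Finset (ℕ × ℕ)) (b : T → k) (i l : ℕ) :
    ((bx T b).coeff l).coeff i = if h : (i, l) ∈ T then b ⟨(i, l), h⟩ else 0 := by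
  have h0 : ∀ x : T, ((b x • (C (X ^ x.1.1) * X ^ x.1.2) : k[X][X]).coeff l).coeff i =
      if x.1 = (i, l) then b x else 0 := by
    intro x
    rw [CC_smul, coeff_C_mul, coeff_C_mul, coeff_C_mul, coeff_X_pow]
    by_cases h1 : l = x.1.2
    · by_cases h2 : i = x.1.1
      · have : x.1 = (i, l) := by rw [h1, h2]
        simp [h1, h2]
      · have : x.1 ≠ (i, l) := by intro h; apply h2; rw [h]
        simp [h1, coeff_X_pow, h2]
        intro h; exact absurd (by rw [h]) h2
    · simp [h1]
      intro h; exact absurd (by rw [h]) h1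
  rw [bx, Fintype.linearCombination_apply, finsetSum_coeff, finsetSum_coeff, Finset.sum_congr rfl fun x _ => h0 x]
  split_ifs with h
  · rw [Finset.sum_eq_single ⟨(i, l), h⟩]
    · simp
    · intro y _ hy
      rw [if_neg]
      intro h'; exact hy (Subtype.ext h')
    · simp
  · refine Finset.sum_eq_zero fun x _ => ?_
    rw [if_neg]
    intro h'; apply h; rw [← h']; exact x.2

theorem bx_inj (T : Finset (ℕ × ℕ)) : Function.Injective (bx (k := k) T) := by
  intro b b' h
  ext x
  have := bx_coeff T b x.1.1 x.1.2
  rw [h, bx_coeff] at this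
  simpa using this.symm

theorem mem_bx (T : Finset (ℕ × ℕ)) (G : k[X][X]) (h : ∀ i l, (i, l) ∉ T → (G.coeff l).coeff i = 0) :
    G ∈ LinearMap.range (bx (k := k) T) := by
  refine ⟨fun x => (G.coeff x.1.2).coeff x.1.1, ?_⟩
  ext l i
  rw [bx_coeff]
  split_ifs with h'
  · rfl
  · exact (h i l h').symm

theorem f0_bound {A B f0 : k[X][X]} {m : ℕ} (hA : T1 A) (hB : T1 B) (hc : IsCoprime (tf A) (tf B))
    (hf : f0.natDegree < A.natDegree) (hm : td ((f0 * B) %ₘ A) ≤ m) : f0 = 0 ∨ td f0 + B.natDegree ≤ m := by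
  by_contra! hcon
  obtain ⟨h0, h1⟩ := hcon
  set g := (f0 * B) /ₘ A
  set G := (f0 * B) %ₘ A
  have e : A * g = f0 * B - G := by
    rw [eq_sub_iff_add_eq, add_comm]; exact modByMonic_add_div _ _
  have e1 : td (f0 * B) = td f0 + B.natDegree := by
    rw [td_mul h0 hB.1.ne_zero, hB.2]
  have e2 : tf A * tf g = tf f0 * tf B := by
    rw [← tf_mul, e, ← tf_mul, tf, tf, map_sub, leadingCoeff_sub_of_degree_lt]
    apply degree_lt_degree
    change td G < td (f0 * B)
    omega
  have e3 : tf A ∣ tf f0 := by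
    refine hc.dvd_of_dvd_mul_right (?_ : tf A ∣ tf f0 * tf B)
    rw [← e2]; exact dvd_mul_right _ _
  have e4 : tf f0 ≠ 0 := by rw [tf, leadingCoeff_ne_zero]; exact psi_ne_zero h0
  have := natDegree_le_of_dvd e3 e4
  rw [hA.tf_natDegree] at this
  have h5 := psi_coeff_natDegree' f0 (psi f0).natDegree
  change (tf f0).natDegree ≤ _ at h5
  omega

def TT (α m : ℕ) : Finset (ℕ × ℕ) :=
  (Finset.range (m + 1) ×ˢ Finset.range α).filter fun x => x.1 + x.2 ≤ m

theorem TT_mem (α m : ℕ) (i l : ℕ) : (i, l) ∈ TT α m ↔ l < α ∧ i + l ≤ m := by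
  simp only [TT, Finset.mem_filter, Finset.mem_product, Finset.mem_range]
  omega

theorem TT_card (α m : ℕ) : (TT α m).card = ∑ l ∈ Finset.range α, (m + 1 - l) := by
  have : TT α m = (Finset.range α).biUnion fun l => (Finset.range (m + 1 - l)).image fun i => (i, l) := by
    ext ⟨i, l⟩
    rw [TT_mem]
    simp only [Finset.mem_biUnion, Finset.mem_range, Finset.mem_image, Prod.mk.injEq]
    constructor
    · rintro ⟨h1, h2⟩; exact ⟨l, h1, i, by omega, rfl, rfl⟩
    · rintro ⟨l', h1, i', h2, rfl, rfl⟩; omega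
  rw [this, Finset.card_biUnion]
  · refine Finset.sum_congr rfl fun l _ => ?_
    rw [Finset.card_image_of_injective, Finset.card_range]
    intro a b h; exact (Prod.mk.inj h).1
  · intro l _ l' _ hne
    rw [Function.onFun, Finset.disjoint_left]
    rintro ⟨i, j⟩ h1 h2
    simp only [Finset.mem_image, Prod.mk.injEq] at h1 h2
    obtain ⟨_, _, _, h⟩ := h1
    obtain ⟨_, _, _, h'⟩ := h2
    exact hne (h.trans h'.symm)

theorem bezout_lower {A B : k[X][X]} (hA : T1 A) (hB : T1 B) (hc : IsCoprime (tf A) (tf B)) {n : ℕ}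
    (hCD : CD (Ideal.span {A, B}) n) : A.natDegree * B.natDegree ≤ n := by
  obtain ⟨W, w1, w2, w3⟩ := hCD
  set α := A.natDegree with hα
  set β := B.natDegree with hβ
  rcases Nat.eq_zero_or_pos α with h0 | h0
  · rw [h0, zero_mul]; exact Nat.zero_le _
  let J := (Ideal.span {A, B} : Ideal k[X][X]).restrictScalars k
  have hq : Module.Finite k (k[X][X] ⧸ J) ∧ Module.finrank k (k[X][X] ⧸ J) ≤ n := by
    have hs : Function.Surjective (J.mkQ.comp W.subtype) := by
      intro y
      obtain ⟨x, rfl⟩ := J.mkQ_surjective y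
      have hx : x ∈ J ⊔ W := by rw [w3]; trivial
      obtain ⟨y, hy, w, hw, rfl⟩ := Submodule.mem_sup.mp hx
      refine ⟨⟨w, hw⟩, ?_⟩
      have hy0 : J.mkQ y = 0 := (Submodule.Quotient.mk_eq_zero J).mpr hy
      rw [map_add, hy0, zero_add]
      rfl
    refine ⟨Module.Finite.of_surjective _ hs, ?_⟩
    exact (LinearMap.finrank_le_finrank_of_surjective hs).trans w2
  obtain ⟨hq1, hq2⟩ := hq
  let m := α + β
  let Θ : (TT α m → k) →ₗ[k] (k[X][X] ⧸ J) := J.mkQ.comp (bx (TT α m))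
  have hrk := LinearMap.finrank_range_add_finrank_ker Θ
  rw [Module.finrank_fintype_fun_eq_card, Fintype.card_coe] at hrk
  have hr1 : Module.finrank k (LinearMap.range Θ) ≤ n := (Submodule.finrank_le _).trans hq2
  let L : (TT α α → k) →ₗ[k] k[X][X] :=
    ((modByMonicHom A).restrictScalars k).comp ((LinearMap.mulRight k B).comp (bx (TT α α)))
  have hker : (LinearMap.ker Θ).map (bx (TT α m)) ≤ LinearMap.range L := by
    rintro _ ⟨b, hb, rfl⟩
    have hG : bx (TT α m) b ∈ Ideal.span {A, B} := by
      have : Θ b = 0 := hb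
      exact (Submodule.Quotient.mk_eq_zero J).mp this
    set G := bx (TT α m) b with hGdef
    have hGd : G.degree < A.degree := by
      rw [degree_eq_natDegree hA.1.ne_zero, degree_lt_iff_coeff_zero]
      intro l hl
      ext i
      rw [bx_coeff, dif_neg, coeff_zero]
      rw [TT_mem]; omega
    have hGt : td G ≤ m := by
      rw [td, natDegree_le_iff_coeff_eq_zero]
      intro j hj
      ext l
      rw [psi_coeff, coeff_zero]
      split_ifs
      · rw [bx_coeff, dif_neg]
        rw [TT_mem]; omega
      · rfl
    obtain ⟨S, f, hSf⟩ := Ideal.mem_span_pair.mp hG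
    set f0 := f %ₘ A with hf0
    have hf0d : f0.natDegree < A.natDegree := natDegree_modByMonic_lt _ hA.1 (by
      intro h1; rw [h1, natDegree_one] at hα; omega)
    have hmod : (f0 * B) %ₘ A = G := by
      rw [← (modByMonic_eq_self_iff hA.1).mpr hGd]
      have hdv : A ∣ G - f0 * B := by
        have := modByMonic_add_div f A
        refine ⟨S + (f /ₘ A) * B, ?_⟩
        rw [← hSf, hf0]
        linear_combination (-B) * this
      rw [eq_comm, ← sub_eq_zero, ← sub_modByMonic]
      exact (modByMonic_eq_zero_iff_dvd hA.1).mpr hdv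
    have hb0 : f0 ∈ LinearMap.range (bx (k := k) (TT α α)) := by
      apply mem_bx
      intro i l hil
      rw [TT_mem] at hil
      by_cases hl : l < α
      · rcases f0_bound (m := m) hA hB hc hf0d (by rw [hmod]; exact hGt) with h | h
        · rw [h]; simp
        · exact coeff_natDegree_of_td (m := α) (by omega) l i (by omega)
      · rw [coeff_eq_zero_of_natDegree_lt (p := f0) (n := l) (by omega), coeff_zero]
    obtain ⟨b', hb'⟩ := hb0
    refine ⟨b', ?_⟩
    change (bx (TT α α) b' * B) %ₘ A = G
    rw [hb', hmod]
  have hk : Module.finrank k (LinearMap.ker Θ) ≤ (TT α α).card := by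
    rw [(Submodule.equivMapOfInjective (bx (TT α m)) (bx_inj _) (LinearMap.ker Θ)).finrank_eq]
    refine (Submodule.finrank_mono hker).trans ((LinearMap.finrank_range_le L).trans ?_)
    rw [Module.finrank_fintype_fun_eq_card, Fintype.card_coe]
  have hcard : (TT α m).card = (TT α α).card + α * β := by
    rw [TT_card, TT_card, show α * β = ∑ l ∈ Finset.range α, β by simp, ← Finset.sum_add_distrib]
    refine Finset.sum_congr rfl fun l hl => ?_
    have := Finset.mem_range.mp hl
    omega
  omega
end F12


section F13
variable {k : Type} [Field k]

theorem exists_compl_in {V : Type} [AddCommGroup V] [Module k V] (D W : Submodule k V) [FiniteDimensional k D]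
    (hW : W ≤ D) : ∃ C : Submodule k V, C ≤ D ∧ D ≤ W ⊔ C ∧
      Module.finrank k C + Module.finrank k W = Module.finrank k D := by
  obtain ⟨C, hC⟩ := Submodule.exists_isCompl (W.comap D.subtype)
  refine ⟨C.map D.subtype, Submodule.map_subtype_le _ _, ?_, ?_⟩
  · intro x hx
    have : (⟨x, hx⟩ : D) ∈ W.comap D.subtype ⊔ C := by rw [hC.sup_eq_top]; trivial
    obtain ⟨w, hw, c, hc, h⟩ := Submodule.mem_sup.mp this
    have h' : (w : V) + c = x := congrArg Subtype.val h
    rw [← h']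
    exact Submodule.add_mem_sup hw ⟨c, hc, rfl⟩
  · have h1 := Submodule.finrank_add_eq_of_isCompl hC
    have h2 : Module.finrank k (C.map D.subtype) = Module.finrank k C := Submodule.finrank_map_subtype_eq D C
    have h3 : Module.finrank k (W.comap D.subtype) = Module.finrank k W :=
      (Submodule.comapSubtypeEquivOfLe hW).finrank_eq
    omega

noncomputable def hm (j : ℕ) : k[X] →ₗ[k] k[X][X] where
  toFun g := ∑ l ∈ Finset.range (j + 1), C (C (g.coeff l) * X ^ (j - l)) * X ^ l
  map_add' g h := by
    rw [← Finset.sum_add_distrib]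
    refine Finset.sum_congr rfl fun l _ => ?_
    rw [coeff_add, C_add, add_mul, C_add, add_mul]
  map_smul' t g := by
    rw [RingHom.id_apply, Finset.smul_sum]
    refine Finset.sum_congr rfl fun l _ => ?_
    rw [CC_smul, coeff_smul, smul_eq_mul]; simp only [C_mul]; ring

theorem psi_hm (j : ℕ) (g : k[X]) (hg : g.natDegree ≤ j) : psi (hm j g) = C g * X ^ j := by
  change psi (∑ l ∈ Finset.range (j + 1), C (C (g.coeff l) * X ^ (j - l)) * X ^ l) = _
  rw [map_sum]
  have : ∀ l ∈ Finset.range (j + 1), psi (C (C (g.coeff l) * X ^ (j - l)) * X ^ l) =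
      C (C (g.coeff l) * X ^ l) * X ^ j := by
    intro l hl
    have := Finset.mem_range.mp hl
    rw [psi_mono, show j - l + l = j by omega]
  rw [Finset.sum_congr rfl this, ← Finset.sum_mul, ← map_sum]
  congr 2
  exact (as_sum_range_C_mul_X_pow' g (by omega)).symm

theorem sum_min_bound (r s n : ℕ) :
    ∑ j ∈ Finset.range n, min r (j + 1) ≤ ∑ j ∈ Finset.range n, min r (j + 1 - s) + r * s := by
  induction s with
  | zero => simp
  | succ s ih =>
    have key : ∀ n, ∑ j ∈ Finset.range n, min r (j + 1 - s) =
        ∑ j ∈ Finset.range n, min r (j + 1 - (s + 1)) + min r (n - s) := by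
      intro n
      induction n with
      | zero => simp
      | succ n ih => rw [Finset.sum_range_succ, Finset.sum_range_succ, ih, show n + 1 - (s + 1) = n - s by omega]
    have h1 := key n
    have : min r (n - s) ≤ r := min_le_left _ _
    rw [Nat.mul_succ]
    omega

theorem mem_dlt {n : ℕ} {g : k[X]} (hg : g ∈ degreeLT k n) : g = 0 ∨ g.natDegree < n := by
  by_cases h : g = 0
  · exact Or.inl h
  · right
    rw [mem_degreeLT] at hg
    exact (natDegree_lt_iff_degree_lt h).mpr hg

theorem finrank_dlt (n : ℕ) : Module.finrank k (degreeLT k n) = n := by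
  rw [(degreeLTEquiv k n).finrank_eq]; simp

instance fin_dlt (n : ℕ) : FiniteDimensional k (degreeLT k n) :=
  LinearEquiv.finiteDimensional (degreeLTEquiv k n).symm

theorem form_compl (a b : k[X]) (r s : ℕ) (ha : a.natDegree = r) (ha0 : a ≠ 0) (hb : b.natDegree ≤ s)
    (hc : IsCoprime a b) (j : ℕ) : ∃ Cj : Submodule k k[X], FiniteDimensional k Cj ∧ Cj ≤ degreeLT k (j + 1) ∧
      Module.finrank k Cj + min r (j + 1 - s) ≤ min r (j + 1) ∧
      ∀ g ∈ degreeLT k (j + 1), ∃ S f c : k[X], S ∈ degreeLT k (j + 1 - r) ∧ f ∈ degreeLT k (j + 1 - s) ∧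
        c ∈ Cj ∧ g = a * S + b * f + c := by
  let L : (degreeLT k (j + 1 - r) × degreeLT k (min r (j + 1 - s))) →ₗ[k] k[X] :=
    LinearMap.coprod ((LinearMap.mulLeft k a).comp (degreeLT k (j + 1 - r)).subtype)
      ((LinearMap.mulLeft k b).comp (degreeLT k (min r (j + 1 - s))).subtype)
  have hL : ∀ S f, L (S, f) = a * S + b * f := fun S f => by simp [L]
  have hinj : Function.Injective L := by
    rw [injective_iff_map_eq_zero]
    rintro ⟨⟨S, hS⟩, ⟨f, hf⟩⟩ h
    rw [hL] at h
    simp only at h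
    have hd : a ∣ f := by
      refine hc.dvd_of_dvd_mul_left (?_ : a ∣ b * f)
      exact ⟨-S, by linear_combination h⟩
    have hf0 : f = 0 := by
      by_contra hne
      have h1 := natDegree_le_of_dvd hd hne
      rcases mem_dlt hf with h2 | h2
      · exact hne h2
      · omega
    subst hf0
    have : S = 0 := by
      rw [mul_zero, add_zero] at h
      exact (mul_eq_zero.mp h).resolve_left ha0
    subst this
    rfl
  have hle : LinearMap.range L ≤ degreeLT k (j + 1) := by
    rintro _ ⟨⟨⟨S, hS⟩, ⟨f, hf⟩⟩, rfl⟩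
    rw [hL]
    refine add_mem ?_ ?_
    · rcases mem_dlt hS with h | h
      · simp [h]
      · rw [mem_degreeLT]
        refine degree_le_natDegree.trans_lt ?_
        have := natDegree_mul_le (p := a) (q := S)
        have h3 : (a * S).natDegree < j + 1 := by omega
        exact_mod_cast h3
    · rcases mem_dlt hf with h | h
      · simp [h]
      · rw [mem_degreeLT]
        refine degree_le_natDegree.trans_lt ?_
        have := natDegree_mul_le (p := b) (q := f)
        have h3 : (b * f).natDegree < j + 1 := by omega
        exact_mod_cast h3
  obtain ⟨Cj, h1, h2, h3⟩ := exists_compl_in _ _ hle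
  refine ⟨Cj, Submodule.finiteDimensional_of_le h1, h1, ?_, ?_⟩
  · rw [LinearMap.finrank_range_of_inj hinj, Module.finrank_prod, finrank_dlt, finrank_dlt, finrank_dlt] at h3
    omega
  · intro g hg
    obtain ⟨w, ⟨⟨⟨S, hS⟩, ⟨f, hf⟩⟩, rfl⟩, c, hc, rfl⟩ := Submodule.mem_sup.mp (h2 hg)
    refine ⟨S, f, c, hS, degreeLT_mono (min_le_right _ _) hf, hc, ?_⟩
    rw [hL]

theorem finrank_iSup_le {V : Type} [AddCommGroup V] [Module k V] (n : ℕ) (W : ℕ → Submodule k V)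
    (hW : ∀ j, FiniteDimensional k (W j)) : ∃ U : Submodule k V, FiniteDimensional k U ∧ (∀ j < n, W j ≤ U) ∧
      Module.finrank k U ≤ ∑ j ∈ Finset.range n, Module.finrank k (W j) := by
  induction n with
  | zero => exact ⟨⊥, inferInstance, by simp, by simp⟩
  | succ n ih =>
    obtain ⟨U, h1, h2, h3⟩ := ih
    refine ⟨U ⊔ W n, inferInstance, ?_, ?_⟩
    · intro j hj
      rcases Nat.lt_succ_iff_lt_or_eq.mp hj with h | rfl
      · exact (h2 j h).trans le_sup_left
      · exact le_sup_right
    · rw [Finset.sum_range_succ]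
      exact (Submodule.finrank_add_le_finrank_add_finrank _ _).trans (add_le_add_left h3 _)

theorem local_lemma (A B : k[X][X]) (r s n : ℕ) (J : Ideal k[X][X]) (hA : X ^ r ∣ psi A)
    (ha : ((psi A).coeff r).natDegree = r) (ha0 : (psi A).coeff r ≠ 0) (hB : X ^ s ∣ psi B)
    (hc : IsCoprime ((psi A).coeff r) ((psi B).coeff s)) (hAJ : A ∈ J) (hBJ : B ∈ J)
    (hJ : ∀ (t : k) (i l : ℕ), n ≤ i + l → C (C t * X ^ i) * X ^ l ∈ J) : CD J (r * s) := by
  choose Cj hC1 hC2 hC3 hC4 using form_compl ((psi A).coeff r) ((psi B).coeff s) r s ha ha0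
    (psi_coeff_natDegree B s) hc
  obtain ⟨U, hU1, hU2, hU3⟩ := finrank_iSup_le n (fun j => (Cj j).map (hm j)) (fun j => inferInstance)
  refine ⟨U, hU1, ?_, ?_⟩
  · refine hU3.trans ?_
    have h1 : ∑ j ∈ Finset.range n, Module.finrank k ((Cj j).map (hm j)) + ∑ j ∈ Finset.range n, min r (j + 1 - s)
        ≤ ∑ j ∈ Finset.range n, min r (j + 1) := by
      rw [← Finset.sum_add_distrib]
      refine Finset.sum_le_sum fun j _ => ?_
      have := Submodule.finrank_map_le (hm j) (Cj j)
      have := hC3 j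
      omega
    have := sum_min_bound r s n
    omega
  have main : ∀ i ≤ n, ∀ G : k[X][X], X ^ (n - i) ∣ psi G → G ∈ J.restrictScalars k ⊔ U := by
    intro i
    induction i with
    | zero =>
      intro _ G hG
      rw [Nat.sub_zero, X_pow_dvd_iff] at hG
      refine Submodule.mem_sup_left ?_
      change G ∈ J
      rw [G.as_sum_range_C_mul_X_pow]
      refine sum_mem fun l _ => ?_
      rw [(G.coeff l).as_sum_range_C_mul_X_pow, map_sum, Finset.sum_mul]
      refine sum_mem fun i _ => ?_
      by_cases h : n ≤ i + l
      · exact hJ _ _ _ h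
      · rw [← psi_coeff_add, hG _ (by omega)]
        simp
    | succ i ih =>
      intro hi G hG
      obtain ⟨j, hj⟩ : ∃ j, n - (i + 1) = j := ⟨_, rfl⟩
      have hj1 : n - i = j + 1 := by omega
      rw [hj] at hG
      rw [hj1] at ih
      obtain ⟨S, f, c, hS, hf, hcc, hg⟩ := hC4 j ((psi G).coeff j) (by
        rw [mem_degreeLT]
        refine degree_le_natDegree.trans_lt ?_
        exact_mod_cast Nat.lt_succ_of_le (psi_coeff_natDegree G j))
      -- the three correction terms
      have aux : ∀ (B : k[X][X]) (s : ℕ) (f : k[X]), X ^ s ∣ psi B → f ∈ degreeLT k (j + 1 - s) →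
          X ^ (j + 1) ∣ psi (B * hm (j - s) f) - C ((psi B).coeff s * f) * X ^ j := by
        intro B s f hB hf
        rcases mem_dlt hf with h | h
        · simp [h]
        · rw [map_mul, psi_hm _ _ (by omega)]
          have h1 : X ^ (s + 1) ∣ psi B - C ((psi B).coeff s) * X ^ s := by
            rw [X_pow_dvd_iff] at hB ⊢
            intro d hd
            rw [coeff_sub, coeff_C_mul, coeff_X_pow]
            split_ifs with h2
            · rw [h2]; simp
            · rw [hB d (by omega)]; simp
          obtain ⟨e, rfl⟩ : ∃ e, j = s + e := ⟨j - s, by omega⟩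
          rw [Nat.add_sub_cancel_left]
          obtain ⟨w, hw⟩ := h1
          refine ⟨w * C f, ?_⟩
          rw [C_mul]
          linear_combination (C f * X ^ e) * hw
      have k1 := aux A r S hA hS
      have k2 := aux B s f hB hf
      have k3 : psi (hm j c) = C c * X ^ j := psi_hm _ _ (by
        rcases mem_dlt (hC2 j hcc) with h | h
        · simp [h]
        · omega)
      have k0 : X ^ (j + 1) ∣ psi G - C ((psi G).coeff j) * X ^ j := by
        rw [X_pow_dvd_iff] at hG ⊢
        intro d hd
        rw [coeff_sub, coeff_C_mul, coeff_X_pow]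
        split_ifs with h2
        · rw [h2]; simp
        · rw [hG d (by omega)]; simp
      have h4 := ih (by omega) (G - A * hm (j - r) S - B * hm (j - s) f - hm j c) (by
        rw [map_sub, map_sub, map_sub, k3]
        have := dvd_sub (dvd_sub k0 k1) k2
        rw [hg] at this
        convert this using 1
        simp only [C_add]
        ring)
      have h5 : G = (G - A * hm (j - r) S - B * hm (j - s) f - hm j c) +
          ((A * hm (j - r) S + B * hm (j - s) f) + hm j c) := by ring
      rw [h5]
      refine add_mem h4 (Submodule.add_mem_sup ?_ ?_)
      · exact J.add_mem (J.mul_mem_right _ hAJ) (J.mul_mem_right _ hBJ)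
      · exact hU2 j (by omega) ⟨c, hcc, rfl⟩
  rw [eq_top_iff]
  rintro G -
  exact main n le_rfl G (by simp)
end F13


section F14
variable {k : Type} [Field k]

noncomputable def En (k : Type) [Field k] (d : ℕ) : k[X] := C (2⁻¹ : k) * ((X + C 1) ^ d + (X - C 1) ^ d)

theorem En_natDegree_le (d : ℕ) : (En k d).natDegree ≤ d := by
  refine (natDegree_C_mul_le _ _).trans ((natDegree_add_le _ _).trans (max_le ?_ ?_))
  · rw [natDegree_pow, natDegree_X_add_C, mul_one]
  · rw [natDegree_pow, natDegree_X_sub_C, mul_one]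

theorem En_coeff_d (d : ℕ) (h2 : (2 : k) ≠ 0) : (En k d).coeff d = 1 := by
  have h1 : ((X + C (1 : k)) ^ d).coeff d = 1 := by
    have := ((monic_X_add_C (1 : k)).pow d).coeff_natDegree
    rwa [natDegree_pow, natDegree_X_add_C, mul_one] at this
  have h3 : ((X - C (1 : k)) ^ d).coeff d = 1 := by
    have := ((monic_X_sub_C (1 : k)).pow d).coeff_natDegree
    rwa [natDegree_pow, natDegree_X_sub_C, mul_one] at this
  rw [En, coeff_C_mul, coeff_add, h1, h3]
  field_simp
  norm_num

theorem En_natDegree (d : ℕ) (h2 : (2 : k) ≠ 0) : (En k d).natDegree = d :=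
  le_antisymm (En_natDegree_le d) (le_natDegree_of_ne_zero (by rw [En_coeff_d d h2]; exact one_ne_zero))

theorem En_monic (d : ℕ) (h2 : (2 : k) ≠ 0) : (En k d).Monic := by
  rw [Monic, leadingCoeff, En_natDegree d h2, En_coeff_d d h2]

theorem En_odd (d : ℕ) (hd : Even d) (h2 : (2 : k) ≠ 0) (i : ℕ) (hi : ¬ 2 ∣ i) : (En k d).coeff i = 0 := by
  have h1 : (En k d).comp (-X) = En k d := by
    simp only [En, mul_comp, C_comp, add_comp, pow_comp, X_comp, sub_comp]
    rw [show (-X + C 1 : k[X]) = - (X - C 1) by ring, show (-X - C 1 : k[X]) = - (X + C 1) by ring,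
      hd.neg_pow, hd.neg_pow, add_comm]
  have h3 := congrArg (fun g => g.coeff i) h1
  simp only [show (-X : k[X]) = C (-1) * X by simp, comp_C_mul_X_coeff] at h3
  have hio : Odd i := by rw [← Nat.not_even_iff_odd, even_iff_two_dvd]; exact hi
  rw [hio.neg_one_pow] at h3
  have : 2 * (En k d).coeff i = 0 := by linear_combination - h3
  exact (mul_eq_zero.mp this).resolve_left h2

/-- `E(Y) - E(X)` -/
noncomputable def Tm (E : k[X]) : k[X][X] := E.map C - C E

theorem psi_Tm_coeff (E : k[X]) (j : ℕ) : (psi (Tm E)).coeff j = C (E.coeff j) * (X ^ j - 1) := by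
  induction E using Polynomial.induction_on' with
  | add f g hf hg =>
    have : Tm (f + g) = Tm f + Tm g := by simp only [Tm, Polynomial.map_add, C_add]; ring
    rw [this, map_add, coeff_add, hf, hg, coeff_add, C_add]; ring
  | monomial n a =>
    have h1 : Tm (monomial n a) = C (C a * X ^ 0) * X ^ n - C (C a * X ^ n) * X ^ 0 := by
      rw [Tm, ← C_mul_X_pow_eq_monomial]; simp
    rw [h1, map_sub, psi_mono, psi_mono, zero_add, add_zero, coeff_sub, coeff_C_mul, coeff_C_mul, coeff_X_pow,
      coeff_monomial]
    split_ifs with h h' h'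
    · subst h; simp; ring
    · omega
    · omega
    · simp

theorem Tm_dvd (d : ℕ) (hd : Even d) (h2 : (2 : k) ≠ 0) : (X ^ 2 - C (X ^ 2) : k[X][X]) ∣ Tm (En k d) := by
  have h : expand k 2 (contract 2 (En k d)) = En k d := by
    ext i
    rw [coeff_expand (by norm_num)]
    split_ifs with hi
    · rw [coeff_contract (by norm_num), Nat.div_mul_cancel hi]
    · rw [En_odd d hd h2 i hi]
  have h3 := sub_dvd_eval_sub (X ^ 2 : k[X][X]) (C (X ^ 2)) (((contract 2 (En k d)).map C).map C)
  convert h3 using 1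
  have e1 : ∀ g : k[X], (expand k 2 g).map C = eval (X ^ 2 : k[X][X]) ((g.map C).map C) := by
    intro g
    induction g using Polynomial.induction_on' with
    | add f g hf hg => simp only [map_add, Polynomial.map_add, eval_add, hf, hg]
    | monomial n a => simp only [expand_C, expand_X, ← C_mul_X_pow_eq_monomial, Polynomial.map_mul, Polynomial.map_pow, map_C, map_X, eval_mul, eval_pow, eval_C, eval_X, map_mul, map_pow, ← pow_mul, mul_comm 2 n]
  have e2 : ∀ g : k[X], C (expand k 2 g) = eval (C (X ^ 2) : k[X][X]) ((g.map C).map C) := by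
    intro g
    induction g using Polynomial.induction_on' with
    | add f g hf hg => simp only [map_add, Polynomial.map_add, eval_add, hf, hg]
    | monomial n a => simp only [expand_C, expand_X, ← C_mul_X_pow_eq_monomial, Polynomial.map_mul, Polynomial.map_pow, map_C, map_X, eval_mul, eval_pow, eval_C, eval_X, map_mul, map_pow, ← pow_mul, mul_comm 2 n]
  rw [Tm]
  conv_lhs => rw [← h]
  rw [e1, e2]

theorem sqd_monic : (X ^ 2 - C (X ^ 2) : k[X][X]).Monic := monic_X_pow_sub_C _ (by norm_num)

theorem psi_sqd : psi (X ^ 2 - C (X ^ 2) : k[X][X]) = C (X ^ 2 - 1) * X ^ 2 := by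
  have h1 : (X ^ 2 - C (X ^ 2) : k[X][X]) = C (C 1 * X ^ 0) * X ^ 2 - C (C 1 * X ^ 2) * X ^ 0 := by simp
  rw [h1, map_sub, psi_mono, psi_mono]
  simp; ring

theorem Tm_natDegree (d : ℕ) (hd : 2 ≤ d) (h2 : (2 : k) ≠ 0) : (Tm (En k d)).natDegree = d ∧ (Tm (En k d)).Monic := by
  have h1 : ((En k d).map (C : k →+* k[X])).Monic := (En_monic d h2).map _
  have h3 : ((En k d).map (C : k →+* k[X])).natDegree = d := by
    rw [natDegree_map_eq_of_injective C_injective, En_natDegree d h2]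
  have h4 : degree (C (En k d) : k[X][X]) < ((En k d).map (C : k →+* k[X])).degree := by
    refine degree_C_le.trans_lt ?_
    rw [degree_eq_natDegree h1.ne_zero, h3]
    exact_mod_cast (show 0 < d by omega)
  exact ⟨by rw [Tm, natDegree_sub_C, h3], h1.sub_of_left h4⟩

theorem exists_F (d : ℕ) (hd : Even d) (hd2 : 2 ≤ d) (h2 : (2 : k) ≠ 0) : ∃ F : k[X][X],
    Tm (En k d) = (X ^ 2 - C (X ^ 2)) * F ∧ F.natDegree = d - 2 ∧ T1 F ∧ (X ^ 2 - 1) * tf F = X ^ d - 1 := by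
  obtain ⟨F, hF⟩ := Tm_dvd d hd h2
  obtain ⟨hn, hm⟩ := Tm_natDegree d hd2 h2
  have hFm : F.Monic := by
    rw [hF] at hm
    exact sqd_monic.of_mul_monic_left hm
  have hFd : F.natDegree = d - 2 := by
    rw [hF, sqd_monic.natDegree_mul hFm, natDegree_X_pow_sub_C] at hn
    omega
  have hX : ∀ n, 0 < n → (X ^ n - 1 : k[X]) ≠ 0 := fun n hn => by
    rw [← C_1]; exact X_pow_sub_C_ne_zero hn 1
  have hlt : (psi (Tm (En k d))).natDegree = d := by
    refine le_antisymm ?_ ?_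
    · rw [natDegree_le_iff_coeff_eq_zero]
      intro j hj
      rw [psi_Tm_coeff, coeff_eq_zero_of_natDegree_lt ((En_natDegree_le d).trans_lt hj)]; simp
    · refine le_natDegree_of_ne_zero ?_
      rw [psi_Tm_coeff, En_coeff_d d h2, C_1, one_mul]
      exact hX d (by omega)
  have hl : (psi (Tm (En k d))).leadingCoeff = X ^ d - 1 := by
    rw [leadingCoeff, hlt, psi_Tm_coeff, En_coeff_d d h2, C_1, one_mul]
  have hlw : (C (X ^ 2 - 1) * X ^ 2 : k[X][X]).natDegree = 2 := natDegree_C_mul_X_pow _ _ (hX 2 (by norm_num))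
  refine ⟨F, hF, hFd, ⟨hFm, ?_⟩, ?_⟩
  · rw [hF, map_mul, psi_sqd, natDegree_mul _ (psi_ne_zero hFm.ne_zero), hlw] at hlt
    · rw [td, hFd]; omega
    · intro h; rw [h] at hlw; simp at hlw
  · rw [hF, map_mul, psi_sqd, leadingCoeff_mul, leadingCoeff_C_mul_X_pow] at hl
    exact hl

theorem sqfree_Xd (d : ℕ) (hd : (d : k) = 1) : Squarefree (X ^ d - 1 : k[X]) := by
  rw [← C_1]
  exact (separable_X_pow_sub_C (1 : k) (by rw [hd]; exact one_ne_zero) one_ne_zero).squarefree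
end F14


section F15
variable {k : Type} [Field k] {M : Type} [Field M] [Algebra k M]

theorem ev_psi (x w : M) (h : k[X][X]) : aevalAeval w x (psi h) = aevalAeval x (x * w) h := by
  have hY : ∀ x y : M, aevalAeval x y (X : k[X][X]) = y := fun x y => by simp
  induction h using bi_induction with
  | hadd G H hG hH => simp only [map_add, hG, hH]
  | hm t i l =>
    rw [psi_mono]
    simp only [map_mul, map_pow, aevalAeval_C, hY, aeval_X, aeval_C]
    ring

/-- homogenised polynomial -/
noncomputable def gh (h : k[X][X]) : (PowerSeries k)[X] :=
  ∑ j ∈ Finset.range (td h + 1), ((psi h).coeff j).map PowerSeries.C * C (PowerSeries.X ^ (td h - j))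

theorem gh_cc (h : k[X][X]) : (gh h).map PowerSeries.constantCoeff = tf h := by
  rw [gh, Polynomial.map_sum, Finset.sum_eq_single (td h)]
  · rw [Polynomial.map_mul, Polynomial.map_map, map_C]
    have : (PowerSeries.constantCoeff (R := k)).comp PowerSeries.C = RingHom.id k := by
      ext t; simp
    rw [this, Polynomial.map_id]
    simp [tf, td]
  · intro i hi hne
    have : td h - i ≠ 0 := by have := Finset.mem_range.mp hi; omega
    simp [this]
  · simp

theorem gh_eval (P : Place k M) (h : k[X][X]) (v : PowerSeries k) :
    aevalAeval P.x (P.x * P.ι v) h = P.x ^ td h * P.ι ((gh h).eval v) := by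
  have hY : ∀ x y : M, aevalAeval x y (X : k[X][X]) = y := fun x y => by simp
  rw [← ev_psi]
  conv_lhs => rw [(psi h).as_sum_range_C_mul_X_pow]
  rw [map_sum, gh, eval_finsetSum, map_sum, Finset.mul_sum]
  refine Finset.sum_congr rfl fun j hj => ?_
  have h1 := P.x_pow_mul (Nat.lt_succ_iff.mp (Finset.mem_range.mp hj))
  change P.x ^ td h * P.ι PowerSeries.X ^ (td h - j) = P.x ^ j at h1
  simp only [map_mul, map_pow, aevalAeval_C, hY, eval_mul, eval_pow, eval_C]
  have h3 : P.ι (eval v (((psi h).coeff j).map PowerSeries.C)) = aeval (P.ι v) ((psi h).coeff j) := by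
    rw [aeval_algHom_apply, aeval_def, eval_map]; rfl
  rw [h3, ← h1]
  ring

theorem t1_points (p : ℕ) [Fact p.Prime] [CharP k p] [IsAlgClosed k] (P : Place k M) (D : ℕ) :
    ∃ N0 : ℕ, ∀ N ≥ N0, ∀ h a : k[X][X], T1 h → h.natDegree ≤ D → 0 < h.natDegree → Irreducible h →
      Squarefree (tf h) → (∀ l i, ((h.coeff l).coeff i) ^ (p ^ N) = (h.coeff l).coeff i) →
      a.natDegree ≤ D → (∀ l, (a.coeff l).natDegree ≤ D) → ¬ h ∣ a →
      ∃ x0 y0 : k, x0 ^ (p ^ N) = x0 ∧ y0 ^ (p ^ N) = y0 ∧ h.evalEval x0 y0 = 0 ∧ a.evalEval x0 y0 ≠ 0 := by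
  obtain ⟨N0, h0⟩ := stepanov_uniform p P.toOrdFilt P.x P.x_mem
    (fun r hr h => P.aeval_not_mem r hr (P.anti (by omega) h)) (D + 1)
  refine ⟨N0, fun N hN h a hT hD hpos hirr hsq hfix ha1 ha2 hna => ?_⟩
  obtain ⟨η, hη⟩ := IsAlgClosed.exists_root (tf h) (by
    intro h1
    have h3 : (tf h).natDegree = 0 := natDegree_eq_of_degree_eq_some h1
    rw [hT.tf_natDegree] at h3
    omega)
  have hsep : (tf h).Separable := PerfectField.separable_iff_squarefree.mpr hsq
  have hη' : (derivative (tf h)).eval η ≠ 0 := by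
    have := hsep.aeval_derivative_ne_zero (x := η) (by rw [coe_aeval_eq_eval]; exact hη)
    rwa [coe_aeval_eq_eval] at this
  obtain ⟨v, hv0, hv1, hv2, -⟩ := hensel_ps (gh h) η (by rw [gh_cc]; exact hη) (by rw [gh_cc]; exact hη')
  have hev : aevalAeval P.x (P.x * P.ι v) h = 0 := by rw [gh_eval, hv1, map_zero, mul_zero]
  obtain ⟨h', hhm, hhi, hhd, hh⟩ := exists_minpoly P.x (P.x * P.ι v) P.aeval_inj h hT.1 hev
  have hhH : h' = h := eq_of_monic_of_associated hhm hT.1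
    ((hhi.dvd_irreducible_iff_associated hirr).mp hhd)
  subst hhH
  refine h0 N hN h' a (P.x * P.ι v) hT.1 (by omega) (fun l => ?_) hfix ?_ hh (by omega)
    (fun l => (ha2 l).trans (by omega)) (fun h1 => hna ((hh a).mp h1)) ?_
  · rw [natDegree_le_iff_coeff_eq_zero]
    intro i hi
    exact coeff_natDegree_of_td hT.2.le l i (by omega)
  · have h1 := P.mul_mem P.x_mem (P.ι_mem v)
    exact P.anti (by push_cast; omega) h1
  · intro h1
    rw [hh] at h1
    have h3 : derivative h' = 0 := by
      by_contra hne
      have := natDegree_le_of_dvd h1 hne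
      have := natDegree_derivative_lt (p := h') (by omega)
      omega
    apply hη'
    have : derivative (tf h') = 0 := by
      ext l
      rw [coeff_derivative, coeff_zero]
      have h4 := congrArg (fun g => (g.coeff l).coeff (td h' - (l + 1))) h3
      simp only [coeff_derivative, coeff_zero] at h4
      rw [show ((l : k[X]) + 1) = C ((l : k) + 1) by simp, coeff_mul_C] at h4
      change ((psi h').coeff (td h')).coeff (l + 1) * _ = 0
      rw [psi_coeff]
      split_ifs
      · exact h4
      · simp
    rw [this, eval_zero]

end F15


section F16
variable {k : Type} [Field k] {M : Type} [Field M] [Algebra k M]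

theorem psi_mapC_coeff (E : k[X]) (j : ℕ) : (psi (E.map C)).coeff j = C (E.coeff j) * X ^ j := by
  induction E using Polynomial.induction_on' with
  | add f g hf hg =>
    rw [Polynomial.map_add, map_add, coeff_add, hf, hg, coeff_add, C_add]; ring
  | monomial n a =>
    have h1 : (monomial n a).map (C : k →+* k[X]) = C (C a * X ^ 0) * X ^ n := by
      rw [← C_mul_X_pow_eq_monomial]; simp
    rw [h1, psi_mono, zero_add, coeff_C_mul, coeff_X_pow, coeff_monomial]
    split_ifs with h h' h'
    · subst h; simp
    · omega
    · omega
    · simp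

theorem natDegree_pos_of_irr {h : k[X][X]} (hm : h.Monic) (hi : Irreducible h) : 0 < h.natDegree := by
  rw [Nat.pos_iff_ne_zero]
  intro h0
  exact hi.not_isUnit (by rw [hm.natDegree_eq_zero.mp h0]; exact isUnit_one)

theorem En_deriv_eval (d : ℕ) (hd : Even d) (hd2 : 2 ≤ d) (hdk : (d : k) = 1) (t : k) :
    (derivative (En k d)).eval t = 2⁻¹ * ((1 + t) ^ (d - 1) - (1 - t) ^ (d - 1)) := by
  have ho : Odd (d - 1) := Nat.Even.sub_odd (by omega) hd odd_one
  simp only [En, derivative_mul, derivative_C, derivative_add, derivative_sub, derivative_X, derivative_pow, derivative_one, hdk, eval_mul, eval_add,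
    eval_sub, eval_pow, eval_X, eval_C, eval_one, map_one, zero_mul, zero_add, add_zero, sub_zero, mul_one, one_mul]
  rw [show t - 1 = -(1 - t) by ring, ho.neg_pow]
  ring

theorem caseB_fixed (p : ℕ) [Fact p.Prime] [CharP k p] [IsAlgClosed k] (P : Place k M) (f : k[X]) (d : ℕ)
    (hf : f.Monic) (hdeg : f.natDegree = d) (hdk : (d : k) = 1) (hd2 : 2 ≤ d) (hd : Even d) (h2 : (2 : k) ≠ 0)
    (F : k[X][X]) (hF : Tm (En k d) = (X ^ 2 - C (X ^ 2)) * F) (hFd : F.natDegree = d - 2) (hFT : T1 F)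
    (hFt : (X ^ 2 - 1) * tf F = X ^ d - 1) :
    ∃ N0 : ℕ, ∀ N ≥ N0, (∀ i, f.coeff i ^ (p ^ N) = f.coeff i) → ∀ h : k[X][X], h.Monic → Irreducible h →
      h ∣ F → (∀ l i, ((h.coeff l).coeff i) ^ (p ^ N) = (h.coeff l).coeff i) →
      ∃ a b c : k, a ^ (p ^ N) = a ∧ b ^ (p ^ N) = b ∧ c ^ (p ^ N) = c ∧ b ≠ 0 ∧ c ≠ 0 ∧
        sd f a b c = 0 := by
  obtain ⟨N1, h1⟩ := lemmaL p P f d hf hdeg hdk hd2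
  obtain ⟨N2, hN2⟩ := t1_points p P (d + 2)
  refine ⟨max N1 N2, fun N hN hfix h hhm hhi hhd hhfix => ?_⟩
  have hsq : Squarefree ((X ^ 2 - 1) * tf F : k[X]) := by rw [hFt]; exact sqfree_Xd d hdk
  have hpos := natDegree_pos_of_irr hhm hhi
  obtain ⟨h', hh'⟩ := id hhd
  have hh'm : h'.Monic := by
    have := hFT.1
    rw [hh'] at this
    exact hhm.of_mul_monic_left this
  have hT : T1 h := T1.of_mul hhm hh'm (by rw [← hh']; exact hFT)
  have htd : tf h ∣ tf F := tf_dvd hhd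
  have hnu : ¬ IsUnit (tf h) := fun hu => by
    have := natDegree_eq_zero_of_isUnit hu
    rw [hT.tf_natDegree] at this; omega
  have hle : h.natDegree ≤ d := by
    have := natDegree_le_of_dvd hhd hFT.1.ne_zero
    omega
  have hprime : Prime h := hhi.prime
  have n1 : ¬ h ∣ X ^ 2 - C (X ^ 2) := by
    intro hdv
    have h3 := tf_dvd hdv
    have h4 : tf (X ^ 2 - C (X ^ 2) : k[X][X]) = X ^ 2 - 1 := by
      rw [tf, psi_sqd, leadingCoeff_C_mul_X_pow]
    rw [h4] at h3
    exact hnu ((squarefree_mul_iff.mp hsq).1 h3 htd)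
  have n2 : ¬ h ∣ (derivative (En k d)).map C := by
    intro hdv
    have h3 := tf_dvd hdv
    obtain ⟨η, hη⟩ := IsAlgClosed.exists_root (tf h) (by
      intro h1
      have h3 : (tf h).natDegree = 0 := natDegree_eq_of_degree_eq_some h1
      rw [hT.tf_natDegree] at h3
      omega)
    have r1 : η ^ d = 1 := by
      have h5 : tf h ∣ X ^ d - 1 := by rw [← hFt]; exact htd.mul_left _
      have := hη.dvd h5
      simpa [sub_eq_zero] using this
    have r2 := hη.dvd h3
    have hne : psi ((derivative (En k d)).map C) ≠ 0 := by
      intro h0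
      have h6 := psi_mapC_coeff (derivative (En k d)) (d - 1)
      rw [h0, coeff_zero, coeff_derivative, show d - 1 + 1 = d by omega, En_coeff_d d h2, one_mul] at h6
      have h7 : ((d - 1 : ℕ) : k) + 1 = 1 := by
        have : ((d - 1 + 1 : ℕ) : k) = 1 := by rw [show d - 1 + 1 = d by omega, hdk]
        rwa [Nat.cast_add, Nat.cast_one] at this
      rw [h7, C_1, one_mul] at h6
      exact pow_ne_zero _ X_ne_zero h6.symm
    have hne2 := leadingCoeff_ne_zero.mpr hne
    rw [tf, leadingCoeff, psi_mapC_coeff] at r2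
    rw [leadingCoeff, psi_mapC_coeff] at hne2
    have hc : (derivative (En k d)).coeff (psi ((derivative (En k d)).map C)).natDegree ≠ 0 := by
      intro h0; rw [h0] at hne2; simp at hne2
    simp only [IsRoot, eval_mul, eval_C, eval_pow, eval_X] at r2
    have := (mul_eq_zero.mp r2).resolve_left hc
    have hη0 : η = 0 := by
      by_contra h; exact pow_ne_zero _ h this
    rw [hη0, zero_pow (by omega)] at r1
    exact zero_ne_one r1
  have hna : ¬ h ∣ (X ^ 2 - C (X ^ 2)) * (derivative (En k d)).map C := fun hdv =>
    (hprime.dvd_or_dvd hdv).elim n1 n2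
  obtain ⟨s, t, hs, ht, e1, e2⟩ := hN2 N (by omega) h ((X ^ 2 - C (X ^ 2)) * (derivative (En k d)).map C) hT
    (by omega) hpos hhi (hsq.squarefree_of_dvd (htd.mul_left _)) hhfix (by
      refine natDegree_mul_le.trans ?_
      have h3 := natDegree_derivative_le (En k d)
      have h4 := En_natDegree_le (k := k) d
      have h5 := natDegree_map_le (f := (C : k →+* k[X])) (p := derivative (En k d))
      rw [natDegree_X_pow_sub_C]
      omega)
    (fun l => by
      rw [sub_mul, coeff_sub, coeff_C_mul, coeff_X_pow_mul', coeff_map, coeff_map]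
      refine (natDegree_sub_le _ _).trans (max_le ?_ ?_)
      · split_ifs <;> simp
      · rw [mul_comm]
        exact (natDegree_C_mul_le _ _).trans (by simp)) hna
  have hT0 : (Tm (En k d)).evalEval s t = 0 := by
    rw [hF, hh', evalEval_mul, evalEval_mul, e1]; ring
  have hE : ∀ u : k, (En k d).eval u = 2⁻¹ * ((1 + u) ^ d + (1 - u) ^ d) := by
    intro u
    simp only [En, eval_mul, eval_add, eval_sub, eval_pow, eval_X, eval_C]
    rw [show u - 1 = -(1 - u) by ring, hd.neg_pow, add_comm u 1]
  have h2i : (2 : k)⁻¹ ≠ 0 := inv_ne_zero h2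
  have key : (1 + t) ^ d + (1 - t) ^ d = (1 + s) ^ d + (1 - s) ^ d := by
    rw [Tm, evalEval_sub, evalEval_map_C, evalEval_C, hE, hE, ← mul_sub] at hT0
    exact sub_eq_zero.mp ((mul_eq_zero.mp hT0).resolve_left h2i)
  rw [evalEval_mul, evalEval_map_C, evalEval_sub, evalEval_pow, evalEval_X, evalEval_C, eval_pow, eval_X,
    En_deriv_eval d hd hd2 hdk] at e2
  have g1 : t ^ 2 - s ^ 2 ≠ 0 := left_ne_zero_of_mul e2
  have g2 : (1 + t) ^ (d - 1) ≠ (1 - t) ^ (d - 1) :=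
    sub_ne_zero.mp (right_ne_zero_of_mul (right_ne_zero_of_mul e2))
  have u1 : s + t ≠ 0 := fun h0 => g1 (by linear_combination (t - s) * h0)
  have u2 : s - t ≠ 0 := fun h0 => g1 (by linear_combination (- t - s) * h0)
  have fx : ∀ u w : k, u ^ (p ^ N) = u → w ^ (p ^ N) = w → (u + w) ^ (p ^ N) = u + w := fun u w hu hw => by
    rw [add_pow_char_pow, hu, hw]
  have fs : ∀ u w : k, u ^ (p ^ N) = u → w ^ (p ^ N) = w → (u - w) ^ (p ^ N) = u - w := fun u w hu hw => by
    rw [sub_pow_char_pow, hu, hw]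
  by_cases hc : (1 + s) ^ (d - 1) = (1 - t) ^ (d - 1)
  · refine h1 N (by omega) hfix (1 - s) (s - t) (s + t) (fs _ _ (one_pow _) hs) (fs _ _ hs ht) (fx _ _ hs ht)
      u2 u1 ?_ ?_
    · rw [show 1 - s + (s - t) + (s + t) = 1 + s by ring, show 1 - s + (s - t) = 1 - t by ring,
        show 1 - s + (s + t) = 1 + t by ring]
      linear_combination - key
    · rw [show 1 - s + (s - t) + (s + t) = 1 + s by ring, show 1 - s + (s + t) = 1 + t by ring, hc]
      exact g2.symm
  · refine h1 N (by omega) hfix (1 - s) (s + t) (s - t) (fs _ _ (one_pow _) hs) (fx _ _ hs ht) (fs _ _ hs ht)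
      u1 u2 ?_ ?_
    · rw [show 1 - s + (s + t) + (s - t) = 1 + s by ring, show 1 - s + (s - t) = 1 - t by ring,
        show 1 - s + (s + t) = 1 + t by ring]
      linear_combination - key
    · rw [show 1 - s + (s + t) + (s - t) = 1 + s by ring, show 1 - s + (s - t) = 1 - t by ring]
      exact hc
end F16


section F17
variable {k : Type} [Field k]

theorem comb_third {α : Type} [DecidableEq α] (S : Finset α) (π : α → α) (w : α → ℕ) (hπ : ∀ x ∈ S, π x ∈ S)
    (hinj : Set.InjOn π S) (hfix : ∀ x ∈ S, π x ≠ x) (hw : ∀ x ∈ S, w (π x) = w x) :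
    ∃ A ⊆ S, 2 * ∑ x ∈ A, w x ≤ ∑ x ∈ S, w x ∧ ∑ x ∈ S, w x ≤ 3 * ∑ x ∈ A, w x := by
  let T : Finset (Finset α) := S.powerset.filter fun A => ∀ x ∈ A, π x ∉ A
  obtain ⟨A, hA, hmax⟩ := T.exists_max_image Finset.card ⟨∅, by simp [T]⟩
  have hAS : A ⊆ S := by simp only [T, Finset.mem_filter, Finset.mem_powerset] at hA; exact hA.1
  have hAd : ∀ x ∈ A, π x ∉ A := by simp only [T, Finset.mem_filter] at hA; exact hA.2
  have s1 : ∑ x ∈ A.image π, w x = ∑ x ∈ A, w x := by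
    rw [Finset.sum_image (fun x hx y hy h => hinj (hAS hx) (hAS hy) h)]
    exact Finset.sum_congr rfl fun x hx => hw x (hAS hx)
  let Q := S.filter fun y => π y ∈ A
  have s2 : ∑ x ∈ Q, w x ≤ ∑ x ∈ A, w x := by
    have hQS : Q ⊆ S := Finset.filter_subset _ _
    have : ∑ x ∈ Q.image π, w x = ∑ x ∈ Q, w x := by
      rw [Finset.sum_image (fun x hx y hy h => hinj (hQS hx) (hQS hy) h)]
      exact Finset.sum_congr rfl fun x hx => hw x (hQS hx)
    rw [← this]
    refine Finset.sum_le_sum_of_subset ?_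
    intro y hy
    obtain ⟨x, hx, rfl⟩ := Finset.mem_image.mp hy
    exact (Finset.mem_filter.mp hx).2
  refine ⟨A, hAS, ?_, ?_⟩
  · have hdis : Disjoint A (A.image π) := by
      rw [Finset.disjoint_left]
      intro y hy hy'
      obtain ⟨x, hx, rfl⟩ := Finset.mem_image.mp hy'
      exact hAd x hx hy
    have : ∑ x ∈ A ∪ A.image π, w x ≤ ∑ x ∈ S, w x := by
      refine Finset.sum_le_sum_of_subset (Finset.union_subset hAS ?_)
      intro y hy
      obtain ⟨x, hx, rfl⟩ := Finset.mem_image.mp hy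
      exact hπ x (hAS hx)
    rw [Finset.sum_union hdis, s1] at this
    omega
  · have hcov : S ⊆ A ∪ (A.image π ∪ Q) := by
      intro y hy
      by_contra hn
      simp only [Finset.mem_union, not_or] at hn
      obtain ⟨n1, n2, n3⟩ := hn
      have n3' : π y ∉ A := fun h => n3 (Finset.mem_filter.mpr ⟨hy, h⟩)
      have hins : insert y A ∈ T := by
        simp only [T, Finset.mem_filter, Finset.mem_powerset]
        refine ⟨Finset.insert_subset hy hAS, ?_⟩
        intro x hx
        rw [Finset.mem_insert, not_or]
        rcases Finset.mem_insert.mp hx with rfl | hx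
        · exact ⟨hfix x hy, n3'⟩
        · exact ⟨fun h => n2 (Finset.mem_image.mpr ⟨x, hx, h⟩), hAd x hx⟩
      have := hmax _ hins
      rw [Finset.card_insert_of_notMem n1] at this
      omega
    have h1 := Finset.sum_le_sum_of_subset (f := w) hcov
    have h2 := Finset.sum_union_inter (s₁ := A) (s₂ := A.image π ∪ Q) (f := w)
    have h3 := Finset.sum_union_inter (s₁ := A.image π) (s₂ := Q) (f := w)
    omega

noncomputable def cequiv (e : k ≃+* k) : k[X][X] ≃+* k[X][X] := Polynomial.mapEquiv (Polynomial.mapEquiv e)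

open UniqueFactorizationMonoid in
theorem split_F (e : k ≃+* k) (F : k[X][X]) (hF : F.Monic) (hsq : Squarefree F) (hfix : cequiv e F = F) :
    (∃ h : k[X][X], h.Monic ∧ Irreducible h ∧ h ∣ F ∧ cequiv e h = h) ∨
    ∃ A B : k[X][X], A.Monic ∧ B.Monic ∧ F = A * B ∧ 2 * A.natDegree ≤ F.natDegree ∧
      F.natDegree ≤ 3 * A.natDegree := by
  classical
  by_contra hcon
  rw [not_or] at hcon
  obtain ⟨c1, c2⟩ := hcon
  let S := (normalizedFactors F).toFinset
  have hnd : (normalizedFactors F).Nodup := (squarefree_iff_nodup_normalizedFactors hF.ne_zero).mp hsq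
  have hmem : ∀ h, h ∈ S ↔ h.Monic ∧ Irreducible h ∧ h ∣ F := by
    intro h
    rw [Multiset.mem_toFinset, mem_normalizedFactors_iff' hF.ne_zero]
    constructor
    · rintro ⟨h1, h2, h3⟩
      refine ⟨?_, h1, h3⟩
      obtain ⟨g, hg⟩ := h3
      have hu : IsUnit h.leadingCoeff := by
        refine IsUnit.of_mul_eq_one g.leadingCoeff ?_
        rw [← leadingCoeff_mul, ← hg, hF.leadingCoeff]
      have h4 : normalize h.leadingCoeff = h.leadingCoeff := by
        rw [← leadingCoeff_normalize, h2]
      rw [Monic, ← h4]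
      exact normalize_eq_one.mpr hu
    · rintro ⟨h1, h2, h3⟩
      exact ⟨h2, h1.normalize_eq_self, h3⟩
  have hprod : ∏ h ∈ S, h = F := by
    have h1 := prod_normalizedFactors_eq hF.ne_zero
    rw [hF.normalize_eq_self] at h1
    rw [← h1, Finset.prod, Multiset.toFinset_val, hnd.dedup, Multiset.map_id']
  have hdeg : ∀ A ⊆ S, (∏ h ∈ A, h).natDegree = ∑ h ∈ A, h.natDegree := fun A hA =>
    natDegree_prod_of_monic _ _ fun h hh => ((hmem h).mp (hA hh)).1
  have hcd : ∀ h, (cequiv e h).natDegree = h.natDegree := fun h =>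
    natDegree_map_eq_of_injective (f := (Polynomial.mapEquiv e : k[X] →+* k[X])) (Polynomial.mapEquiv e).injective h
  obtain ⟨A, hA, h1, h2⟩ := comb_third S (cequiv e) natDegree
    (fun h hh => by
      obtain ⟨m1, m2, m3⟩ := (hmem h).mp hh
      rw [hmem]
      refine ⟨m1.map _, (MulEquiv.irreducible_iff (cequiv e)).mpr m2, ?_⟩
      rw [← hfix]
      exact _root_.map_dvd (cequiv e) m3)
    (cequiv e).injective.injOn
    (fun h hh hf => by
      obtain ⟨m1, m2, m3⟩ := (hmem h).mp hh
      exact c1 ⟨h, m1, m2, m3, hf⟩)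
    (fun h _ => hcd h)
  rw [← hdeg A hA, ← hdeg S subset_rfl, hprod] at h1 h2
  refine c2 ⟨∏ h ∈ A, h, ∏ h ∈ S \ A, h, ?_, ?_, ?_, h1, h2⟩
  · exact monic_prod_of_monic _ _ fun h hh => ((hmem h).mp (hA hh)).1
  · exact monic_prod_of_monic _ _ fun h hh => ((hmem h).mp (Finset.sdiff_subset hh)).1
  · rw [mul_comm, Finset.prod_sdiff hA, hprod]
end F17


section F18
variable {k : Type} [Field k]

theorem exists_ord {G : k[X][X]} (hG : G ≠ 0) : ∃ (r : ℕ) (G' : k[X][X]), psi G = X ^ r * G' ∧ G'.coeff 0 ≠ 0 := by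
  obtain ⟨n, a, h1, h2⟩ := WfDvdMonoid.max_power_factor (psi_ne_zero hG) (irreducible_X (R := k[X]))
  exact ⟨n, a, h2, fun h => h1 (X_dvd_iff.mpr h)⟩

theorem coeff_deg {G G' : k[X][X]} {r : ℕ} (h : psi G = X ^ r * G') (i : ℕ) : (G'.coeff i).natDegree ≤ i + r := by
  have := psi_coeff_natDegree G (i + r)
  rwa [h, coeff_X_pow_mul] at this

theorem eq_zero_or (A B : k[X][X]) : A * B = 0 → A = 0 ∨ B = 0 := mul_eq_zero.mp

theorem sep_form (q : ℕ) (hq : (q : k) = 0) (c1 c1' : k) (h1 : c1 ≠ 0) (h1' : c1' ≠ 0) :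
    Squarefree (C c1' * X ^ (q + 1) - C c1 : k[X]) := by
  have h : (C c1' * X ^ (q + 1) - C c1 : k[X]) = C c1' * (X ^ (q + 1) - C (c1 / c1')) := by
    rw [mul_sub, ← C_mul, mul_div_cancel₀ _ h1']
  rw [h]
  have h3 : Squarefree (X ^ (q + 1) - C (c1 / c1') : k[X]) :=
    (separable_X_pow_sub_C _ (by push_cast; rw [hq]; simp) (div_ne_zero h1 h1')).squarefree
  have hu : IsUnit (C c1' : k[X]) := isUnit_C.mpr (isUnit_iff_ne_zero.mpr h1')
  exact h3.squarefree_of_dvd (by rw [IsUnit.mul_left_dvd hu])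

theorem natDegree_form (q : ℕ) (c1 c1' : k) (h1' : c1' ≠ 0) :
    (C c1' * X ^ (q + 1) - C c1 : k[X]).natDegree = q + 1 := by
  rw [natDegree_sub_C, natDegree_C_mul_X_pow _ _ h1']

theorem dvd_pow_lin {ν c : k} {q r : ℕ} {a : k[X]} (ha : a ∣ C c * (X - C ν) ^ q) (hc : c ≠ 0) (hr : a.natDegree = r) :
    (X - C ν) ^ r ∣ a := by
  have hu : IsUnit (C c : k[X]) := isUnit_C.mpr (isUnit_iff_ne_zero.mpr hc)
  rw [IsUnit.dvd_mul_left hu] at ha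
  obtain ⟨i, -, hi⟩ := (dvd_prime_pow (prime_X_sub_C ν) q).mp ha
  have : a.natDegree = i := by
    rw [natDegree_eq_of_degree_eq (degree_eq_degree_of_associated hi), natDegree_pow, natDegree_X_sub_C, mul_one]
  rw [← hr, this]
  exact hi.symm.dvd

theorem isCop_unit {x y : k[X]} (h : IsUnit x) : IsCoprime x y := by
  obtain ⟨u, hu⟩ := h.exists_left_inv
  exact ⟨u, 0, by rw [hu, zero_mul, add_zero]⟩

theorem local_bound (p : ℕ) [Fact p.Prime] [CharP k p] [IsAlgClosed k] (q a0 : ℕ) (ha0 : 1 ≤ a0) (hq : q = p ^ a0)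
    (hq3 : 3 ≤ q) (D A B : k[X][X]) (w : ℕ) (Dt : k[X][X]) (hD : psi D = X ^ w * Dt) (hD0 : Dt.coeff 0 ≠ 0)
    (c c' c1 c1' : k) (hc1 : c1 ≠ 0) (hc1' : c1' ≠ 0) (hU : ∀ j < q, (psi (D * (A * B))).coeff j = 0)
    (hUq : (psi (D * (A * B))).coeff q = C c' * X ^ q - C c)
    (hUq1 : (psi (D * (A * B))).coeff (q + 1) = C c1' * X ^ (q + 1) - C c1)
    (J : Ideal k[X][X]) (hA : A ∈ J) (hB : B ∈ J) (hX : C (X ^ q) ∈ J)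
    (hJ : ∀ (t : k) (i l : ℕ), 2 * q ≤ i + l → C (C t * X ^ i) * X ^ l ∈ J) :
    ∃ n, CD J n ∧ 4 * n ≤ (q + 1 - w) ^ 2 := by
  have hqk : (q : k) = 0 := by rw [hq, Nat.cast_pow, CharP.cast_eq_zero, zero_pow (by omega)]
  have hsqf := sep_form q hqk c1 c1' hc1 hc1'
  have hdeg := natDegree_form q c1 c1' hc1'
  have hne : psi (D * (A * B)) ≠ 0 := by
    intro h; rw [h, coeff_zero] at hUq1; rw [← hUq1] at hdeg; simp at hdeg
  have hA0 : A ≠ 0 := by rintro rfl; simp at hne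
  have hB0 : B ≠ 0 := by rintro rfl; simp at hne
  obtain ⟨r, At, hAt, hAt0⟩ := exists_ord hA0
  obtain ⟨s, Bt, hBt, hBt0⟩ := exists_ord hB0
  have hpsi : psi (D * (A * B)) = X ^ (w + (r + s)) * (Dt * (At * Bt)) := by
    rw [map_mul, map_mul, hD, hAt, hBt]; ring
  have hco : ∀ i, (psi (D * (A * B))).coeff (i + (w + (r + s))) = (Dt * (At * Bt)).coeff i := fun i => by
    rw [hpsi, coeff_X_pow_mul]
  have h0 : (Dt * (At * Bt)).coeff 0 = Dt.coeff 0 * (At.coeff 0 * Bt.coeff 0) := by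
    rw [mul_coeff_zero, mul_coeff_zero]
  have h0ne : Dt.coeff 0 * (At.coeff 0 * Bt.coeff 0) ≠ 0 := mul_ne_zero hD0 (mul_ne_zero hAt0 hBt0)
  have h1 : (Dt * (At * Bt)).coeff 1 = Dt.coeff 0 * (At.coeff 0 * Bt.coeff 1 + At.coeff 1 * Bt.coeff 0)
      + Dt.coeff 1 * (At.coeff 0 * Bt.coeff 0) := by
    rw [mul_coeff_one, mul_coeff_one, mul_coeff_zero]
  have cA : (psi A).coeff r = At.coeff 0 := by
    have := coeff_X_pow_mul At r 0
    rwa [← hAt, zero_add] at this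
  have cB : (psi B).coeff s = Bt.coeff 0 := by
    have := coeff_X_pow_mul Bt s 0
    rwa [← hBt, zero_add] at this
  have dD0 := coeff_deg hD 0
  have dA0 := coeff_deg hAt 0
  have dB0 := coeff_deg hBt 0
  have dD1 := coeff_deg hD 1
  have dA1 := coeff_deg hAt 1
  have dB1 := coeff_deg hBt 1
  have hdA : X ^ r ∣ psi A := ⟨_, hAt⟩
  have hdB : X ^ s ∣ psi B := ⟨_, hBt⟩
  -- the unit cases
  have unitc : ∀ g : k[X], g ≠ 0 → g.natDegree = 0 → IsUnit g := fun g hg hd => by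
    rw [eq_C_of_natDegree_eq_zero hd] at hg ⊢
    exact isUnit_C.mpr (isUnit_iff_ne_zero.mpr fun h => hg (by rw [h, C_0]))
  by_cases hr0 : r = 0
  · subst hr0
    refine ⟨0 * s, local_lemma A B 0 s (2 * q) J hdA ?_ (by rwa [cA]) hdB ?_ hA hB hJ, by simp⟩
    · rw [cA]; omega
    · rw [cA]; exact isCop_unit (unitc _ hAt0 (by omega))
  by_cases hs0 : s = 0
  · subst hs0
    refine ⟨0 * r, local_lemma B A 0 r (2 * q) J hdB ?_ (by rwa [cB]) hdA ?_ hB hA hJ, by simp⟩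
    · rw [cB]; omega
    · rw [cB]; exact isCop_unit (unitc _ hBt0 (by omega))
  have hge : q ≤ w + (r + s) := by
    by_contra hlt
    have := hU (0 + (w + (r + s))) (by omega)
    rw [hco, h0] at this
    exact h0ne this
  have nd : (Dt.coeff 0 * (At.coeff 0 * Bt.coeff 0)).natDegree =
      (Dt.coeff 0).natDegree + ((At.coeff 0).natDegree + (Bt.coeff 0).natDegree) := by
    rw [natDegree_mul hD0 (mul_ne_zero hAt0 hBt0), natDegree_mul hAt0 hBt0]
  by_cases htame : c = 0 ∧ c' = 0
  · have e1 : w + (r + s) ≠ q := by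
      intro he
      have := hco 0
      rw [zero_add, he, hUq, h0, htame.1, htame.2] at this
      exact h0ne (by rw [← this]; simp)
    have e2 : w + (r + s) = q + 1 := by
      by_contra hn
      have : (psi (D * (A * B))).coeff (q + 1) = 0 := by
        rw [hpsi, coeff_X_pow_mul', if_neg (by omega)]
      rw [this] at hUq1
      rw [← hUq1] at hdeg
      simp at hdeg
    have e3 := hco 0
    rw [zero_add, e2, hUq1, h0] at e3
    rw [← e3, hdeg] at nd
    rw [e3] at hsqf
    refine ⟨r * s, local_lemma A B r s (2 * q) J hdA ?_ (by rwa [cA]) hdB ?_ hA hB hJ, ?_⟩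
    · rw [cA]; omega
    · rw [cA, cB]
      have h5 := hsqf.squarefree_of_dvd (dvd_mul_left _ _)
      exact (squarefree_mul_iff.mp h5).1.isCoprime
    · rw [show q + 1 - w = r + s by omega]
      have := four_mul_le_pow_two_add r s
      nlinarith [this]
  -- wild case
  have e2 : w + (r + s) = q := by
    by_contra hn
    have h5 : (psi (D * (A * B))).coeff q = 0 := by
      rw [hpsi, coeff_X_pow_mul', if_neg (by omega)]
    rw [h5] at hUq
    have h6 := congrArg (fun g => g.coeff 0) hUq
    have h7 := congrArg (fun g => g.coeff q) hUq
    simp [coeff_X_pow, show q ≠ 0 by omega, coeff_C, show ¬ 0 = q by omega] at h6 h7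
    exact htame ⟨h6, h7.symm⟩
  have e3 := hco 0
  rw [zero_add, e2, hUq, h0] at e3
  have e4 := hco 1
  rw [e2, add_comm 1 q, hUq1, h1] at e4
  by_cases hc' : c' = 0
  · exfalso
    rw [hc', C_0, zero_mul, zero_sub] at e3
    rw [← e3, natDegree_neg, natDegree_C] at nd
    have : (C c1' * X ^ (q + 1) - C c1 : k[X]).natDegree ≤ q := by
      rw [e4]
      refine (natDegree_add_le _ _).trans (max_le (natDegree_mul_le.trans ?_) (natDegree_mul_le.trans ?_))
      · have : (At.coeff 0 * Bt.coeff 1 + At.coeff 1 * Bt.coeff 0).natDegree ≤ q := by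
          refine (natDegree_add_le _ _).trans (max_le (natDegree_mul_le.trans ?_) (natDegree_mul_le.trans ?_))
          · omega
          · omega
        omega
      · have : (At.coeff 0 * Bt.coeff 0).natDegree ≤ 0 := natDegree_mul_le.trans (by omega)
        omega
    omega
  obtain ⟨ν, hν⟩ := IsAlgClosed.exists_pow_nat_eq (c / c') (show 0 < q by omega)
  have hlin : (C c' * X ^ q - C c : k[X]) = C c' * (X - C ν) ^ q := by
    rw [hq, sub_pow_char_pow, ← C_pow, ← hq, hν, mul_sub, ← C_mul, mul_div_cancel₀ _ hc']
  rw [hlin] at e3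
  have ndq : (C c' * (X - C ν) ^ q).natDegree = q := by
    rw [natDegree_C_mul hc', natDegree_pow, natDegree_X_sub_C, mul_one]
  rw [← e3, ndq] at nd
  have vD : (X - C ν) ^ w ∣ Dt.coeff 0 := dvd_pow_lin (by rw [e3]; exact dvd_mul_right _ _) hc' (by omega)
  have vA : (X - C ν) ^ r ∣ At.coeff 0 :=
    dvd_pow_lin (by rw [e3]; exact (dvd_mul_right _ _).mul_left _) hc' (by omega)
  have vB : (X - C ν) ^ s ∣ Bt.coeff 0 :=
    dvd_pow_lin (by rw [e3]; exact (dvd_mul_left _ _).mul_left _) hc' (by omega)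
  have hkey : w = 0 ∧ (r = 1 ∨ s = 1) := by
    by_contra hn
    have hws : 2 ≤ w + s := by omega
    have hwr : 2 ≤ w + r := by omega
    have k1 : ∀ {n : ℕ} {g : k[X]}, 2 ≤ n → (X - C ν) ^ n ∣ g → (X - C ν) * (X - C ν) ∣ g := fun hn hg =>
      (by rw [← pow_two]; exact pow_dvd_pow _ hn : (X - C ν) * (X - C ν) ∣ _).trans hg
    have k2 : (X - C ν) * (X - C ν) ∣ (C c1' * X ^ (q + 1) - C c1 : k[X]) := by
      rw [e4, mul_add]
      refine dvd_add (dvd_add ?_ ?_) ?_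
      · refine k1 hwr ?_
        rw [pow_add, ← mul_assoc]
        exact (mul_dvd_mul vD vA).mul_right _
      · refine k1 hws ?_
        rw [pow_add, mul_comm (At.coeff 1), ← mul_assoc]
        exact (mul_dvd_mul vD vB).mul_right _
      · refine k1 (show 2 ≤ r + s by omega) ?_
        rw [pow_add]
        exact (mul_dvd_mul vA vB).mul_left _
    exact not_isUnit_X_sub_C ν (hsqf _ k2)
  obtain ⟨hw0, hrs⟩ := hkey
  have hpX : psi (C (X ^ q) : k[X][X]) = X ^ q := by
    have := psi_mono (1 : k) q 0
    simpa using this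
  have cX : (psi (C (X ^ q) : k[X][X])).coeff q = 1 := by rw [hpX, coeff_X_pow, if_pos rfl]
  have fin : 4 * (1 * q) ≤ (q + 1 - w) ^ 2 := by
    rw [hw0, Nat.sub_zero]
    nlinarith [sq_nonneg ((q : ℤ) - 1), four_mul_le_pow_two_add q 1]
  rcases hrs with rfl | rfl
  · refine ⟨1 * q, local_lemma A (C (X ^ q)) 1 q (2 * q) J hdA ?_ (by rwa [cA]) (by rw [hpX]) ?_ hA hX hJ, fin⟩
    · rw [cA]; omega
    · rw [cX]; exact isCoprime_one_right
  · refine ⟨1 * q, local_lemma B (C (X ^ q)) 1 q (2 * q) J hdB ?_ (by rwa [cB]) (by rw [hpX]) ?_ hB hX hJ, fin⟩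
    · rw [cB]; omega
    · rw [cX]; exact isCoprime_one_right
end F18


section F19
variable {k : Type} [Field k]

noncomputable def sh (s t : k) : k[X][X] →ₐ[k] k[X][X] := aevalAeval (C (X + C s) : k[X][X]) (X + C (C t))

theorem sh_C (s t : k) (g : k[X]) : sh s t (C g) = C (taylor s g) := by
  rw [sh, aevalAeval_C]
  have : aeval (C (X + C s) : k[X][X]) g = (CAlgHom (R := k) (A := k[X])) (aeval (X + C s) g) := by
    rw [← aeval_algHom_apply]; rfl
  rw [this, taylor_apply]; rfl

theorem sh_X (s t : k) : sh s t (X : k[X][X]) = X + C (C t) := by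
  rw [sh]; simp

theorem sh_mapC (s t : k) (g : k[X]) : sh s t (g.map C) = (taylor t g).map C := by
  induction g using Polynomial.induction_on' with
  | add f g hf hg => simp only [Polynomial.map_add, map_add, hf, hg]
  | monomial n a =>
    rw [← C_mul_X_pow_eq_monomial]
    simp only [Polynomial.map_mul, Polynomial.map_pow, map_C, map_X, map_mul, map_pow, sh_X, sh_C, taylor_C]
    have : taylor t ((C a : k[X]) * X ^ n) = C a * (X + C t) ^ n := by
      rw [taylor_mul, taylor_C, taylor_pow, taylor_X]
    rw [taylor_apply] at *
    simp

theorem sh_inv (s t : k) (G : k[X][X]) : sh (-s) (-t) (sh s t G) = G := by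
  induction G using bi_induction with
  | hadd G H hG hH => simp only [map_add, hG, hH]
  | hm c i l =>
    simp only [map_mul, map_pow, sh_X, sh_C, map_add]
    simp [taylor_apply]

theorem psi_C_coeff (h : k[X]) (j : ℕ) : (psi (C h)).coeff j = C (h.coeff j) := by
  have : psi (C h) = h.map C := by
    rw [psi, aevalAeval_C, aeval_def, eval₂_eq_eval_map]
    change eval X (h.map ((C : k[X] →+* k[X][X]).comp C)) = _
    rw [← Polynomial.map_map, eval_map, ← coe_mapRingHom]
    exact eval₂_C_X
  rw [this, coeff_map]

theorem psi_shT_coeff (s t : k) (E : k[X]) (j : ℕ) : (psi (sh s t (Tm E))).coeff j =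
    C ((taylor t E).coeff j) * X ^ j - C ((taylor s E).coeff j) := by
  rw [Tm, map_sub, sh_mapC, sh_C, map_sub, coeff_sub, psi_mapC_coeff, psi_C_coeff]

theorem psi_shD (s t : k) : psi (sh s t (X ^ 2 - C (X ^ 2))) =
    X ^ 2 * C (X ^ 2 - 1) + X * (C (C (2 * t) * X - C (2 * s))) + C (C (t ^ 2 - s ^ 2)) := by
  have h : sh s t (X ^ 2 - C (X ^ 2)) = (X + C (C t)) ^ 2 - C ((X + C s) ^ 2) := by
    rw [map_sub, map_pow, sh_X, sh_C, taylor_pow, taylor_X]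
  have hX : psi (X : k[X][X]) = C X * X := by
    have := psi_mono (1 : k) 0 1
    simpa using this
  have hC : psi (C X : k[X][X]) = X := by
    have := psi_mono (1 : k) 1 0
    simpa using this
  have hCC : ∀ a : k, psi (C (C a) : k[X][X]) = C (C a) := fun a => by
    have := psi_mono a 0 0
    simpa using this
  rw [h]
  simp only [map_sub, map_pow, map_add, hX, hCC, hC, map_mul, map_one, C_ofNat]
  ring

theorem ord_D (h2 : (2 : k) ≠ 0) (s t : k) : ∃ (w : ℕ) (Dt : k[X][X]),
    psi (sh s t (X ^ 2 - C (X ^ 2))) = X ^ w * Dt ∧ Dt.coeff 0 ≠ 0 ∧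
      (s ^ 2 = t ^ 2 → 1 ≤ w) ∧ (s = 0 → t = 0 → 2 ≤ w) := by
  have hX2 : (X ^ 2 - 1 : k[X]) ≠ 0 := by
    rw [← C_1]; exact X_pow_sub_C_ne_zero (by norm_num) 1
  rw [psi_shD]
  by_cases h1 : s ^ 2 = t ^ 2
  · by_cases h3 : s = 0
    · have h4 : t = 0 := by
        rw [h3] at h1
        exact pow_eq_zero_iff (n := 2) (by norm_num) |>.mp (by rw [← h1]; simp)
      refine ⟨2, C (X ^ 2 - 1), ?_, by rwa [coeff_C_zero], fun _ => by norm_num, fun _ _ => le_rfl⟩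
      rw [h3, h4]; simp
    · refine ⟨1, X * C (X ^ 2 - 1) + C (C (2 * t) * X - C (2 * s)), ?_, ?_, fun _ => le_rfl, fun h => absurd h h3⟩
      · rw [h1]; simp only [sub_self, C_0]; ring
      · simp only [coeff_add, mul_coeff_zero, coeff_X_zero, zero_mul, zero_add, coeff_C_zero]
        intro h
        have := congrArg (fun g => g.coeff 0) h
        simp at this
        rcases this with h | h
        · exact h2 h
        · exact h3 h
  · refine ⟨0, _, (by rw [pow_zero, one_mul]), ?_, fun h => absurd h h1, fun h h' => absurd (by rw [h, h']) h1⟩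
    simp only [coeff_add, mul_coeff_zero, coeff_X_pow, coeff_X_zero, zero_mul, zero_add, coeff_C_zero]
    simp
    intro h
    have h' : C (t ^ 2 - s ^ 2) = (0 : k[X]) := by rw [C_sub, C_pow, C_pow]; exact h
    have h'' := C_eq_zero.mp h'
    exact h1 (by linear_combination - h'')
end F19


section F20
variable {k : Type} [Field k]

theorem pw_expand (p : ℕ) [Fact p.Prime] [CharP k p] (a q m : ℕ) (hq : q = p ^ a) (u : k) :
    (X + C u : k[X]) ^ (q * m + 1) = (X + C u) * expand k q ((X + C (u ^ q)) ^ m) := by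
  rw [pow_succ, pow_mul, mul_comm, map_pow, map_add, expand_X, expand_C, C_pow, hq, add_pow_char_pow]

theorem pw_coeff_mid (p : ℕ) [Fact p.Prime] [CharP k p] (a q m : ℕ) (hq : q = p ^ a) (hq3 : 3 ≤ q)
    (u : k) (j : ℕ) (hj : 2 ≤ j) (hjq : j < q) : ((X + C u : k[X]) ^ (q * m + 1)).coeff j = 0 := by
  rw [pw_expand p a q m hq u]
  obtain ⟨i, rfl⟩ : ∃ i, j = i + 1 := ⟨j - 1, by omega⟩
  rw [add_mul, coeff_add, coeff_X_mul, coeff_C_mul, coeff_expand (by omega), coeff_expand (by omega),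
    if_neg, if_neg]
  · simp
  · exact Nat.not_dvd_of_pos_of_lt (by omega) hjq
  · exact Nat.not_dvd_of_pos_of_lt (by omega) (by omega)

theorem pw_coeff_one (p : ℕ) [Fact p.Prime] [CharP k p] (a q m : ℕ) (hq : q = p ^ a) (hq3 : 3 ≤ q)
    (u : k) : ((X + C u : k[X]) ^ (q * m + 1)).coeff 1 = (u ^ m) ^ q := by
  rw [pw_expand p a q m hq u]
  rw [add_mul, coeff_add, coeff_X_mul, coeff_C_mul, coeff_expand (by omega), coeff_expand (by omega),
    if_pos (dvd_zero q), if_neg (Nat.not_dvd_of_pos_of_lt (by omega) (by omega)), Nat.zero_div,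
    coeff_zero_eq_eval_zero]
  simp
  rw [← pow_mul, ← pow_mul, mul_comm]

theorem pw_coeff_q1 (p : ℕ) [Fact p.Prime] [CharP k p] (a q m : ℕ) (hq : q = p ^ a) (hq3 : 3 ≤ q)
    (u : k) : ((X + C u : k[X]) ^ (q * m + 1)).coeff (q + 1) = (m * u ^ (m - 1)) ^ q := by
  rw [pw_expand p a q m hq u]
  have hnd : ¬ q ∣ q + 1 := fun h => by
    have := (Nat.dvd_add_right (dvd_refl q)).mp h
    have := Nat.le_of_dvd (by norm_num) this
    omega
  rw [add_mul, coeff_add, coeff_X_mul, coeff_C_mul, coeff_expand (by omega), coeff_expand (by omega),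
    if_pos (dvd_refl q), if_neg hnd, Nat.div_self (by omega), coeff_X_add_C_pow]
  have : ((m : k)) ^ q = m := by
    rw [hq]
    have := map_natCast (iterateFrobenius k p a) m
    rwa [iterateFrobenius_def] at this
  rw [mul_pow, this, Nat.choose_one_right, ← pow_mul, ← pow_mul, mul_comm q]
  ring

theorem taylor_En (s : k) (d : ℕ) : taylor s (En k d) =
    C 2⁻¹ * ((X + C (s + 1)) ^ d + (X + C (s - 1)) ^ d) := by
  rw [En, taylor_mul, taylor_C, map_add, taylor_pow, taylor_pow, map_add, map_sub, taylor_X, taylor_C]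
  simp only [C_add, C_sub]
  congr 2 <;> congr 1 <;> ring

theorem taylor_vanish (p : ℕ) [Fact p.Prime] [CharP k p] (a q m : ℕ) (hq : q = p ^ a) (hq3 : 3 ≤ q)
    (s : k) (hs : (s + 1) ^ m + (s - 1) ^ m = 0) (j : ℕ) (hj : 0 < j) (hjq : j < q) :
    (taylor s (En k (q * m + 1))).coeff j = 0 := by
  rw [taylor_En, coeff_C_mul, coeff_add]
  by_cases h : j = 1
  · rw [h, pw_coeff_one p a q m hq hq3, pw_coeff_one p a q m hq hq3]
    subst hq
    rw [← add_pow_char_pow, hs, zero_pow (by omega), mul_zero]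
  · rw [pw_coeff_mid p a q m hq hq3 _ j (by omega) hjq, pw_coeff_mid p a q m hq hq3 _ j (by omega) hjq]
    simp

theorem root_aux (h2 : (2 : k) ≠ 0) (m : ℕ) (hm : 1 ≤ m) (s : k) (hs : (s + 1) ^ m + (s - 1) ^ m = 0) :
    (s + 1) ^ (m - 1) + (s - 1) ^ (m - 1) ≠ 0 := by
  obtain ⟨m, rfl⟩ : ∃ i, m = i + 1 := ⟨m - 1, by omega⟩
  simp only [Nat.add_sub_cancel]
  intro h
  have h3 : 2 * (s - 1) ^ m = 0 := by
    rw [pow_succ, pow_succ] at hs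
    linear_combination (s + 1) * h - hs
  have h4 : (s - 1) ^ m = 0 := (mul_eq_zero.mp h3).resolve_left h2
  have h5 : s - 1 = 0 := eq_zero_of_pow_eq_zero h4
  rw [h4, add_zero] at h
  have h6 : s + 1 = 0 := eq_zero_of_pow_eq_zero h
  exact h2 (by linear_combination h6 - h5)

theorem taylor_q1 (p : ℕ) [Fact p.Prime] [CharP k p] (a q m : ℕ) (hq : q = p ^ a) (hq3 : 3 ≤ q)
    (h2 : (2 : k) ≠ 0) (hm : (m : k) ≠ 0)
    (s : k) (hs : (s + 1) ^ m + (s - 1) ^ m = 0) :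
    (taylor s (En k (q * m + 1))).coeff (q + 1) ≠ 0 := by
  have hm1 : 1 ≤ m := by
    rcases Nat.eq_zero_or_pos m with h | h
    · simp [h] at hm
    · exact h
  rw [taylor_En, coeff_C_mul, coeff_add, pw_coeff_q1 p a q m hq hq3, pw_coeff_q1 p a q m hq hq3]
  have := root_aux h2 m hm1 s hs
  subst hq
  rw [← add_pow_char_pow, ← mul_add]
  exact mul_ne_zero (inv_ne_zero h2) (pow_ne_zero _ (mul_ne_zero hm this))
end F20


section F21
variable {k : Type} [Field k]

noncomputable def bnd (q w : ℕ) : ℕ := (q + 1 - w) ^ 2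

theorem point_bound (p : ℕ) [Fact p.Prime] [CharP k p] [IsAlgClosed k] (a q m : ℕ) (ha : 1 ≤ a) (hq : q = p ^ a)
    (hq3 : 3 ≤ q) (h2 : (2 : k) ≠ 0) (hm : (m : k) ≠ 0) (A B : k[X][X])
    (hT : Tm (En k (q * m + 1)) = (X ^ 2 - C (X ^ 2)) * (A * B)) (s t : k)
    (hs : (s + 1) ^ m + (s - 1) ^ m = 0) (ht : (t + 1) ^ m + (t - 1) ^ m = 0)
    (J : Ideal k[X][X]) (hA : A ∈ J) (hB : B ∈ J) (hX : C ((X - C s) ^ q) ∈ J) (hY : (X - C (C t)) ^ q ∈ J) :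
    ∃ n, CD J n ∧ ((En k (q * m + 1)).eval s ≠ (En k (q * m + 1)).eval t → n = 0) ∧
      4 * n ≤ (q + 1) ^ 2 ∧ (s ^ 2 = t ^ 2 → 4 * n ≤ q ^ 2) ∧ (s = 0 → t = 0 → 4 * n ≤ (q - 1) ^ 2) := by
  set E := En k (q * m + 1) with hE
  have hT' : sh s t (Tm E) = sh s t (X ^ 2 - C (X ^ 2)) * (sh s t A * sh s t B) := by
    rw [hT, map_mul, map_mul]
  set J' : Ideal k[X][X] := J.comap (sh (-s) (-t)) with hJ'
  have hinv : ∀ G, sh s t G ∈ J' ↔ G ∈ J := fun G => by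
    rw [hJ', Ideal.mem_comap, sh_inv]
  have hA' : sh s t A ∈ J' := (hinv A).2 hA
  have hB' : sh s t B ∈ J' := (hinv B).2 hB
  have hX' : C (X ^ q) ∈ J' := by
    have := (hinv _).2 hX
    rwa [sh_C, taylor_pow, map_sub, taylor_X, taylor_C, add_sub_cancel_right] at this
  have hY' : X ^ q ∈ J' := by
    have := (hinv _).2 hY
    rwa [map_pow, map_sub, sh_X, sh_C, taylor_C, add_sub_cancel_right] at this
  have hmono : ∀ (c : k) (i l : ℕ), 2 * q ≤ i + l → C (C c * X ^ i) * X ^ l ∈ J' := by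
    intro c i l h
    by_cases hi : q ≤ i
    · obtain ⟨i', rfl⟩ := Nat.exists_eq_add_of_le hi
      have : (C (C c * X ^ (q + i')) * X ^ l : k[X][X]) = (C (C c * X ^ i') * X ^ l) * C (X ^ q) := by
        rw [pow_add]; simp only [C_mul]; ring
      rw [this]; exact J'.mul_mem_left _ hX'
    · obtain ⟨l', rfl⟩ := Nat.exists_eq_add_of_le (show q ≤ l by omega)
      have : (C (C c * X ^ i) * X ^ (q + l') : k[X][X]) = (C (C c * X ^ i) * X ^ l') * X ^ q := by
        rw [pow_add]; ring
      rw [this]; exact J'.mul_mem_left _ hY'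
  have hback : ∀ n, CD J' n → CD J n := by
    intro n h
    have hsurj : Function.Surjective (sh (-s) (-t)) := fun G => ⟨sh s t G, sh_inv s t G⟩
    exact (h.map (sh (-s) (-t)) hsurj).mono Ideal.map_comap_le le_rfl
  have hc0 : (psi (sh s t (Tm E))).coeff 0 = C (E.eval t) - C (E.eval s) := by
    rw [psi_shT_coeff, taylor_coeff_zero, taylor_coeff_zero, pow_zero, mul_one]
  by_cases hne : E.eval s = E.eval t
  · obtain ⟨w, Dt, hD, hD0, hw1, hw2⟩ := ord_D h2 s t
    obtain ⟨n, hn, hn4⟩ := local_bound p q a ha hq hq3 (sh s t (X ^ 2 - C (X ^ 2))) (sh s t A) (sh s t B) w Dt hD hD0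
      ((taylor s E).coeff q) ((taylor t E).coeff q) ((taylor s E).coeff (q + 1)) ((taylor t E).coeff (q + 1))
      (taylor_q1 p a q m hq hq3 h2 hm s hs) (taylor_q1 p a q m hq hq3 h2 hm t ht)
      (by
        intro j hj
        rw [← hT']
        rcases Nat.eq_zero_or_pos j with h0 | h0
        · rw [h0, hc0, hne, sub_self]
        · rw [psi_shT_coeff, taylor_vanish p a q m hq hq3 s hs j h0 hj, taylor_vanish p a q m hq hq3 t ht j h0 hj]
          simp)
      (by rw [← hT', psi_shT_coeff]) (by rw [← hT', psi_shT_coeff]) J' hA' hB' hX' hmono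
    refine ⟨n, hback n hn, fun h => absurd hne h, hn4.trans ?_, fun h => hn4.trans ?_, fun h h' => hn4.trans ?_⟩
    · exact Nat.pow_le_pow_left (by omega) 2
    · have := hw1 h
      exact Nat.pow_le_pow_left (by omega) 2
    · have := hw2 h h'
      exact Nat.pow_le_pow_left (by omega) 2
  · have hA0 : (psi (sh s t A)).coeff 0 ≠ 0 := by
      intro h
      rw [hT', map_mul, map_mul, mul_coeff_zero, mul_coeff_zero, h, zero_mul, mul_zero, ← C_sub] at hc0
      exact hne (sub_eq_zero.mp (C_eq_zero.mp hc0.symm)).symm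
    have hd : ((psi (sh s t A)).coeff 0).natDegree = 0 := Nat.le_zero.mp (psi_coeff_natDegree _ 0)
    have hu : IsUnit ((psi (sh s t A)).coeff 0) := by
      rw [eq_C_of_natDegree_eq_zero hd] at hA0 ⊢
      exact isUnit_C.mpr (isUnit_iff_ne_zero.mpr fun h => hA0 (by rw [h, C_0]))
    have := local_lemma (sh s t A) (sh s t B) 0 0 (2 * q) J' (by simp) hd hA0 (by simp) (isCop_unit hu) hA' hB' hmono
    refine ⟨0, hback 0 this, fun _ => rfl, by simp, by simp, by simp⟩
end F21


section F22
variable {k : Type} [Field k]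

variable (k) in
noncomputable def gam (m : ℕ) : k[X] := (X + C 1) ^ m + (X - C 1) ^ m

theorem gam_eval (m : ℕ) (s : k) : (gam k m).eval s = (s + 1) ^ m + (s - 1) ^ m := by
  simp [gam]

theorem gam_degree (h2 : (2 : k) ≠ 0) (m : ℕ) : (gam k m).natDegree = m ∧ (gam k m).leadingCoeff = 2 := by
  have h1 : (gam k m).natDegree ≤ m := by
    refine (natDegree_add_le _ _).trans ?_
    rw [natDegree_pow, natDegree_pow, natDegree_X_add_C, natDegree_X_sub_C]; simp
  have hc : (gam k m).coeff m = 2 := by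
    have e1 := (monic_X_add_C (1 : k)).pow m
    have e2 := (monic_X_sub_C (1 : k)).pow m
    have d1 : ((X + C (1 : k)) ^ m).natDegree = m := by rw [natDegree_pow, natDegree_X_add_C, mul_one]
    have d2 : ((X - C (1 : k)) ^ m).natDegree = m := by rw [natDegree_pow, natDegree_X_sub_C, mul_one]
    rw [Monic, leadingCoeff, d1] at e1
    rw [Monic, leadingCoeff, d2] at e2
    rw [gam, coeff_add, e1, e2]; norm_num
  have h3 : (gam k m).natDegree = m := le_antisymm h1 (le_natDegree_of_ne_zero (by rw [hc]; exact h2))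
  exact ⟨h3, by rw [leadingCoeff, h3, hc]⟩

theorem gam_split [IsAlgClosed k] (h2 : (2 : k) ≠ 0) (m : ℕ) (hm : (m : k) ≠ 0) :
    ∃ S : Finset k, (∀ s, s ∈ S ↔ (s + 1) ^ m + (s - 1) ^ m = 0) ∧ S.card = m ∧
      gam k m = C 2 * ∏ s ∈ S, (X - C s) := by
  classical
  have hm1 : 1 ≤ m := by
    rcases Nat.eq_zero_or_pos m with h | h
    · simp [h] at hm
    · exact h
  obtain ⟨hd, hl⟩ := gam_degree h2 m
  have h0 : gam k m ≠ 0 := by intro h; rw [h] at hl; simp at hl; exact h2 hl.symm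
  have hsp := IsAlgClosed.splits (gam k m)
  have hnd : (gam k m).roots.Nodup := by
    rw [Multiset.nodup_iff_count_le_one]
    intro s
    rw [count_roots]
    by_contra h
    push Not at h
    have := (one_lt_rootMultiplicity_iff_isRoot h0).mp h
    obtain ⟨h1, h3⟩ := this
    rw [IsRoot, gam_eval] at h1
    apply root_aux h2 m hm1 s h1
    rw [IsRoot, gam] at h3
    simp only [derivative_add, derivative_pow, derivative_sub, derivative_X, derivative_C, eval_add, eval_mul, eval_pow, eval_sub, eval_X, eval_C, add_zero, sub_zero, mul_one, ← mul_add] at h3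
    exact (mul_eq_zero.mp h3).resolve_left hm
  refine ⟨(gam k m).roots.toFinset, fun s => ?_, ?_, ?_⟩
  · rw [Multiset.mem_toFinset, mem_roots h0, IsRoot, gam_eval]
  · rw [Multiset.toFinset_card_of_nodup hnd, ← hsp.natDegree_eq_card_roots, hd]
  · have := hsp.eq_prod_roots
    rw [hl] at this
    rw [Finset.prod, Multiset.toFinset_val, Multiset.dedup_eq_self.mpr hnd]
    exact this

theorem En_derivative (p : ℕ) [Fact p.Prime] [CharP k p] (a q m : ℕ) (ha : 1 ≤ a) (hq : q = p ^ a) :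
    derivative (En k (q * m + 1)) = C 2⁻¹ * (gam k m) ^ q := by
  have hqk : (q : k) = 0 := by rw [hq, Nat.cast_pow, CharP.cast_eq_zero, zero_pow (by omega)]
  have : gam k m ^ q = (X + C 1) ^ (q * m) + (X - C 1) ^ (q * m) := by
    rw [gam, hq, add_pow_char_pow, ← pow_mul, ← pow_mul, mul_comm]
  rw [this, En, derivative_C_mul, derivative_add, derivative_pow, derivative_pow]
  simp [hqk]

theorem Tm_deriv (E A B : k[X][X]) (D : k[X][X]) (h : E = D * (A * B)) :
    derivative E ∈ Ideal.span {A, B} := by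
  rw [h, derivative_mul, derivative_mul]
  have hA : A ∈ Ideal.span {A, B} := Ideal.subset_span (by simp)
  have hB : B ∈ Ideal.span {A, B} := Ideal.subset_span (by simp)
  refine Ideal.add_mem _ (Ideal.mul_mem_left _ _ (Ideal.mul_mem_left _ _ hB)) (Ideal.mul_mem_left _ _ (Ideal.add_mem _ (Ideal.mul_mem_left _ _ hB) (Ideal.mul_mem_right _ _ hA)))

theorem Tm_memY (E : k[X]) (A B : k[X][X]) (h : Tm E = (X ^ 2 - C (X ^ 2)) * (A * B)) :
    (derivative E).map C ∈ Ideal.span {A, B} := by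
  have := Tm_deriv _ A B _ h
  rwa [Tm, derivative_sub, derivative_C, sub_zero, derivative_map] at this

theorem Tm_memX (E : k[X]) (A B : k[X][X]) (h : Tm E = (X ^ 2 - C (X ^ 2)) * (A * B)) :
    C (derivative E) ∈ Ideal.span {A, B} := by
  have hsC : ∀ g : k[X], Bivariate.swap (C g) = g.map C := fun g => Bivariate.swap_C g
  have hsM : ∀ g : k[X], Bivariate.swap (g.map C) = C g := fun g => Bivariate.swap_map_C g
  have hX : Bivariate.swap (X : k[X][X]) = C X := Bivariate.swap_Y
  have h1 : Tm E = (X ^ 2 - C (X ^ 2)) * (Bivariate.swap A * Bivariate.swap B) := by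
    have := congrArg (Bivariate.swap (R := k)) h
    rw [Tm, map_mul, map_sub, map_sub, map_mul, hsC, hsM, hsC, map_pow, hX] at this
    rw [Tm]
    simp only [Polynomial.map_pow, map_X, C_pow] at this ⊢
    linear_combination - this
  have h2 := Tm_memY E _ _ h1
  obtain ⟨u, v, huv⟩ := Ideal.mem_span_pair.mp h2
  refine Ideal.mem_span_pair.mpr ⟨Bivariate.swap u, Bivariate.swap v, ?_⟩
  have := congrArg (Bivariate.swap (R := k)) huv
  rw [map_add, map_mul, map_mul, hsM] at this
  have hss : ∀ G : k[X][X], Bivariate.swap (Bivariate.swap G) = G := fun G => Bivariate.swap_swap_apply G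
  rwa [hss, hss] at this

theorem global_bound (p : ℕ) [Fact p.Prime] [CharP k p] [IsAlgClosed k] (a q m : ℕ) (ha : 1 ≤ a) (hq : q = p ^ a)
    (h2 : (2 : k) ≠ 0) (A B : k[X][X])
    (hT : Tm (En k (q * m + 1)) = (X ^ 2 - C (X ^ 2)) * (A * B)) (S : Finset k)
    (hS : gam k m = C 2 * ∏ s ∈ S, (X - C s)) (n : k → k → ℕ)
    (hn : ∀ s ∈ S, ∀ t ∈ S, ∀ J : Ideal k[X][X], A ∈ J → B ∈ J → C ((X - C s) ^ q) ∈ J → (X - C (C t)) ^ q ∈ J →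
      CD J (n s t)) : CD (Ideal.span {A, B}) (∑ s ∈ S, ∑ t ∈ S, n s t) := by
  have hY := Tm_memY _ _ _ hT
  have hX := Tm_memX _ _ _ hT
  set J := Ideal.span {A, B} with hJ
  have hA : A ∈ J := Ideal.subset_span (by simp)
  have hB : B ∈ J := Ideal.subset_span (by simp)
  have hE : derivative (En k (q * m + 1)) = C (2⁻¹ * 2 ^ q) * ∏ s ∈ S, (X - C s) ^ q := by
    rw [En_derivative p a q m ha hq, hS, mul_pow, ← Finset.prod_pow, C_mul, C_pow, mul_assoc]
  have hu : (2⁻¹ * 2 ^ q : k) ≠ 0 := mul_ne_zero (inv_ne_zero h2) (pow_ne_zero _ h2)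
  rw [hE] at hX hY
  have hX' : ∏ s ∈ S, (C ((X - C s) ^ q) : k[X][X]) ∈ J := by
    have := J.mul_mem_left (C (C (2⁻¹ * 2 ^ q)⁻¹)) hX
    rwa [← C_mul, ← mul_assoc, ← C_mul, inv_mul_cancel₀ hu, C_1, one_mul, map_prod] at this
  have hY' : ∏ s ∈ S, ((X - C (C s)) ^ q : k[X][X]) ∈ J := by
    have := J.mul_mem_left (C (C (2⁻¹ * 2 ^ q)⁻¹)) hY
    rw [Polynomial.map_mul, map_C, ← mul_assoc, ← C_mul, ← C_mul, inv_mul_cancel₀ hu, C_1, C_1, one_mul,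
      Polynomial.map_prod] at this
    simpa using this
  have key := CD.prod S (fun s => (C ((X - C s) ^ q) : k[X][X])) (fun s => ∑ t ∈ S, n s t) J (by
    intro s hs
    have k2 := CD.prod S (fun t => ((X - C (C t)) ^ q : k[X][X])) (fun t => n s t)
      (J ⊔ Ideal.span {(C ((X - C s) ^ q) : k[X][X])}) (by
        intro t ht
        refine hn s hs t ht _ ?_ ?_ ?_ ?_
        · exact Ideal.mem_sup_left (Ideal.mem_sup_left hA)
        · exact Ideal.mem_sup_left (Ideal.mem_sup_left hB)
        · exact Ideal.mem_sup_left (Ideal.mem_sup_right (Ideal.mem_span_singleton_self _))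
        · exact Ideal.mem_sup_right (Ideal.mem_span_singleton_self _))
    refine k2.mono (sup_le le_rfl ?_) le_rfl
    rw [Ideal.span_singleton_le_iff_mem]
    exact Ideal.mem_sup_left hY')
  refine key.mono (sup_le le_rfl ?_) le_rfl
  rw [Ideal.span_singleton_le_iff_mem]
  exact hX'
end F22


section F23
variable {k : Type} [Field k]

noncomputable def Vr [DecidableEq k] (m : ℕ) (r : k) : Finset k :=
  (nthRootsFinset m (1 : k)).filter fun x => x ≠ 1 ∧ x ≠ r ∧ r * x ≠ 1 ∧ (r - 1) ^ m = (x - 1) ^ m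

theorem Vr_card [DecidableEq k] (h2 : (2 : k) ≠ 0) (m : ℕ) (hm : Odd m) (r : k) (hr : r ^ m = 1) (hr1 : r ≠ 1) :
    2 * (Vr m r).card + 3 ≤ m := by
  have hm0 : 0 < m := hm.pos
  have hU : (nthRootsFinset m (1 : k)).card ≤ m := by
    rw [nthRootsFinset_def]
    exact (Multiset.toFinset_card_le _).trans (card_nthRoots m 1)
  have memU : ∀ x : k, x ∈ nthRootsFinset m (1 : k) ↔ x ^ m = 1 := fun x => mem_nthRootsFinset hm0 1
  have hr0 : r ≠ 0 := by rintro rfl; rw [zero_pow hm0.ne'] at hr; exact zero_ne_one hr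
  have hrr : r ≠ r⁻¹ := by
    intro h
    have h1 : r ^ 2 = 1 := by rw [pow_two]; nth_rewrite 2 [h]; exact mul_inv_cancel₀ hr0
    obtain ⟨j, hj⟩ := hm
    rw [hj, pow_succ, pow_mul, h1, one_pow, one_mul] at hr
    exact hr1 hr
  have hinv1 : r⁻¹ ≠ 1 := fun h => hr1 (inv_eq_one.mp h)
  set T : Finset k := {1, r, r⁻¹} with hT
  have hTc : T.card = 3 := by
    rw [hT, Finset.card_insert_of_notMem, Finset.card_pair hrr]
    simp [hr1.symm, hinv1.symm]
  set I : Finset k := (Vr m r).image (fun x => x⁻¹) with hI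
  have hIc : I.card = (Vr m r).card := Finset.card_image_of_injective _ inv_injective
  have memV : ∀ x ∈ Vr m r, x ^ m = 1 ∧ x ≠ 1 ∧ x ≠ r ∧ r * x ≠ 1 ∧ (r - 1) ^ m = (x - 1) ^ m := by
    intro x hx
    rw [Vr, Finset.mem_filter, memU] at hx
    exact hx
  have hx0 : ∀ x ∈ Vr m r, x ≠ 0 := by
    intro x hx h
    have := (memV x hx).1
    rw [h, zero_pow hm0.ne'] at this; exact zero_ne_one this
  have d1 : Disjoint (Vr m r) I := by
    rw [Finset.disjoint_left]
    intro x hx hxI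
    obtain ⟨y, hy, hyx⟩ := Finset.mem_image.mp hxI
    have hy0 := hx0 y hy
    obtain ⟨a1, a2, a3, a4, a5⟩ := memV x hx
    obtain ⟨b1, b2, b3, b4, b5⟩ := memV y hy
    have h1 : (x - 1) ^ m = - (y - 1) ^ m := by
      have : x - 1 = (-(y - 1)) * y⁻¹ := by
        rw [← hyx]; field_simp; ring
      rw [this, mul_pow, inv_pow, b1, inv_one, mul_one, hm.neg_pow]
    rw [← a5, ← b5] at h1
    have h3 : 2 * (r - 1) ^ m = 0 := by linear_combination h1
    have h4 := eq_zero_of_pow_eq_zero ((mul_eq_zero.mp h3).resolve_left h2)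
    exact hr1 (sub_eq_zero.mp h4)
  have d2 : Disjoint (Vr m r ∪ I) T := by
    rw [Finset.disjoint_left]
    intro x hx hxT
    rw [hT] at hxT
    simp only [Finset.mem_insert, Finset.mem_singleton] at hxT
    rcases Finset.mem_union.mp hx with hx | hx
    · obtain ⟨a1, a2, a3, a4, a5⟩ := memV x hx
      rcases hxT with h | h | h
      · exact a2 h
      · exact a3 h
      · exact a4 (by rw [h, mul_inv_cancel₀ hr0])
    · obtain ⟨y, hy, hyx⟩ := Finset.mem_image.mp hx
      have hy0 := hx0 y hy
      obtain ⟨b1, b2, b3, b4, b5⟩ := memV y hy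
      rcases hxT with h | h | h
      · rw [h] at hyx; exact b2 (inv_eq_one.mp hyx)
      · rw [h] at hyx; exact b4 (by rw [← hyx, inv_mul_cancel₀ hy0])
      · rw [h] at hyx; exact b3 (inv_injective hyx)
  have hsub : (Vr m r ∪ I) ∪ T ⊆ nthRootsFinset m (1 : k) := by
    intro x hx
    rw [memU]
    rcases Finset.mem_union.mp hx with hx | hx
    · rcases Finset.mem_union.mp hx with hx | hx
      · exact (memV x hx).1
      · obtain ⟨y, hy, hyx⟩ := Finset.mem_image.mp hx
        rw [← hyx, inv_pow, (memV y hy).1, inv_one]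
    · rw [hT] at hx
      simp only [Finset.mem_insert, Finset.mem_singleton] at hx
      rcases hx with h | h | h
      · rw [h, one_pow]
      · rw [h, hr]
      · rw [h, inv_pow, hr, inv_one]
  have := (Finset.card_le_card hsub).trans hU
  rw [Finset.card_union_of_disjoint d2, Finset.card_union_of_disjoint d1, hTc, hIc] at this
  omega

theorem En_eval_root (p : ℕ) [Fact p.Prime] [CharP k p] (a q m : ℕ) (hq : q = p ^ a) (hqo : Odd q) (hm : Odd m)
    (h2 : (2 : k) ≠ 0) (s : k) (hs : (s + 1) ^ m + (s - 1) ^ m = 0) :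
    (En k (q * m + 1)).eval s = ((s + 1) ^ m) ^ q := by
  have h1 : (s - 1) ^ m = - (s + 1) ^ m := by linear_combination hs
  rw [En]
  simp only [eval_mul, eval_C, eval_add, eval_pow, eval_sub, eval_X]
  have e1 : (s + 1) ^ (q * m + 1) = ((s + 1) ^ m) ^ q * (s + 1) := by rw [pow_succ, ← pow_mul, mul_comm q]
  have e2 : (s - 1) ^ (q * m + 1) = - ((s + 1) ^ m) ^ q * (s - 1) := by
    rw [pow_succ, mul_comm q, pow_mul, h1, hqo.neg_pow]
  rw [e1, e2]
  field_simp
  ring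

theorem off_count [DecidableEq k] (h2 : (2 : k) ≠ 0) (m : ℕ) (hm : Odd m) (S : Finset k)
    (hS : ∀ s ∈ S, (s + 1) ^ m + (s - 1) ^ m = 0) :
    2 * ((S ×ˢ S).filter fun x => x.1 ^ 2 ≠ x.2 ^ 2 ∧ (x.1 + 1) ^ m = (x.2 + 1) ^ m).card ≤ (m - 1) * (m - 3) := by
  have hm0 : 0 < m := hm.pos
  set O := (S ×ˢ S).filter fun x => x.1 ^ 2 ≠ x.2 ^ 2 ∧ (x.1 + 1) ^ m = (x.2 + 1) ^ m with hO
  set U := (nthRootsFinset m (1 : k)) with hUdef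
  have hU : U.card ≤ m := by
    rw [hUdef, nthRootsFinset_def]
    exact (Multiset.toFinset_card_le _).trans (card_nthRoots m 1)
  have memU : ∀ x : k, x ∈ U ↔ x ^ m = 1 := fun x => mem_nthRootsFinset hm0 1
  have hS' : ∀ s ∈ S, (1 + s) ^ m = (1 - s) ^ m ∧ 1 + s ≠ 0 ∧ 1 - s ≠ 0 := by
    intro s hs
    have h := hS s hs
    have h1 : (1 - s) ^ m = - (s - 1) ^ m := by rw [← hm.neg_pow]; ring
    have h3 : (1 + s) ^ m = (1 - s) ^ m := by rw [h1, add_comm 1 s]; linear_combination h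
    refine ⟨h3, fun h0 => ?_, fun h0 => ?_⟩
    · rw [h0, zero_pow hm0.ne'] at h3
      have := eq_zero_of_pow_eq_zero h3.symm
      exact h2 (by linear_combination h0 + this)
    · rw [h0, zero_pow hm0.ne'] at h3
      have := eq_zero_of_pow_eq_zero h3
      exact h2 (by linear_combination h0 + this)
  let W : Finset (Σ _ : k, k) := (U.erase 1).sigma fun r => Vr m r
  have hW : 2 * W.card ≤ (m - 1) * (m - 3) := by
    rw [Finset.card_sigma, Finset.mul_sum]
    calc ∑ r ∈ U.erase 1, 2 * (Vr m r).card ≤ ∑ r ∈ U.erase 1, (m - 3) := by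
          refine Finset.sum_le_sum fun r hr => ?_
          rw [Finset.mem_erase, memU] at hr
          have := Vr_card h2 m hm r hr.2 hr.1
          omega
      _ = (U.erase 1).card * (m - 3) := by rw [Finset.sum_const, smul_eq_mul]
      _ ≤ (m - 1) * (m - 3) := by
          refine Nat.mul_le_mul_right _ ?_
          rw [Finset.card_erase_of_mem ((memU 1).2 (one_pow m))]
          omega
  have hOW : O.card ≤ W.card := by
    refine Finset.card_le_card_of_injOn (fun x => ⟨(1 + x.1) / (1 - x.2), (1 + x.2) / (1 - x.1)⟩) ?_ ?_
    · rintro ⟨s, t⟩ hx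
      simp only [hO, Finset.coe_filter, Finset.mem_product, Set.mem_ofPred_eq] at hx
      obtain ⟨⟨hs, ht⟩, hst, hE⟩ := hx
      obtain ⟨s1, s2, s3⟩ := hS' s hs
      obtain ⟨t1, t2, t3⟩ := hS' t ht
      rw [add_comm s, add_comm t] at hE
      have hadd : s + t ≠ 0 := fun h => hst (by linear_combination (s - t) * h)
      simp only [W, Finset.coe_sigma, Set.mem_sigma_iff, Finset.mem_coe, Finset.mem_erase, memU, Vr, Finset.mem_filter, ← hUdef]
      refine ⟨⟨?_, ?_⟩, ?_, ?_, ?_, ?_, ?_⟩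
      · intro h
        rw [div_eq_one_iff_eq t3] at h
        exact hadd (by linear_combination h)
      · rw [div_pow, hE, t1, div_self (pow_ne_zero _ t3)]
      · rw [div_pow, ← hE, s1, div_self (pow_ne_zero _ s3)]
      · intro h
        rw [div_eq_one_iff_eq s3] at h
        exact hadd (by linear_combination h)
      · intro h
        rw [div_eq_div_iff s3 t3] at h
        exact hst (by linear_combination h)
      · intro h
        rw [div_mul_div_comm, div_eq_one_iff_eq (mul_ne_zero t3 s3)] at h
        exact hadd (mul_left_cancel₀ h2 (by linear_combination h))
      · have e1 : (1 + s) / (1 - t) - 1 = (s + t) / (1 - t) := by field_simp; ring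
        have e2 : (1 + t) / (1 - s) - 1 = (s + t) / (1 - s) := by field_simp; ring
        rw [e1, e2, div_pow, div_pow, ← t1, ← s1, hE]
    · rintro ⟨s, t⟩ hx ⟨s', t'⟩ hx' heq
      simp only [hO, Finset.coe_filter, Finset.mem_product, Set.mem_ofPred_eq] at hx hx'
      obtain ⟨⟨hs, ht⟩, hst, hE⟩ := hx
      obtain ⟨⟨hs', ht'⟩, hst', hE'⟩ := hx'
      obtain ⟨s1, s2, s3⟩ := hS' s hs
      obtain ⟨t1, t2, t3⟩ := hS' t ht
      obtain ⟨s1', s2', s3'⟩ := hS' s' hs'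
      obtain ⟨t1', t2', t3'⟩ := hS' t' ht'
      have hadd : s + t ≠ 0 := fun h => hst (by linear_combination (s - t) * h)
      simp only [Sigma.mk.injEq, heq_eq_eq] at heq
      obtain ⟨q1, q2⟩ := heq
      set r := (1 + s) / (1 - t) with hr
      set r' := (1 + t) / (1 - s) with hr'
      have f1 : 1 + s = r * (1 - t) := by rw [hr]; field_simp
      have f2 : 1 + t = r' * (1 - s) := by rw [hr']; field_simp
      have f3 : 1 + s' = r * (1 - t') := by rw [q1]; field_simp
      have f4 : 1 + t' = r' * (1 - s') := by rw [q2]; field_simp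
      have hrr : 1 - r * r' ≠ 0 := by
        intro h
        have : r * r' = 1 := by linear_combination - h
        rw [hr, hr', div_mul_div_comm, div_eq_one_iff_eq (mul_ne_zero t3 s3)] at this
        exact hadd (mul_left_cancel₀ h2 (by linear_combination this))
      have g1 : s = s' := by
        have : (1 - r * r') * s = (1 - r * r') * s' := by linear_combination f1 - f3 - r * f2 + r * f4
        exact mul_left_cancel₀ hrr this
      have g2 : t = t' := by rw [← g1] at f4; linear_combination f2 - f4
      rw [g1, g2]
  omega
end F23


section F24
variable {k : Type} [Field k]

theorem final_arith (q m α β O T4 : ℕ) (hq : 3 ≤ q) (hm : 3 ≤ m) (h1 : α + β + 1 = q * m) (h2 : 2 * α ≤ α + β)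
    (h3 : α + β ≤ 3 * α) (hO : 2 * O ≤ (m - 1) * (m - 3))
    (hS : T4 ≤ (q - 1) ^ 2 + (m - 1) * q ^ 2 + (m - 1) * q ^ 2 + O * (q + 1) ^ 2) (hb : 4 * (α * β) ≤ T4) : False := by
  obtain ⟨x, rfl⟩ : ∃ x, q = x + 3 := ⟨q - 3, by omega⟩
  obtain ⟨y, rfl⟩ : ∃ y, m = y + 3 := ⟨m - 3, by omega⟩
  simp only [show x + 3 - 1 = x + 2 by omega, show y + 3 - 1 = y + 2 by omega, Nat.add_sub_cancel] at hO hS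
  have e1 : 2 * (α + β) ^ 2 ≤ 9 * (α * β) := by
    obtain ⟨u, hu⟩ : ∃ u, β = α + u := ⟨β - α, by omega⟩
    obtain ⟨v, hv⟩ : ∃ v, 3 * α = α + β + v := ⟨3 * α - α - β, by omega⟩
    have : α = u + v := by omega
    subst hu; subst this
    nlinarith [Nat.zero_le (u * v), Nat.zero_le (v * v), Nat.zero_le (u * u)]
  have e2 : α + β = x * y + 3 * x + 3 * y + 8 := by nlinarith
  rw [e2] at e1
  have e3 : 2 * (O * (x + 3 + 1) ^ 2) ≤ ((y + 2) * y) * (x + 4) ^ 2 := by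
    have := Nat.mul_le_mul_right ((x + 4) ^ 2) hO
    nlinarith
  have e4 : 16 * (x * y + 3 * x + 3 * y + 8) ^ 2 ≤ 18 * (x + 2) ^ 2 + 36 * (y + 2) * (x + 3) ^ 2 + 9 * (((y + 2) * y) * (x + 4) ^ 2) := by
    nlinarith
  have hz : ∀ a b : ℕ, 0 ≤ x ^ a * y ^ b := fun a b => Nat.zero_le _
  nlinarith [hz 1 1, hz 1 2, hz 2 1, hz 2 2, hz 1 0, hz 2 0, hz 0 1, hz 0 2]

theorem sum_ind {α : Type} (T : Finset α) (P : α → Prop) [DecidablePred P] (c n : ℕ) (h : (T.filter P).card ≤ n) :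
    ∑ x ∈ T, (if P x then c else 0) ≤ n * c := by
  rw [← Finset.sum_filter, Finset.sum_const, smul_eq_mul]
  exact Nat.mul_le_mul_right _ h

theorem caseB_contra (p : ℕ) [Fact p.Prime] [CharP k p] [IsAlgClosed k] (a q m : ℕ) (ha : 1 ≤ a) (hq : q = p ^ a)
    (hq3 : 3 ≤ q) (hqo : Odd q) (hmo : Odd m) (hm3 : 3 ≤ m) (h2 : (2 : k) ≠ 0) (hm : (m : k) ≠ 0)
    (F A B : k[X][X]) (hF : Tm (En k (q * m + 1)) = (X ^ 2 - C (X ^ 2)) * F) (hFd : F.natDegree = q * m + 1 - 2)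
    (hFT : T1 F) (hFt : (X ^ 2 - 1) * tf F = X ^ (q * m + 1) - 1) (hA : A.Monic) (hB : B.Monic) (hAB : F = A * B)
    (h3 : 2 * A.natDegree ≤ F.natDegree) (h4 : F.natDegree ≤ 3 * A.natDegree) : False := by
  classical
  have hqk : (q : k) = 0 := by rw [hq, Nat.cast_pow, CharP.cast_eq_zero, zero_pow (by omega)]
  have hTA : T1 A := T1.of_mul hA hB (hAB ▸ hFT)
  have hTB : T1 B := T1.of_mul hB hA (by rw [mul_comm, ← hAB]; exact hFT)
  have hsq : Squarefree (tf F) := by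
    have : Squarefree ((X ^ 2 - 1) * tf F) := by
      rw [hFt]; exact sqfree_Xd (q * m + 1) (by push_cast; rw [hqk]; ring)
    exact this.squarefree_of_dvd (dvd_mul_left _ _)
  have hcop : IsCoprime (tf A) (tf B) := by
    rw [hAB, tf_mul] at hsq
    exact (squarefree_mul_iff.mp hsq).1.isCoprime
  obtain ⟨S, hSm, hSc, hSp⟩ := gam_split h2 m hm
  have hpt : ∀ s t : k, ∃ n : ℕ, s ∈ S → t ∈ S → 
      (∀ J : Ideal k[X][X], A ∈ J → B ∈ J → C ((X - C s) ^ q) ∈ J → (X - C (C t)) ^ q ∈ J → CD J n) ∧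
      ((En k (q * m + 1)).eval s ≠ (En k (q * m + 1)).eval t → n = 0) ∧
      4 * n ≤ (q + 1) ^ 2 ∧ (s ^ 2 = t ^ 2 → 4 * n ≤ q ^ 2) ∧ (s = 0 → t = 0 → 4 * n ≤ (q - 1) ^ 2) := by
    intro s t
    by_cases hst : s ∈ S ∧ t ∈ S
    · obtain ⟨n, hn, hn'⟩ := point_bound p a q m ha hq hq3 h2 hm A B (by rw [hF, hAB]) s t ((hSm s).1 hst.1) ((hSm t).1 hst.2)
        (Ideal.span {A, B, C ((X - C s) ^ q), (X - C (C t)) ^ q}) (Ideal.subset_span (by simp))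
        (Ideal.subset_span (by simp)) (Ideal.subset_span (by simp)) (Ideal.subset_span (by simp))
      refine ⟨n, fun _ _ => ⟨fun J j1 j2 j3 j4 => hn.mono ?_ le_rfl, hn'⟩⟩
      rw [Ideal.span_le]
      intro x hx
      simp only [Set.mem_insert_iff, Set.mem_singleton_iff] at hx
      rcases hx with rfl | rfl | rfl | rfl <;> assumption
    · exact ⟨0, fun h h' => absurd ⟨h, h'⟩ hst⟩
  choose n hn using hpt
  have hCD := global_bound p a q m ha hq h2 A B (by rw [hF, hAB]) S hSp n (fun s hs t ht => (hn s t hs ht).1)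
  have hbz := bezout_lower hTA hTB hcop hCD
  set O := ((S ×ˢ S).filter fun x => x.1 ^ 2 ≠ x.2 ^ 2 ∧ (x.1 + 1) ^ m = (x.2 + 1) ^ m) with hO
  have hOc : 2 * O.card ≤ (m - 1) * (m - 3) := off_count h2 m hmo S fun s hs => (hSm s).1 hs
  have h0S : (0 : k) ∈ S := by
    rw [hSm, zero_add, zero_sub, hmo.neg_pow, one_pow]; ring
  have hsum : 4 * ∑ s ∈ S, ∑ t ∈ S, n s t ≤ (q - 1) ^ 2 + (m - 1) * q ^ 2 + (m - 1) * q ^ 2 + O.card * (q + 1) ^ 2 := by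
    rw [← Finset.sum_product', Finset.mul_sum]
    have b1 := sum_ind (S ×ˢ S) (fun x => x.1 = 0 ∧ x.2 = 0) ((q - 1) ^ 2) 1 (by
      rw [Finset.card_le_one]
      rintro ⟨x1, x2⟩ hx ⟨y1, y2⟩ hy
      simp only [Finset.mem_filter] at hx hy
      rw [hx.2.1, hx.2.2, hy.2.1, hy.2.2])
    have b2 : ∀ g : k → k, ∑ x ∈ S ×ˢ S, (if x.1 ≠ 0 ∧ x.2 = g x.1 then q ^ 2 else 0) ≤ (m - 1) * q ^ 2 := by
      intro g
      refine sum_ind (S ×ˢ S) (fun x => x.1 ≠ 0 ∧ x.2 = g x.1) (q ^ 2) (m - 1) ?_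
      rw [← hSc, ← Finset.card_erase_of_mem h0S]
      refine Finset.card_le_card_of_injOn (fun x => x.1) ?_ ?_
      · rintro ⟨x1, x2⟩ hx
        simp only [Finset.coe_filter, Finset.mem_product, Set.mem_ofPred_eq] at hx
        rw [Finset.mem_coe, Finset.mem_erase]
        exact ⟨hx.2.1, hx.1.1⟩
      · rintro ⟨x1, x2⟩ hx ⟨y1, y2⟩ hy hxy
        simp only [Finset.coe_filter, Finset.mem_product, Set.mem_ofPred_eq] at hx hy hxy
        rw [hx.2.2, hy.2.2, hxy]
    have b3 := sum_ind (S ×ˢ S) (fun x => x.1 ^ 2 ≠ x.2 ^ 2 ∧ (x.1 + 1) ^ m = (x.2 + 1) ^ m) ((q + 1) ^ 2) O.card le_rfl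
    have c1 := b2 id
    have c2 := b2 (fun x => - x)
    rw [one_mul] at b1
    refine le_trans ?_ (Nat.add_le_add (Nat.add_le_add (Nat.add_le_add b1 c1) c2) b3)
    rw [← Finset.sum_add_distrib, ← Finset.sum_add_distrib, ← Finset.sum_add_distrib]
    refine Finset.sum_le_sum ?_
    rintro ⟨s, t⟩ hst
    rw [Finset.mem_product] at hst
    obtain ⟨-, k1, k2, k3, k4⟩ := hn s t hst.1 hst.2
    simp only [id]
    by_cases i1 : s ^ 2 = t ^ 2
    · by_cases i2 : s = 0
      · have i3 : t = 0 := by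
          rw [i2] at i1
          exact pow_eq_zero_iff (n := 2) (by norm_num) |>.mp (by rw [← i1]; simp)
        have := k4 i2 i3
        rw [if_pos ⟨i2, i3⟩]; omega
      · have i4 := k3 i1
        rcases sq_eq_sq_iff_eq_or_eq_neg.mp i1 with i3 | i3
        · rw [if_pos (c := s ≠ 0 ∧ t = s) ⟨i2, i3.symm⟩]; omega
        · rw [if_pos (c := s ≠ 0 ∧ t = -s) ⟨i2, by rw [i3, neg_neg]⟩]; omega
    · by_cases i2 : (s + 1) ^ m = (t + 1) ^ m
      · rw [if_pos (c := s ^ 2 ≠ t ^ 2 ∧ _) ⟨i1, i2⟩]; omega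
      · have := k1 (by
          rw [En_eval_root p a q m hq hqo hmo h2 s ((hSm s).1 hst.1), En_eval_root p a q m hq hqo hmo h2 t ((hSm t).1 hst.2)]
          intro h
          apply i2
          subst hq
          have := sub_pow_char_pow (p := p) (n := a) ((s + 1) ^ m) ((t + 1) ^ m)
          rw [h, sub_self] at this
          exact sub_eq_zero.mp (eq_zero_of_pow_eq_zero this))
        rw [this]; simp
  have hdeg : F.natDegree = A.natDegree + B.natDegree := by rw [hAB, hA.natDegree_mul hB]
  have hqm : 9 ≤ q * m := Nat.mul_le_mul hq3 hm3
  exact final_arith q m A.natDegree B.natDegree O.card _ hq3 hm3 (by omega) (by omega) (by omega) hOc hsum (by omega)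
end F24


section F25
variable {k : Type} [Field k] {M : Type} [Field M] [Algebra k M]

theorem sqfree_of_tf {F : k[X][X]} (hF : T1 F) (h : Squarefree (tf F)) : Squarefree F := by
  rintro x ⟨y, hy⟩
  have hl : IsUnit x.leadingCoeff := by
    have := congrArg leadingCoeff hy
    rw [hF.1.leadingCoeff, leadingCoeff_mul, leadingCoeff_mul, mul_assoc] at this
    exact IsUnit.of_mul_eq_one _ this.symm
  obtain ⟨u, hu⟩ := hl
  set x' : k[X][X] := C (↑u⁻¹ : k[X]) * x with hx'
  have hx : x = C (u : k[X]) * x' := by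
    rw [hx', ← mul_assoc, ← C_mul, Units.mul_inv, C_1, one_mul]
  have hm : x'.Monic := by
    rw [Monic, hx', leadingCoeff_mul, leadingCoeff_C, ← hu, Units.inv_mul]
  have hF2 : F = x' * (x' * (C (u * u : k[X]) * y)) := by
    rw [hy]; nth_rewrite 1 2 [hx]; rw [C_mul]; ring
  have hm2 : (x' * (C (u * u : k[X]) * y)).Monic := by
    have := hF.1
    rw [hF2] at this
    exact hm.of_mul_monic_left this
  have hT : T1 x' := T1.of_mul hm hm2 (hF2 ▸ hF)
  have hu' : IsUnit (tf x') := by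
    apply h
    refine ⟨tf (C (u * u : k[X]) * y), ?_⟩
    rw [mul_assoc, ← tf_mul x', ← tf_mul x', ← hF2]
  have h0 : x'.natDegree = 0 := by
    rw [← hT.tf_natDegree]; exact natDegree_eq_zero_of_isUnit hu'
  have h1 : x' = 1 := hm.natDegree_eq_zero.mp h0
  rw [hx, h1, mul_one]
  exact isUnit_C.mpr u.isUnit

theorem cequiv_En (e : k ≃+* k) (d : ℕ) : (En k d).map (e : k →+* k) = En k d := by
  rw [En]
  have h2 : e 2 = 2 := map_ofNat e 2
  simp [Polynomial.map_mul, Polynomial.map_add, Polynomial.map_pow, h2]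

theorem cequiv_C (e : k ≃+* k) (g : k[X]) : cequiv e (C g) = C (g.map (e : k →+* k)) := by
  simp [cequiv]

theorem cequiv_X (e : k ≃+* k) : cequiv e (X : k[X][X]) = X := by
  simp [cequiv]

theorem cequiv_mapC (e : k ≃+* k) (g : k[X]) : cequiv e (g.map C) = (g.map (e : k →+* k)).map C := by
  induction g using Polynomial.induction_on' with
  | add f g hf hg => simp only [Polynomial.map_add, map_add, hf, hg]
  | monomial n a =>
    rw [← C_mul_X_pow_eq_monomial]
    simp only [Polynomial.map_mul, Polynomial.map_pow, map_C, map_X, map_mul, map_pow, cequiv_C, cequiv_X]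

theorem cequiv_F (e : k ≃+* k) (d : ℕ) (F : k[X][X]) (hF : Tm (En k d) = (X ^ 2 - C (X ^ 2)) * F) :
    cequiv e F = F := by
  have h := congrArg (cequiv e) hF
  have h1 : cequiv e (Tm (En k d)) = Tm (En k d) := by
    rw [Tm, map_sub, cequiv_mapC, cequiv_C, cequiv_En]
  rw [h1, map_mul, map_sub, map_pow, cequiv_X, cequiv_C, Polynomial.map_pow, map_X, hF] at h
  have hne : (X ^ 2 - C (X ^ 2) : k[X][X]) ≠ 0 := (monic_X_pow_sub_C _ (by norm_num)).ne_zero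
  exact (mul_left_cancel₀ hne h).symm

theorem caseB (p : ℕ) [Fact p.Prime] [CharP k p] [IsAlgClosed k] (P : Place k M) (f : k[X]) (a q m : ℕ)
    (ha : 1 ≤ a) (hq : q = p ^ a) (hp : Odd p) (hmo : Odd m) (hm3 : 3 ≤ m) (hm : (m : k) ≠ 0)
    (hf : f.Monic) (hdeg : f.natDegree = q * m + 1) :
    ∃ N0 : ℕ, ∀ N ≥ N0, (∀ i, f.coeff i ^ (p ^ N) = f.coeff i) →
      ∃ a b c : k, a ^ (p ^ N) = a ∧ b ^ (p ^ N) = b ∧ c ^ (p ^ N) = c ∧ b ≠ 0 ∧ c ≠ 0 ∧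
        sd f a b c = 0 := by
  have hqo : Odd q := by rw [hq]; exact hp.pow
  have hpp : p.Prime := Fact.out
  have hp3 : 3 ≤ p := by
    have := hpp.two_le
    obtain ⟨j, hj⟩ := hp
    omega
  have hq3 : 3 ≤ q := by
    rw [hq]; exact hp3.trans (Nat.le_self_pow (by omega) p)
  have h2 : (2 : k) ≠ 0 := by
    intro h
    have h' : ((2 : ℕ) : k) = 0 := by exact_mod_cast h
    have := (CharP.cast_eq_zero_iff k p 2).mp h'
    have := Nat.le_of_dvd (by norm_num) this
    omega
  have hqk : (q : k) = 0 := by rw [hq, Nat.cast_pow, CharP.cast_eq_zero, zero_pow (by omega)]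
  have hdk : ((q * m + 1 : ℕ) : k) = 1 := by push_cast; rw [hqk]; ring
  have hev : Even (q * m + 1) := (hqo.mul hmo).add_one
  have hd2 : 2 ≤ q * m + 1 := by
    have : 9 ≤ q * m := Nat.mul_le_mul hq3 hm3
    omega
  obtain ⟨F, hF, hFd, hFT, hFt⟩ := exists_F (q * m + 1) hev hd2 h2
  obtain ⟨N0, hN0⟩ := caseB_fixed p P f (q * m + 1) hf hdeg hdk hd2 hev h2 F hF hFd hFT hFt
  refine ⟨N0, fun N hN hfix => ?_⟩
  have : PerfectRing k p := PerfectField.toPerfectRing p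
  set e := iterateFrobeniusEquiv k p N with he
  have hsq : Squarefree (tf F) := by
    have : Squarefree ((X ^ 2 - 1) * tf F) := by
      rw [hFt]; exact sqfree_Xd (q * m + 1) hdk
    exact this.squarefree_of_dvd (dvd_mul_left _ _)
  rcases split_F e F hFT.1 (sqfree_of_tf hFT hsq) (cequiv_F e _ F hF) with ⟨h, hm1, hi, hd, hc⟩ | ⟨A, B, hA, hB, hAB, h3, h4⟩
  · refine hN0 N hN hfix h hm1 hi hd ?_
    intro l i
    have := congrArg (fun g : k[X][X] => (g.coeff l).coeff i) hc
    simp only [cequiv, mapEquiv_apply, coeff_map] at this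
    change ((h.coeff l).map (e : k →+* k)).coeff i = _ at this
    rw [coeff_map] at this
    exact this
  · exact absurd hAB fun _ => caseB_contra p a q m ha hq hq3 hqo hmo hm3 h2 hm F A B hF hFd hFT hFt hA hB hAB h3 h4
end F25


section F26

theorem bridge (p n : ℕ) (hp : p.Prime) (hn : 0 < n) (K : Type) [Field K] [Fintype K] (hK : Fintype.card K = p ^ n)
    (k : Type) [Field k] [IsAlgClosed k] [Algebra K k] [CharP k p]
    (f : K[X]) (r : ℕ) (hr : 0 < r) (hpl : ∀ (L : Type) [Field L] [Fintype L] [Algebra K L],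
      Fintype.card L = Fintype.card K ^ r → IsPlanarOdd (fun x : L => Polynomial.aeval x f))
    (a b c : k) (ha : a ^ (p ^ (n * r)) = a) (hb : b ^ (p ^ (n * r)) = b) (hc : c ^ (p ^ (n * r)) = c)
    (hb0 : b ≠ 0) (hc0 : c ≠ 0) : sd (f.map (algebraMap K k)) a b c ≠ 0 := by
  classical
  intro hsd
  have : Fact p.Prime := ⟨hp⟩
  set Q := p ^ (n * r) with hQ
  have hQ0 : Q ≠ 0 := pow_ne_zero _ hp.ne_zero
  have hQ1 : 1 < Q := Nat.one_lt_pow (Nat.mul_pos hn hr).ne' hp.one_lt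
  let L : IntermediateField K k :=
    { carrier := {x | x ^ Q = x}
      mul_mem' := fun {x y} hx hy => by
        change (x * y) ^ Q = x * y
        rw [mul_pow, show x ^ Q = x from hx, show y ^ Q = y from hy]
      add_mem' := fun {x y} hx hy => by
        change (x + y) ^ Q = x + y
        rw [hQ, add_pow_char_pow, ← hQ, show x ^ Q = x from hx, show y ^ Q = y from hy]
      algebraMap_mem' := fun x => by
        change (algebraMap K k x) ^ Q = algebraMap K k x
        rw [← map_pow, hQ, pow_mul, ← hK, FiniteField.pow_card_pow]
      inv_mem' := fun x hx => by
        change (x⁻¹) ^ Q = x⁻¹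
        rw [inv_pow, show x ^ Q = x from hx] }
  have memL : ∀ x : k, x ∈ L ↔ x ^ Q = x := fun x => Iff.rfl
  set P : k[X] := X ^ Q - X with hP
  have hP0 : P ≠ 0 := FiniteField.X_pow_card_sub_X_ne_zero k hQ1
  have hPd : P.natDegree = Q := FiniteField.X_pow_card_sub_X_natDegree_eq k hQ1
  have memP : ∀ x : k, x ∈ P.roots.toFinset ↔ x ∈ L := by
    intro x
    rw [Multiset.mem_toFinset, mem_roots hP0, memL, IsRoot, hP]
    simp [sub_eq_zero]
  let : Fintype L := Fintype.subtype P.roots.toFinset memP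
  have hcard : Fintype.card L = Fintype.card K ^ r := by
    have h1 : Fintype.card L = P.roots.toFinset.card := Fintype.subtype_card _ memP
    rw [h1, hK, ← pow_mul, ← hQ]
    refine le_antisymm ?_ ?_
    · refine (Multiset.toFinset_card_le _).trans ?_
      rw [← hPd]; exact card_roots' P
    · obtain ⟨S, hS, hS'⟩ := fixed_card (k := k) p (n * r) (Nat.mul_pos hn hr)
      rw [hQ, ← hS]
      refine Finset.card_le_card fun x hx => ?_
      rw [memP]; exact hS' x hx
  have hplL := hpl L hcard
  let a' : L := ⟨a, ha⟩
  let b' : L := ⟨b, hb⟩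
  let c' : L := ⟨c, hc⟩
  have hb' : b' ≠ 0 := fun h => hb0 (congrArg Subtype.val h)
  have hinj := (hplL b' hb').1
  have key : a' + c' = a' := by
    apply hinj
    apply (algebraMap L k).injective
    simp only [map_sub, ← aeval_algebraMap_apply]
    simp only [map_add]
    change aeval (a + c + b) f - aeval (a + c) f = aeval (a + b) f - aeval a f
    rw [sd] at hsd
    simp only [aeval_map_algebraMap] at hsd
    rw [show a + c + b = a + b + c by ring]
    linear_combination hsd
  exact hc0 (congrArg Subtype.val (add_eq_left.mp key))


theorem main_aux
    (p n d : ℕ) (hp : p.Prime) (hodd : Odd p) (hn : 0 < n)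
    (K : Type) [Field K] [Fintype K] (k : Type) [Field k] [IsAlgClosed k] [Algebra K k] (hK : Fintype.card K = p ^ n)
    (f : K[X]) (hmonic : f.Monic) (hdeg : f.natDegree = d)
    (hd1 : d % p = 1) (hexc : IsExceptionalPlanarOdd f) :
    ∃ (κ : ℕ) (h : K[X]), 0 < κ ∧ f = X ^ (p ^ κ + 1) + h ∧
      h.natDegree < p ^ κ + 1 ∧
      ((p : ℤ) ∣ (h.natDegree : ℤ) ∨ (p : ℤ) ∣ (h.natDegree : ℤ) - 1) := by
  have hfp : Fact p.Prime := ⟨hp⟩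
  have hcK : CharP K p := by
    have h1 : ringChar K = p := by
      obtain ⟨c, hc⟩ := CharP.exists K
      obtain ⟨j, hpr, hj⟩ := FiniteField.card K c
      have : c ∣ p := by
        apply hpr.dvd_of_dvd_pow (n := n)
        rw [← hK, hj]
        exact dvd_pow_self _ j.pos.ne'
      rw [ringChar.eq_iff, ← (Nat.prime_dvd_prime_iff_eq hpr hp).mp this]
      exact hc
    rw [← h1]; exact ringChar.charP K
  have hck : CharP k p := charP_of_injective_algebraMap (algebraMap K k).injective p
  set φ := algebraMap K k with hφ
  have hfixed : ∀ (g : K[X]) (r i : ℕ), (g.map φ).coeff i ^ (p ^ (n * r)) = (g.map φ).coeff i := by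
    intro g r i
    rw [coeff_map, ← map_pow, pow_mul, ← hK, FiniteField.pow_card_pow]
  have hno : ¬ ∃ N0 : ℕ, ∀ N ≥ N0, (∀ g : K[X], ∀ i, (g.map φ).coeff i ^ (p ^ N) = (g.map φ).coeff i) →
      ∃ a b c : k, a ^ (p ^ N) = a ∧ b ^ (p ^ N) = b ∧ c ^ (p ^ N) = c ∧ b ≠ 0 ∧ c ≠ 0 ∧ sd (f.map φ) a b c = 0 := by
    rintro ⟨N0, hN0⟩
    obtain ⟨r, hr, hrN⟩ := hexc.exists_gt N0
    obtain ⟨a, b, c, ha, hb, hc, hb0, hc0, hsd⟩ := hN0 (n * r) (by nlinarith) (fun g i => hfixed g r i)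
    exact bridge p n hp hn K hK k f r hr.1 hr.2 a b c ha hb hc hb0 hc0 hsd
  obtain ⟨M, _, _, ⟨P⟩⟩ := exists_place k
  have hfm : (f.map φ).Monic := hmonic.map φ
  have hfd : (f.map φ).natDegree = d := by rw [natDegree_map, hdeg]
  have hp2 := hp.two_le
  have hd0 : 1 ≤ d := by
    rcases Nat.eq_zero_or_pos d with h | h
    · rw [h, Nat.zero_mod] at hd1; omega
    · exact h
  rcases Nat.eq_or_lt_of_le hd0 with hd | hd
  · exfalso
    apply hno
    refine ⟨0, fun N _ _ => ⟨0, 1, 1, zero_pow (pow_ne_zero _ hp.ne_zero), one_pow _, one_pow _, one_ne_zero, one_ne_zero, ?_⟩⟩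
    have h1 : f.map φ = X + C ((f.map φ).coeff 0) := by
      have := hfm.eq_X_add_C (by rw [hfd, hd])
      exact this
    rw [h1, sd]
    simp
  have hdm : p ∣ d - 1 := (Nat.modEq_iff_dvd' hd0).mp (by rw [Nat.ModEq, hd1, Nat.mod_eq_of_lt hp.one_lt])
  obtain ⟨a, m, hpm, ham⟩ := Nat.exists_eq_pow_mul_and_not_dvd (n := d - 1) (by omega) p hp.ne_one
  have ha : 1 ≤ a := by
    rcases Nat.eq_zero_or_pos a with h | h
    · rw [h, pow_zero, one_mul] at ham
      exact absurd (ham ▸ hdm) hpm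
    · exact h
  set q := p ^ a with hq
  have hdq : d = q * m + 1 := by omega
  have hqo : Odd q := hodd.pow
  have hm0 : (m : k) ≠ 0 := fun h => hpm ((CharP.cast_eq_zero_iff k p m).mp h)
  have hqk : (q : k) = 0 := by rw [hq, Nat.cast_pow, CharP.cast_eq_zero, zero_pow (by omega)]
  have hdk : (d : k) = 1 := by rw [hdq, Nat.cast_add, Nat.cast_mul, hqk]; simp
  rcases Nat.even_or_odd m with hme | hmo
  · exfalso
    apply hno
    have hdo : Odd d := by rw [hdq]; exact (hme.mul_left q).add_one
    obtain ⟨N0, hN0⟩ := caseA p P (f.map φ) d hfm hfd hdk hd hdo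
    exact ⟨N0, fun N hN h => hN0 N hN (h f)⟩
  by_cases hm1 : m = 1
  · rw [hm1, mul_one] at hdq
    have hlt : (f - X ^ (q + 1)).natDegree < q + 1 := by
      have h1 : (f - X ^ (q + 1)).degree < f.degree := by
        refine degree_sub_lt_left ?_ hmonic.ne_zero ?_
        · rw [degree_X_pow, degree_eq_natDegree hmonic.ne_zero, hdeg, hdq]
        · rw [hmonic.leadingCoeff, (monic_X_pow (q + 1)).leadingCoeff]
      rw [degree_eq_natDegree hmonic.ne_zero, hdeg, hdq] at h1
      by_cases h0 : f - X ^ (q + 1) = 0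
      · rw [h0, natDegree_zero]; omega
      · rwa [degree_eq_natDegree h0, Nat.cast_lt] at h1
    refine ⟨a, f - X ^ (q + 1), ha, by ring, hlt, ?_⟩
    by_contra hcon
    push Not at hcon
    apply hno
    set h := f - X ^ (q + 1) with hh
    set e := h.natDegree with he
    have he0 : (e : k) ≠ 0 := by
      intro h0
      have := (CharP.cast_eq_zero_iff k p e).mp h0
      exact hcon.1 (by exact_mod_cast this)
    have he1 : (e : k) ≠ 1 := by
      intro h0
      have h1 : (((e : ℤ) - 1 : ℤ) : k) = 0 := by push_cast; rw [h0, sub_self]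
      exact hcon.2 ((CharP.intCast_eq_zero_iff k p _).mp h1)
    obtain ⟨N0, hN0⟩ := caseC p P (h.map φ) a q e ha hq (by rw [natDegree_map]) hlt he0 he1
    refine ⟨N0, fun N hN hf => ?_⟩
    have hfe : f.map φ = X ^ (q + 1) + h.map φ := by
      rw [hh, Polynomial.map_sub, Polynomial.map_pow, map_X]; ring
    rw [hfe]
    exact hN0 N hN (hf h)
  · exfalso
    apply hno
    have hm3 : 3 ≤ m := by
      obtain ⟨j, hj⟩ := hmo
      omega
    obtain ⟨N0, hN0⟩ := caseB p P (f.map φ) a q m ha hq hodd hmo hm3 hm0 hfm (hfd.trans hdq)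
    exact ⟨N0, fun N hN h => hN0 N hN (h f)⟩
end F26

theorem exceptional_planar_monic_deg_one_mod_p
    (p n d : ℕ) (hp : p.Prime) (hodd : Odd p) (hn : 0 < n)
    (K : Type) [Field K] [Fintype K] (hK : Fintype.card K = p ^ n)
    (f : K[X]) (hmonic : f.Monic) (hdeg : f.natDegree = d)
    (hd1 : d % p = 1) (hexc : IsExceptionalPlanarOdd f) :
    ∃ (k : ℕ) (h : K[X]), 0 < k ∧ f = X ^ (p ^ k + 1) + h ∧
      h.natDegree < p ^ k + 1 ∧
      ((p : ℤ) ∣ (h.natDegree : ℤ) ∨ (p : ℤ) ∣ (h.natDegree : ℤ) - 1) := by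
  exact main_aux p n d hp hodd hn K (AlgebraicClosure K) hK f hmonic hdeg hd1 hexc
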